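/- arXiv:1511.00954 — 3 statements merged into one kernel-verified Lean document; each statement's English description precedes it below -/
import Mathlib

section
/- Let n be a positive integer. Then the sum, over all partitions λ of n, of the square of the number f^λ of standard Young tableaux of shape λ equals n!: Σ_{λ ⊢ n} (f^λ)² = n!. -/
open Nat

/-- A filling of a Young diagram `μ`, given as a bijection from the cells of `μ` to
`Fin μ.card` (entry `j` meaning the number `j+1`), is standard if the entries strictly
increase along each row and along each column. -/
def IsStandardYT (μ : YoungDiagram) (T : ↥μ.cells ≃ Fin μ.card) : Prop :=
  (∀ c d : μ.cells, (c : ℕ × ℕ).1 = (d : ℕ × ℕ).1 → (c : ℕ × ℕ).2 < (d : ℕ × ℕ).2 → T c < T d) ∧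
  (∀ c d : μ.cells, (c : ℕ × ℕ).2 = (d : ℕ × ℕ).2 → (c : ℕ × ℕ).1 < (d : ℕ × ℕ).1 → T c < T d)

/-- `f^μ`, the number of standard Young tableaux of shape `μ`. -/
noncomputable def sytCard (μ : YoungDiagram) : ℕ :=
  Nat.card {T : ↥μ.cells ≃ Fin μ.card // IsStandardYT μ T}

/-- The Young diagram of a partition `p` of `n`. -/
def diagramOfPartition {n : ℕ} (p : n.Partition) : YoungDiagram :=
  YoungDiagram.ofRowLens (p.parts.sort (· ≥ ·)) ((Multiset.pairwise_sort p.parts (· ≥ ·)).sortedGE)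


/-- The number of cells of a diagram built from row lengths. -/
lemma syt_card_cellsOfRowLens (w : List ℕ) :
    (YoungDiagram.cellsOfRowLens w).card = w.sum := by
  induction w with
  | nil => simp [YoungDiagram.cellsOfRowLens]
  | cons a w ih =>
    rw [YoungDiagram.cellsOfRowLens, Finset.card_union_of_disjoint]
    · simp [ih]
    · rw [Finset.disjoint_left]
      rintro ⟨i, j⟩ h1 h2
      simp at h1 h2
      omega

lemma syt_card_ofRowLens (w : List ℕ) (h : w.SortedGE) :
    (YoungDiagram.ofRowLens w h).card = w.sum := syt_card_cellsOfRowLens w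

lemma syt_card_diagram {n : ℕ} (p : n.Partition) : (diagramOfPartition p).card = n := by
  rw [diagramOfPartition, syt_card_ofRowLens, ← Multiset.sum_coe, Multiset.sort_eq, p.parts_sum]

lemma syt_rowLens_diagram {n : ℕ} (p : n.Partition) :
    ((diagramOfPartition p).rowLens : Multiset ℕ) = p.parts := by
  rw [diagramOfPartition, YoungDiagram.rowLens_ofRowLens_eq_self, Multiset.sort_eq]
  intro x hx
  exact p.parts_pos (by simpa using hx)

lemma syt_diagram_injective (n : ℕ) :
    Function.Injective (diagramOfPartition : n.Partition → YoungDiagram) := by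
  intro p q h
  ext1
  rw [← syt_rowLens_diagram, h, syt_rowLens_diagram]

lemma syt_sum_rowLens (μ : YoungDiagram) : μ.rowLens.sum = μ.card := by
  rw [← syt_card_ofRowLens _ μ.rowLens_sorted, YoungDiagram.ofRowLens_to_rowLens_eq_self]

lemma syt_diagram_surj (μ : YoungDiagram) :
    ∃ p : μ.card.Partition, diagramOfPartition p = μ := by
  refine ⟨⟨(μ.rowLens : Multiset ℕ), ?_, ?_⟩, ?_⟩
  · intro i hi
    exact μ.pos_of_mem_rowLens i (by simpa using hi)
  · rw [Multiset.sum_coe, syt_sum_rowLens]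
  · have : ((μ.rowLens : Multiset ℕ).sort (· ≥ ·)) = μ.rowLens := by
      rw [Multiset.coe_sort]
      apply List.mergeSort_of_pairwise
      have := μ.rowLens_sorted.pairwise
      simpa using this
    simp only [diagramOfPartition]
    conv_rhs => rw [← @YoungDiagram.ofRowLens_to_rowLens_eq_self μ]
    congr 1

open Classical in
/-- Level `n` of the Young lattice. -/
noncomputable def sytLevel (n : ℕ) : Finset YoungDiagram :=
  (Finset.univ : Finset n.Partition).image diagramOfPartition

lemma mem_sytLevel {n : ℕ} {μ : YoungDiagram} : μ ∈ sytLevel n ↔ μ.card = n := by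
  simp only [sytLevel, Finset.mem_image, Finset.mem_univ, true_and]
  constructor
  · rintro ⟨p, rfl⟩
    exact syt_card_diagram p
  · rintro rfl
    exact syt_diagram_surj μ

lemma sum_sytLevel (n : ℕ) (F : YoungDiagram → ℕ) :
    ∑ p : n.Partition, F (diagramOfPartition p) = ∑ μ ∈ sytLevel n, F μ := by
  classical
  rw [sytLevel, Finset.sum_image]
  exact fun p _ q _ h => syt_diagram_injective n h

lemma syt_eq_of_le_of_card_le {μ ν : YoungDiagram} (h : μ ≤ ν) (hc : ν.card ≤ μ.card) :
    μ = ν :=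
  YoungDiagram.ext (Finset.eq_of_subset_of_card_le (YoungDiagram.cells_subset_iff.2 h) hc)

lemma syt_card_mono {μ ν : YoungDiagram} (h : μ ≤ ν) : μ.card ≤ ν.card :=
  Finset.card_le_card (YoungDiagram.cells_subset_iff.2 h)

lemma syt_row_lt_card {μ : YoungDiagram} {i : ℕ} (h : 0 < μ.rowLen i) : i < μ.card := by
  rw [← YoungDiagram.mem_iff_lt_rowLen, YoungDiagram.mem_iff_lt_colLen,
    YoungDiagram.colLen_eq_card] at h
  exact h.trans_le (Finset.card_le_card (Finset.filter_subset _ _))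

open Classical in
/-- Two different diagrams of the same size have as many common upper covers as common
lower covers. -/
lemma syt_card_up_down_ne {n : ℕ} {κ ν : YoungDiagram} (hκ : κ.card = n + 1)
    (hν : ν.card = n + 1) (hne : κ ≠ ν) :
    ((sytLevel (n + 2)).filter (fun μ => ν ≤ μ ∧ κ ≤ μ)).card =
      ((sytLevel n).filter (fun ρ => ρ ≤ ν ∧ ρ ≤ κ)).card := by
  have hsum : (ν ⊔ κ).card + (ν ⊓ κ).card = ν.card + κ.card :=
    Finset.card_union_add_card_inter _ _
  have hlt : n + 2 ≤ (ν ⊔ κ).card := by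
    by_contra hcon
    have h1 : ν = ν ⊔ κ := syt_eq_of_le_of_card_le le_sup_left (by omega)
    have h2 : κ = ν ⊔ κ := syt_eq_of_le_of_card_le le_sup_right (by omega)
    exact hne (h2.trans h1.symm)
  by_cases hs : (ν ⊔ κ).card = n + 2
  · have e1 : (sytLevel (n + 2)).filter (fun μ => ν ≤ μ ∧ κ ≤ μ) = {ν ⊔ κ} := by
      ext μ
      simp only [Finset.mem_filter, mem_sytLevel, Finset.mem_singleton]
      constructor
      · rintro ⟨h, h1, h2⟩
        exact (syt_eq_of_le_of_card_le (sup_le h1 h2) (by omega)).symm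
      · rintro rfl
        exact ⟨hs, le_sup_left, le_sup_right⟩
    have e2 : (sytLevel n).filter (fun ρ => ρ ≤ ν ∧ ρ ≤ κ) = {ν ⊓ κ} := by
      ext μ
      simp only [Finset.mem_filter, mem_sytLevel, Finset.mem_singleton]
      constructor
      · rintro ⟨h, h1, h2⟩
        exact syt_eq_of_le_of_card_le (le_inf h1 h2) (by omega)
      · rintro rfl
        exact ⟨by omega, inf_le_left, inf_le_right⟩
    rw [e1, e2, Finset.card_singleton, Finset.card_singleton]
  · rw [Finset.filter_eq_empty_iff.2, Finset.filter_eq_empty_iff.2]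
    · rintro ρ hρ ⟨h1, h2⟩
      rw [mem_sytLevel] at hρ
      have := syt_card_mono (le_inf h1 h2)
      omega
    · rintro ρ hρ ⟨h1, h2⟩
      rw [mem_sytLevel] at hρ
      have := syt_card_mono (sup_le h1 h2)
      omega

open Classical in
/-- Add a cell at the end of row `i`, when possible. -/
noncomputable def sytAdd (ν : YoungDiagram) (i : ℕ) : YoungDiagram :=
  if h : IsLowerSet ((insert (i, ν.rowLen i) ν.cells : Finset (ℕ × ℕ)) : Set (ℕ × ℕ)) then
    ⟨insert (i, ν.rowLen i) ν.cells, h⟩ else ν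

open Classical in
/-- Remove the last cell of row `i`, when possible. -/
noncomputable def sytRem (ν : YoungDiagram) (i : ℕ) : YoungDiagram :=
  if h : IsLowerSet ((ν.cells.erase (i, ν.rowLen i - 1) : Finset (ℕ × ℕ)) : Set (ℕ × ℕ)) then
    ⟨ν.cells.erase (i, ν.rowLen i - 1), h⟩ else ν

lemma sytAdd_cells {ν : YoungDiagram} {i : ℕ} (h : i = 0 ∨ ν.rowLen i < ν.rowLen (i - 1)) :
    (sytAdd ν i).cells = insert (i, ν.rowLen i) ν.cells := by
  rw [sytAdd, dif_pos]
  rintro ⟨a, b⟩ ⟨c, d⟩ hle hab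
  obtain ⟨hca, hdb⟩ := Prod.mk_le_mk.1 hle
  simp only [Finset.coe_insert, Set.mem_insert_iff, Prod.mk.injEq, Finset.mem_coe,
    YoungDiagram.mem_cells, YoungDiagram.mem_iff_lt_rowLen] at hab ⊢
  rcases hab with ⟨rfl, rfl⟩ | hab
  · rcases Nat.lt_or_ge c a with hlt | hge
    · right
      have := ν.rowLen_anti c (a - 1) (by omega)
      omega
    · have : c = a := by omega
      subst this
      omega
  · right
    have := ν.rowLen_anti c a hca
    omega

lemma sytRem_cells {ν : YoungDiagram} {i : ℕ} (h : ν.rowLen (i + 1) < ν.rowLen i) :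
    (sytRem ν i).cells = ν.cells.erase (i, ν.rowLen i - 1) := by
  rw [sytRem, dif_pos]
  rintro ⟨a, b⟩ ⟨c, d⟩ hle hab
  obtain ⟨hca, hdb⟩ := Prod.mk_le_mk.1 hle
  simp only [Finset.coe_erase, Set.mem_sdiff, Set.mem_singleton_iff, Prod.mk.injEq,
    Finset.mem_coe, YoungDiagram.mem_cells, YoungDiagram.mem_iff_lt_rowLen] at hab ⊢
  have h1 := ν.rowLen_anti c a hca
  refine ⟨by omega, ?_⟩
  rintro ⟨rfl, rfl⟩
  rcases Nat.lt_or_ge c a with hlt | hge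
  · have := ν.rowLen_anti (c + 1) a (by omega)
    omega
  · have : c = a := by omega
    subst this
    omega

lemma syt_exists_insert {μ ν : YoungDiagram} (h : ν ≤ μ) (hc : μ.card = ν.card + 1) :
    ∃ c, c ∉ ν.cells ∧ μ.cells = insert c ν.cells := by
  have hs := YoungDiagram.cells_subset_iff.2 h
  have h1 : (μ.cells \ ν.cells).card = 1 := by
    have hc1 : μ.cells.card = ν.cells.card + 1 := hc
    rw [Finset.card_sdiff_of_subset hs]; omega
  obtain ⟨c, hc⟩ := Finset.card_eq_one.1 h1
  refine ⟨c, ?_, ?_⟩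
  · have : c ∈ μ.cells \ ν.cells := by rw [hc]; simp
    exact (Finset.mem_sdiff.1 this).2
  · rw [Finset.insert_eq, ← hc, Finset.sdiff_union_of_subset hs]

open Classical in
lemma syt_card_up {n : ℕ} {ν : YoungDiagram} (hν : ν.card = n) :
    ((sytLevel (n + 1)).filter (fun μ => ν ≤ μ)).card =
      ((Finset.range (n + 1)).filter (fun i => i = 0 ∨ ν.rowLen i < ν.rowLen (i - 1))).card := by
  symm
  have hnot : ∀ i, (i, ν.rowLen i) ∉ ν.cells := fun i => by
    simp [YoungDiagram.mem_iff_lt_rowLen]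
  apply Finset.card_bij (fun i _ => sytAdd ν i)
  · intro i hi
    simp only [Finset.mem_filter] at hi
    have h := sytAdd_cells hi.2
    simp only [Finset.mem_filter, mem_sytLevel, ← YoungDiagram.cells_subset_iff,
      YoungDiagram.card, h]
    refine ⟨?_, Finset.subset_insert _ _⟩
    rw [Finset.card_insert_of_notMem (hnot i)]
    exact congrArg (· + 1) hν
  · intro i hi j hj hij
    simp only [Finset.mem_filter] at hi hj
    have h1 := sytAdd_cells hi.2
    have h2 := sytAdd_cells hj.2

    rw [hij, h2] at h1
    have h3 : (i, ν.rowLen i) ∈ insert (j, ν.rowLen j) ν.cells := by rw [h1]; simp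
    rcases Finset.mem_insert.1 h3 with h | h
    · exact (Prod.mk.inj h).1
    · exact absurd h (hnot i)
  · intro μ hμ
    simp only [Finset.mem_filter, mem_sytLevel] at hμ
    obtain ⟨⟨i, j⟩, hc, he⟩ := syt_exists_insert hμ.2 (by omega)
    have hm : ∀ a b, (a, b) ∈ μ ↔ (a = i ∧ b = j) ∨ b < ν.rowLen a := by
      intro a b
      rw [← YoungDiagram.mem_cells, he]
      simp [YoungDiagram.mem_iff_lt_rowLen]
    have hc' : ν.rowLen i ≤ j := by
      simpa [YoungDiagram.mem_iff_lt_rowLen] using hc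
    have hij : (i, j) ∈ μ := (hm i j).2 (Or.inl ⟨rfl, rfl⟩)
    have hj : ν.rowLen i = j := by
      have := (hm i (ν.rowLen i)).1 (μ.up_left_mem le_rfl hc' hij)
      omega
    have hi : i = 0 ∨ ν.rowLen i < ν.rowLen (i - 1) := by
      rcases Nat.eq_zero_or_pos i with h | h
      · exact Or.inl h
      · right
        have := (hm (i - 1) j).1 (μ.up_left_mem (by omega) le_rfl hij)
        omega
    refine ⟨i, ?_, ?_⟩
    · simp only [Finset.mem_filter, Finset.mem_range]
      refine ⟨?_, hi⟩
      rcases hi with h | h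
      · omega
      · have := syt_row_lt_card (μ := ν) (i := i - 1) (by omega)
        omega
    · apply YoungDiagram.ext
      rw [sytAdd_cells hi, he, hj]

open Classical in
lemma syt_card_down {n : ℕ} {ν : YoungDiagram} (hν : ν.card = n + 1) :
    ((sytLevel n).filter (fun ρ => ρ ≤ ν)).card =
      ((Finset.range (n + 1)).filter (fun i => ν.rowLen (i + 1) < ν.rowLen i)).card := by
  symm
  have hin : ∀ i, ν.rowLen (i + 1) < ν.rowLen i → (i, ν.rowLen i - 1) ∈ ν.cells := by
    intro i h
    simp only [YoungDiagram.mem_cells, YoungDiagram.mem_iff_lt_rowLen]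
    omega
  apply Finset.card_bij (fun i _ => sytRem ν i)
  · intro i hi
    simp only [Finset.mem_filter] at hi
    have h := sytRem_cells hi.2
    simp only [Finset.mem_filter, mem_sytLevel, ← YoungDiagram.cells_subset_iff,
      YoungDiagram.card, h]
    refine ⟨?_, Finset.erase_subset _ _⟩
    rw [Finset.card_erase_of_mem (hin i hi.2)]
    exact congrArg (· - 1) hν
  · intro i hi j hj hij
    simp only [Finset.mem_filter] at hi hj
    have h1 := sytRem_cells hi.2
    have h2 := sytRem_cells hj.2

    rw [hij, h2] at h1
    by_contra hne
    have h3 : (i, ν.rowLen i - 1) ∈ ν.cells.erase (j, ν.rowLen j - 1) :=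
      Finset.mem_erase.2 ⟨fun h => hne (Prod.mk.inj h).1, hin i hi.2⟩
    rw [h1] at h3
    simp at h3
  · intro ρ hρ
    simp only [Finset.mem_filter, mem_sytLevel] at hρ
    obtain ⟨⟨i, j⟩, hc, he⟩ := syt_exists_insert hρ.2 (by omega)
    have hm : ∀ a b, b < ν.rowLen a ↔ (a = i ∧ b = j) ∨ (a, b) ∈ ρ := by
      intro a b
      rw [← YoungDiagram.mem_iff_lt_rowLen, ← YoungDiagram.mem_cells, he]
      simp
    have hij : j < ν.rowLen i := (hm i j).2 (Or.inl ⟨rfl, rfl⟩)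
    have hj : ν.rowLen i - 1 = j := by
      by_contra hne
      rcases (hm i (ν.rowLen i - 1)).1 (by omega) with h | h
      · omega
      · exact hc (ρ.up_left_mem le_rfl (by omega) h)
    have hi : ν.rowLen (i + 1) < ν.rowLen i := by
      by_contra hcon
      rcases (hm (i + 1) j).1 (by omega) with h | h
      · omega
      · exact hc (ρ.up_left_mem (by omega) le_rfl h)
    refine ⟨i, ?_, ?_⟩
    · simp only [Finset.mem_filter, Finset.mem_range]
      refine ⟨?_, hi⟩
      have := syt_row_lt_card (μ := ν) (i := i) (by omega)
      omega
    · apply YoungDiagram.ext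
      rw [sytRem_cells hi, he, hj, Finset.erase_insert hc]

open Classical in
lemma syt_card_up_down {n : ℕ} {ν : YoungDiagram} (hν : ν.card = n + 1) :
    ((sytLevel (n + 2)).filter (fun μ => ν ≤ μ)).card =
      ((sytLevel n).filter (fun ρ => ρ ≤ ν)).card + 1 := by
  rw [syt_card_up hν, syt_card_down hν]
  rw [Finset.card_filter, Finset.card_filter, Finset.sum_range_succ']
  simp

open Classical in
lemma syt_card_up_down_all {n : ℕ} {κ ν : YoungDiagram} (hκ : κ.card = n + 1)
    (hν : ν.card = n + 1) :
    ((sytLevel (n + 2)).filter (fun μ => ν ≤ μ ∧ κ ≤ μ)).card =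
      ((sytLevel n).filter (fun ρ => ρ ≤ ν ∧ ρ ≤ κ)).card + if κ = ν then 1 else 0 := by
  by_cases h : κ = ν
  · subst h
    simpa using syt_card_up_down hν
  · simpa [h] using syt_card_up_down_ne hκ hν h

/-- Standard fillings as functions on the whole grid, vanishing outside of the diagram. -/
structure IsSytFun (μ : YoungDiagram) (t : ℕ × ℕ → ℕ) : Prop where
  zero : ∀ c, c ∉ μ.cells → t c = 0
  inj : Set.InjOn t (μ.cells : Set (ℕ × ℕ))
  img : μ.cells.image t = Finset.range μ.cells.card
  row : ∀ i j j', (i, j') ∈ μ.cells → j < j' → t (i, j) < t (i, j')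
  col : ∀ i i' j, (i', j) ∈ μ.cells → i < i' → t (i, j) < t (i', j)

lemma IsSytFun.lt {μ : YoungDiagram} {t : ℕ × ℕ → ℕ} (h : IsSytFun μ t) {c : ℕ × ℕ}
    (hc : c ∈ μ.cells) : t c < μ.cells.card := by
  rw [← Finset.mem_range, ← h.img]
  exact Finset.mem_image_of_mem _ hc

lemma IsSytFun.mono {μ : YoungDiagram} {t : ℕ × ℕ → ℕ} (h : IsSytFun μ t) {c d : ℕ × ℕ}
    (hd : d ∈ μ.cells) (hcd : c ≤ d) : t c ≤ t d := by
  obtain ⟨i, j⟩ := c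
  obtain ⟨i', j'⟩ := d
  obtain ⟨hi, hj⟩ := Prod.mk_le_mk.1 hcd
  have h1 : t (i, j) ≤ t (i, j') := by
    rcases hj.eq_or_lt with rfl | hlt
    · exact le_rfl
    · exact (h.row i j j' (μ.up_left_mem hi le_rfl hd) hlt).le
  have h2 : t (i, j') ≤ t (i', j') := by
    rcases hi.eq_or_lt with rfl | hlt
    · exact le_rfl
    · exact (h.col i i' j' hd hlt).le
  exact h1.trans h2

open Classical in
/-- The function on the grid attached to a filling. -/
noncomputable def sytToFun (μ : YoungDiagram) (T : ↥μ.cells ≃ Fin μ.card) (c : ℕ × ℕ) : ℕ :=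
  if h : c ∈ μ.cells then (T ⟨c, h⟩ : ℕ) else 0

lemma sytToFun_of_mem {μ : YoungDiagram} (T : ↥μ.cells ≃ Fin μ.card) {c : ℕ × ℕ}
    (h : c ∈ μ.cells) : sytToFun μ T c = T ⟨c, h⟩ := by
  rw [sytToFun, dif_pos h]

lemma isSytFun_sytToFun {μ : YoungDiagram} {T : ↥μ.cells ≃ Fin μ.card}
    (hT : IsStandardYT μ T) : IsSytFun μ (sytToFun μ T) where
  zero c hc := by rw [sytToFun, dif_neg hc]
  inj := by
    intro c hc d hd hcd
    rw [sytToFun_of_mem T hc, sytToFun_of_mem T hd] at hcd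
    exact congrArg Subtype.val (T.injective (Fin.ext hcd))
  img := by
    ext k
    simp only [Finset.mem_image, Finset.mem_range]
    constructor
    · rintro ⟨c, hc, rfl⟩
      rw [sytToFun_of_mem T hc]
      exact (T ⟨c, hc⟩).2
    · intro hk
      refine ⟨(T.symm ⟨k, hk⟩).1, (T.symm ⟨k, hk⟩).2, ?_⟩
      rw [sytToFun_of_mem T (T.symm ⟨k, hk⟩).2]
      simp
  row i j j' h hlt := by
    have h' : (i, j) ∈ μ.cells := μ.up_left_mem le_rfl hlt.le h
    rw [sytToFun_of_mem T h', sytToFun_of_mem T h]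
    exact hT.1 ⟨_, h'⟩ ⟨_, h⟩ rfl hlt
  col i i' j h hlt := by
    have h' : (i, j) ∈ μ.cells := μ.up_left_mem hlt.le le_rfl h
    rw [sytToFun_of_mem T h', sytToFun_of_mem T h]
    exact hT.2 ⟨_, h'⟩ ⟨_, h⟩ rfl hlt

lemma syt_toFun_bijective (μ : YoungDiagram) :
    Function.Bijective (fun T : {T : ↥μ.cells ≃ Fin μ.card // IsStandardYT μ T} =>
      (⟨sytToFun μ T.1, isSytFun_sytToFun T.2⟩ : {t // IsSytFun μ t})) := by
  constructor
  · rintro ⟨T, hT⟩ ⟨T', hT'⟩ h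
    have h' : sytToFun μ T = sytToFun μ T' := congrArg Subtype.val h
    apply Subtype.ext
    apply Equiv.ext
    rintro ⟨c, hc⟩
    apply Fin.ext
    rw [← sytToFun_of_mem T hc, h', sytToFun_of_mem T' hc]
  · rintro ⟨t, ht⟩
    have hb : Function.Bijective
        (fun c : ↥μ.cells => (⟨t c, ht.lt c.2⟩ : Fin μ.card)) := by
      rw [Fintype.bijective_iff_injective_and_card]
      refine ⟨?_, by simp⟩
      intro c d hcd
      exact Subtype.ext (ht.inj c.2 d.2 (congrArg Fin.val hcd))
    refine ⟨⟨Equiv.ofBijective _ hb, ?_, ?_⟩, ?_⟩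
    · rintro ⟨⟨i, j⟩, hc⟩ ⟨⟨i', j'⟩, hd⟩ h1 h2
      dsimp only at h1 h2
      subst h1
      exact ht.row _ _ _ hd h2
    · rintro ⟨⟨i, j⟩, hc⟩ ⟨⟨i', j'⟩, hd⟩ h1 h2
      dsimp only at h1 h2
      subst h1
      exact ht.col _ _ _ hd h2
    · apply Subtype.ext
      funext c
      by_cases hc : c ∈ μ.cells
      · exact sytToFun_of_mem _ hc
      · exact (dif_neg hc).trans (ht.zero c hc).symm

lemma sytFun_finite (μ : YoungDiagram) : {t | IsSytFun μ t}.Finite := by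
  have : Finite {t // IsSytFun μ t} := Finite.of_surjective _ (syt_toFun_bijective μ).2
  exact this

/-- The finset of standard fillings. -/
noncomputable def sytFuns (μ : YoungDiagram) : Finset (ℕ × ℕ → ℕ) := (sytFun_finite μ).toFinset

lemma mem_sytFuns {μ : YoungDiagram} {t : ℕ × ℕ → ℕ} : t ∈ sytFuns μ ↔ IsSytFun μ t := by
  simp [sytFuns]

lemma sytCard_eq (μ : YoungDiagram) : sytCard μ = (sytFuns μ).card := by
  rw [sytCard, Nat.card_eq_of_bijective _ (syt_toFun_bijective μ), sytFuns,
    ← Set.ncard_eq_toFinset_card _ (sytFun_finite μ)]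
  rfl

open Classical in
/-- Extend a filling of `ν` by the value `n` on the new cells of `μ`. -/
noncomputable def sytExtend (μ ν : YoungDiagram) (n : ℕ) (s : ℕ × ℕ → ℕ) (c : ℕ × ℕ) : ℕ :=
  if c ∈ ν.cells then s c else if c ∈ μ.cells then n else 0

lemma isSytFun_sytExtend {μ ν : YoungDiagram} {n : ℕ} {s : ℕ × ℕ → ℕ} (hν : ν.card = n)
    (hμ : μ.card = n + 1) (hle : ν ≤ μ) (hs : IsSytFun ν s) :
    IsSytFun μ (sytExtend μ ν n s) := by
  obtain ⟨c₀, hc₀, he⟩ := syt_exists_insert hle (by rw [hμ, hν])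
  have hlt : ∀ c ∈ ν.cells, s c < n := fun c hc => hν ▸ hs.lt hc
  have e0 : sytExtend μ ν n s c₀ = n := by simp [sytExtend, hc₀, he]
  have e1 : ∀ c ∈ ν.cells, sytExtend μ ν n s c = s c := fun c hc => by
    rw [sytExtend, if_pos hc]
  have hmem : ∀ {c}, c ∈ μ.cells → c = c₀ ∨ c ∈ ν.cells := fun {c} h => by
    simpa [he] using h
  -- any cell strictly below a cell of `μ` lies in `ν`
  have hbelow : ∀ c d, d ∈ μ.cells → c ≤ d → c ≠ d → c ∈ ν.cells := by
    intro c d hd hcd hne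
    rcases hmem (μ.isLowerSet hcd hd) with rfl | h
    · rcases hmem hd with rfl | h'
      · exact absurd rfl hne
      · exact absurd (ν.isLowerSet hcd h') hc₀
    · exact h
  refine ⟨?_, ?_, ?_, ?_, ?_⟩
  · intro c hc
    have : c ∉ ν.cells := fun h => hc (by rw [he]; exact Finset.mem_insert_of_mem h)
    rw [sytExtend, if_neg this, if_neg hc]
  · intro c hc d hd hcd
    rcases hmem hc with rfl | hc' <;> rcases hmem hd with rfl | hd'
    · rfl
    · rw [e0, e1 d hd'] at hcd
      exact absurd hcd (hlt d hd').ne'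
    · rw [e0, e1 c hc'] at hcd
      exact absurd hcd (hlt c hc').ne
    · rw [e1 c hc', e1 d hd'] at hcd
      exact hs.inj hc' hd' hcd
  · have hμ' : μ.cells.card = n + 1 := hμ
    have hν' : ν.cells.card = n := hν
    rw [hμ', he, Finset.image_insert, e0, Finset.range_add_one, Finset.image_congr (g := s),
      hs.img, hν']
    exact fun c hc => e1 c hc
  · intro i j j' hd hlt'
    have hc := hbelow (i, j) (i, j') hd (Prod.mk_le_mk.2 ⟨le_rfl, hlt'.le⟩)
      (fun h => hlt'.ne (Prod.mk.inj h).2)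
    rw [e1 _ hc]
    rcases hmem hd with h | h
    · rw [h, e0]; exact hlt _ hc
    · rw [e1 _ h]; exact hs.row _ _ _ h hlt'
  · intro i i' j hd hlt'
    have hc := hbelow (i, j) (i', j) hd (Prod.mk_le_mk.2 ⟨hlt'.le, le_rfl⟩)
      (fun h => hlt'.ne (Prod.mk.inj h).1)
    rw [e1 _ hc]
    rcases hmem hd with h | h
    · rw [h, e0]; exact hlt _ hc
    · rw [e1 _ h]; exact hs.col _ _ _ h hlt'

lemma mem_iff_sytExtend {μ ν : YoungDiagram} {n : ℕ} {s : ℕ × ℕ → ℕ} (hν : ν.card = n)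
    (hle : ν ≤ μ) (hs : IsSytFun ν s) (c : ℕ × ℕ) :
    c ∈ ν.cells ↔ c ∈ μ.cells ∧ sytExtend μ ν n s c < n := by
  constructor
  · intro h
    refine ⟨YoungDiagram.cells_subset_iff.2 hle h, ?_⟩
    rw [sytExtend, if_pos h]
    exact hν ▸ hs.lt h
  · rintro ⟨h, h'⟩
    by_contra hc
    rw [sytExtend, if_neg hc, if_pos h] at h'
    exact absurd h' (lt_irrefl _)

open Classical in
/-- The branching rule. -/
lemma sytCard_succ {n : ℕ} {μ : YoungDiagram} (hμ : μ.card = n + 1) :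
    sytCard μ = ∑ ν ∈ (sytLevel n).filter (fun ν => ν ≤ μ), sytCard ν := by
  simp only [sytCard_eq]
  rw [← Finset.card_sigma]
  symm
  apply Finset.card_bij (fun x _ => sytExtend μ x.1 n x.2)
  · rintro ⟨ν, s⟩ h
    simp only [Finset.mem_sigma, Finset.mem_filter, mem_sytLevel, mem_sytFuns] at h ⊢
    exact isSytFun_sytExtend h.1.1 hμ h.1.2 h.2
  · rintro ⟨ν, s⟩ h ⟨ν', s'⟩ h' heq
    simp only [Finset.mem_sigma, Finset.mem_filter, mem_sytLevel, mem_sytFuns] at h h' heq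
    have hνν : ν = ν' := by
      apply YoungDiagram.ext
      ext c
      rw [mem_iff_sytExtend h.1.1 h.1.2 h.2, mem_iff_sytExtend h'.1.1 h'.1.2 h'.2, heq]
    subst hνν
    have hss : s = s' := by
      funext c
      by_cases hc : c ∈ ν.cells
      · have := congrFun heq c
        simpa [sytExtend, hc] using this
      · rw [h.2.zero c hc, h'.2.zero c hc]
    rw [hss]
  · intro t ht
    rw [mem_sytFuns] at ht
    have hμ' : μ.cells.card = n + 1 := hμ
    have hlow : IsLowerSet ((μ.cells.filter (fun c => t c < n) : Finset (ℕ × ℕ)) :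
        Set (ℕ × ℕ)) := by
      intro d c hcd hd
      simp only [Finset.coe_filter, Set.mem_ofPred_eq] at hd ⊢
      exact ⟨μ.isLowerSet hcd hd.1, (ht.mono hd.1 hcd).trans_lt hd.2⟩
    let ν : YoungDiagram := ⟨μ.cells.filter (fun c => t c < n), hlow⟩
    have hmem : ∀ c, c ∈ ν.cells ↔ c ∈ μ.cells ∧ t c < n := fun c => Finset.mem_filter
    have himg : ν.cells.image t = Finset.range n := by
      ext k
      simp only [Finset.mem_image, Finset.mem_range, hmem]
      constructor
      · rintro ⟨c, hc, rfl⟩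
        exact hc.2
      · intro hk
        have : k ∈ μ.cells.image t := by
          rw [ht.img, hμ', Finset.mem_range]; omega
        obtain ⟨c, hc, rfl⟩ := Finset.mem_image.1 this
        exact ⟨c, ⟨hc, hk⟩, rfl⟩
    have hinj : Set.InjOn t (ν.cells : Set (ℕ × ℕ)) := by
      intro c hc d hd
      exact ht.inj ((hmem c).1 hc).1 ((hmem d).1 hd).1
    have hcard : ν.cells.card = n := by
      rw [← Finset.card_image_of_injOn hinj, himg, Finset.card_range]
    have hle : ν ≤ μ := YoungDiagram.cells_subset_iff.1 (Finset.filter_subset _ _)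
    let s : ℕ × ℕ → ℕ := fun c => if c ∈ ν.cells then t c else 0
    have hsin : ∀ c ∈ ν.cells, s c = t c := fun c hc => if_pos hc
    have hs : IsSytFun ν s := by
      refine ⟨fun c hc => if_neg hc, ?_, ?_, ?_, ?_⟩
      · intro c hc d hd h
        rw [hsin c hc, hsin d hd] at h
        exact hinj hc hd h
      · rw [hcard, ← himg]
        exact Finset.image_congr (fun c hc => hsin c hc)
      · intro i j j' h hlt
        have h' : (i, j) ∈ ν.cells := ν.up_left_mem le_rfl hlt.le h
        rw [hsin _ h, hsin _ h']
        exact ht.row _ _ _ ((hmem _).1 h).1 hlt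
      · intro i i' j h hlt
        have h' : (i, j) ∈ ν.cells := ν.up_left_mem hlt.le le_rfl h
        rw [hsin _ h, hsin _ h']
        exact ht.col _ _ _ ((hmem _).1 h).1 hlt
    refine ⟨⟨ν, s⟩, ?_, ?_⟩
    · simp only [Finset.mem_sigma, Finset.mem_filter, mem_sytLevel, mem_sytFuns]
      exact ⟨⟨hcard, hle⟩, hs⟩
    · funext c
      by_cases hc : c ∈ ν.cells
      · simp only [sytExtend, if_pos hc, hsin c hc]
      · simp only [sytExtend, if_neg hc]
        by_cases hc' : c ∈ μ.cells
        · rw [if_pos hc']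
          have h1 := ht.lt hc'
          have h2 : ¬ t c < n := fun h => hc ((hmem c).2 ⟨hc', h⟩)
          omega
        · rw [if_neg hc', ht.zero c hc']

lemma sytLevel_zero : sytLevel 0 = {⊥} := by
  ext μ
  rw [mem_sytLevel, Finset.mem_singleton]
  constructor
  · intro h
    apply YoungDiagram.ext
    rw [YoungDiagram.cells_bot]
    exact Finset.card_eq_zero.1 h
  · rintro rfl
    rfl

lemma sytCard_bot : sytCard ⊥ = 1 := by
  rw [sytCard_eq, Finset.card_eq_one]
  refine ⟨fun _ => 0, ?_⟩
  ext t
  rw [mem_sytFuns, Finset.mem_singleton]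
  constructor
  · intro h
    funext c
    exact h.zero c (by simp)
  · rintro rfl
    constructor <;> simp

open Classical in
lemma sytCard_up (n : ℕ) : ∀ ν : YoungDiagram, ν.card = n →
    ∑ μ ∈ (sytLevel (n + 1)).filter (fun μ => ν ≤ μ), sytCard μ = (n + 1) * sytCard ν := by
  induction n with
  | zero =>
    intro ν hν
    have hb : ν = ⊥ := by
      rw [← Finset.mem_singleton, ← sytLevel_zero, mem_sytLevel, hν]
    subst hb
    have h1 : ∀ μ ∈ (sytLevel (0 + 1)).filter (fun μ => ⊥ ≤ μ), sytCard μ = 1 := by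
      intro μ hμ
      rw [Finset.mem_filter, mem_sytLevel] at hμ
      rw [sytCard_succ hμ.1, sytLevel_zero]
      simp [Finset.filter_singleton, sytCard_bot]
    rw [Finset.sum_congr rfl h1, Finset.sum_const, syt_card_up hν, sytCard_bot]
    simp [Finset.filter_singleton]
  | succ n ih =>
    intro ν hν
    have e1 : ∑ μ ∈ (sytLevel (n + 2)).filter (fun μ => ν ≤ μ), sytCard μ =
        ∑ κ ∈ sytLevel (n + 1),
          ((sytLevel (n + 2)).filter (fun μ => ν ≤ μ ∧ κ ≤ μ)).card * sytCard κ := by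
      have : ∀ μ ∈ (sytLevel (n + 2)).filter (fun μ => ν ≤ μ), sytCard μ =
          ∑ κ ∈ sytLevel (n + 1), if κ ≤ μ then sytCard κ else 0 := by
        intro μ hμ
        rw [Finset.mem_filter, mem_sytLevel] at hμ
        rw [sytCard_succ hμ.1, Finset.sum_filter]
      rw [Finset.sum_congr rfl this, Finset.sum_comm]
      refine Finset.sum_congr rfl fun κ _ => ?_
      rw [← Finset.sum_filter, Finset.filter_filter, Finset.sum_const, smul_eq_mul]
    have e2 : ∑ κ ∈ sytLevel (n + 1),
        ((sytLevel n).filter (fun ρ => ρ ≤ ν ∧ ρ ≤ κ)).card * sytCard κ =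
        (n + 1) * sytCard ν := by
      rw [sytCard_succ hν, Finset.mul_sum]
      have : ∀ ρ ∈ (sytLevel n).filter (fun ρ => ρ ≤ ν), (n + 1) * sytCard ρ =
          ∑ κ ∈ sytLevel (n + 1), if ρ ≤ κ then sytCard κ else 0 := by
        intro ρ hρ
        rw [Finset.mem_filter, mem_sytLevel] at hρ
        rw [← ih ρ hρ.1, Finset.sum_filter]
      rw [Finset.sum_congr rfl this, Finset.sum_comm]
      refine Finset.sum_congr rfl fun κ _ => ?_
      rw [← Finset.sum_filter, Finset.filter_filter, Finset.sum_const, smul_eq_mul]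
    have e3 : ∀ κ ∈ sytLevel (n + 1),
        ((sytLevel (n + 2)).filter (fun μ => ν ≤ μ ∧ κ ≤ μ)).card * sytCard κ =
        ((sytLevel n).filter (fun ρ => ρ ≤ ν ∧ ρ ≤ κ)).card * sytCard κ +
          if κ = ν then sytCard κ else 0 := by
      intro κ hκ
      rw [syt_card_up_down_all (mem_sytLevel.1 hκ) hν, add_mul]
      simp
    rw [e1, Finset.sum_congr rfl e3, Finset.sum_add_distrib, e2, Finset.sum_ite_eq',
      if_pos (mem_sytLevel.2 hν)]
    ring

lemma syt_sum_sq (n : ℕ) : ∑ μ ∈ sytLevel n, sytCard μ ^ 2 = n ! := by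
  classical
  induction n with
  | zero => simp [sytLevel_zero, sytCard_bot]
  | succ n ih =>
    have : ∀ μ ∈ sytLevel (n + 1), sytCard μ ^ 2 =
        ∑ ν ∈ sytLevel n, if ν ≤ μ then sytCard ν * sytCard μ else 0 := by
      intro μ hμ
      rw [pow_two, ← Finset.sum_filter, ← Finset.sum_mul, ← sytCard_succ (mem_sytLevel.1 hμ)]
    rw [Finset.sum_congr rfl this, Finset.sum_comm, Nat.factorial_succ, ← ih, Finset.mul_sum]
    refine Finset.sum_congr rfl fun ν hν => ?_
    rw [← Finset.sum_filter, ← Finset.mul_sum, sytCard_up n ν (mem_sytLevel.1 hν)]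
    ring

/-- The sum over all partitions `λ` of `n` of the square of the number `f^λ` of standard
Young tableaux of shape `λ` equals `n!`. -/
theorem sum_sq_card_standardYT (n : ℕ) (hn : 0 < n) :
    ∑ p : n.Partition, (sytCard (diagramOfPartition p)) ^ 2 = n ! := by
  rw [sum_sytLevel n (fun μ => sytCard μ ^ 2), syt_sum_sq]
end

section
/- Let n be a positive integer. For each partition λ of n and each pair (S,T) of standard Young tableaux of shape λ, define the higher Specht polynomial F^S_T ∈ ℚ[x_1,...,x_n] by F^S_T = ε_T(x_T^{i(S)}), where x_T^{i(S)} is the monomial whose exponent of the variable x_j is the entry of the index tableau i(S) in the cell of T containing j, and ε_T = Σ_{σ ∈ R(T)} Σ_{τ ∈ C(T)} sign(τ) · τσ is the Young symmetrizer of T acting on polynomials by permuting variables. Then the n! polynomials F^S_T, as (S,T) runs over all pairs of standard Young tableaux of the same shape λ ⊢ n, form a basis of ℚ[x_1,...,x_n] as a module over the ring Sym = ℚ[e_1,...,e_n] of symmetric polynomials; in particular ℚ[x_1,...,x_n] is a free Sym-module of rank n! with basis {F^S_T}. -/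
open MvPolynomial Nat

/-- The word `w(S)` of a tableau `S` : read the entries column by column from left to right,
each column being read from its last cell up to the first row (this is the reading "from top
to bottom" in the French convention, rows being indexed here in the English convention). -/
def wordOf (μ : YoungDiagram) (S : ↥μ.cells ≃ Fin μ.card) : List ℕ :=
  (List.range (μ.rowLen 0)).flatMap fun c =>
    ((List.range (μ.colLen c)).reverse).filterMap fun r =>
      if h : (r, c) ∈ μ.cells then some ((S ⟨(r, c), h⟩ : Fin μ.card) : ℕ) else none

/-- The index of the letter `k` in a word `w` (letter `k` stands for the number `k+1`):
the letter `0` has index `0`, and if the letter `k` has index `p` then the letter `k+1` has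
index `p+1` if it lies to the left of `k` in `w`, and index `p` otherwise. -/
def letterIndex (w : List ℕ) : ℕ → ℕ
  | 0 => 0
  | k + 1 => letterIndex w k + (if w.idxOf (k + 1) < w.idxOf k then 1 else 0)

/-- The monomial `x_T^{i(S)}` : the exponent of the variable `x_j` is the entry of the index
tableau `i(S)` in the cell of `T` containing `j`. -/
noncomputable def higherSpechtMonomial (μ : YoungDiagram)
    (S T : ↥μ.cells ≃ Fin μ.card) : MvPolynomial (Fin μ.card) ℚ :=
  ∏ j : Fin μ.card, (X j : MvPolynomial (Fin μ.card) ℚ) ^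
    letterIndex (wordOf μ S) ((S (T.symm j) : Fin μ.card) : ℕ)

/-- The row stabilizer `R(T)` of a tableau `T`: the permutations of the entries preserving
each row of `T`. -/
def rowStab (μ : YoungDiagram) (T : ↥μ.cells ≃ Fin μ.card) :
    Finset (Equiv.Perm (Fin μ.card)) :=
  Finset.univ.filter fun σ => ∀ j, ((T.symm (σ j) : ℕ × ℕ)).1 = ((T.symm j : ℕ × ℕ)).1

/-- The column stabilizer `C(T)` of a tableau `T`: the permutations of the entries preserving
each column of `T`. -/
def colStab (μ : YoungDiagram) (T : ↥μ.cells ≃ Fin μ.card) :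
    Finset (Equiv.Perm (Fin μ.card)) :=
  Finset.univ.filter fun τ => ∀ j, ((T.symm (τ j) : ℕ × ℕ)).2 = ((T.symm j : ℕ × ℕ)).2

/-- The higher Specht polynomial `F^S_T = ε_T (x_T^{i(S)})`, where
`ε_T = ∑_{σ ∈ R(T)} ∑_{τ ∈ C(T)} sign(τ) τσ` is the Young symmetrizer of `T`, acting on
polynomials by permutation of the variables. -/
noncomputable def higherSpecht (μ : YoungDiagram) (S T : ↥μ.cells ≃ Fin μ.card) :
    MvPolynomial (Fin μ.card) ℚ :=
  ∑ σ ∈ rowStab μ T, ∑ τ ∈ colStab μ T,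
    (Equiv.Perm.sign τ : ℤ) • rename (⇑(τ * σ)) (higherSpechtMonomial μ S T)

/-- The indexing set of the higher Specht polynomials for `n` variables: pairs `(S, T)` of
standard Young tableaux of the same shape `λ ⊢ n`. -/
def HSPair (n : ℕ) : Type :=
  Σ μ : {μ : YoungDiagram // μ.card = n},
    {ST : (↥(μ : YoungDiagram).cells ≃ Fin (μ : YoungDiagram).card) ×
        (↥(μ : YoungDiagram).cells ≃ Fin (μ : YoungDiagram).card) //
      IsStandardYT (μ : YoungDiagram) ST.1 ∧ IsStandardYT (μ : YoungDiagram) ST.2}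

/-- The family of higher Specht polynomials `F^S_T ∈ ℚ[x₁,…,xₙ]`, indexed by the pairs
`(S, T)` of standard Young tableaux of the same shape `λ ⊢ n`. -/
noncomputable def higherSpechtFamily (n : ℕ) (x : HSPair n) : MvPolynomial (Fin n) ℚ :=
  rename (Fin.cast x.1.2) (higherSpecht (x.1 : YoungDiagram) x.2.1.1 x.2.1.2)

namespace HS

open Equiv

variable {n : ℕ}

/-- rational sign -/
def sg (π : Perm (Fin n)) : ℚ := ((Perm.sign π : ℤ) : ℚ)

lemma sg_mul (a b : Perm (Fin n)) : sg (a * b) = sg a * sg b := by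
  simp [sg]

lemma sg_one : sg (1 : Perm (Fin n)) = 1 := by simp [sg]

lemma sg_inv (a : Perm (Fin n)) : sg a⁻¹ = sg a := by
  simp [sg]

lemma sg_sq (a : Perm (Fin n)) : sg a * sg a = 1 := by
  rw [sg, ← Int.cast_mul, ← Units.val_mul, Int.units_mul_self]; simp

lemma sg_ne_zero (a : Perm (Fin n)) : sg a ≠ 0 := by
  intro h; have := sg_sq a; rw [h] at this; simp at this

lemma sg_swap {i j : Fin n} (h : i ≠ j) : sg (swap i j) = -1 := by
  simp [sg, Perm.sign_swap h]

/-- antisymmetrization -/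
noncomputable def alt : MvPolynomial (Fin n) ℚ →ₗ[ℚ] MvPolynomial (Fin n) ℚ :=
  ∑ π : Perm (Fin n), sg π • (rename π : MvPolynomial (Fin n) ℚ →ₐ[ℚ] _).toLinearMap

lemma alt_apply (f : MvPolynomial (Fin n) ℚ) : alt f = ∑ π : Perm (Fin n), sg π • rename π f := by
  simp [alt]

lemma rename_mul_perm (a b : Perm (Fin n)) (f : MvPolynomial (Fin n) ℚ) :
    rename (⇑(a * b)) f = rename a (rename b f) := by
  rw [rename_rename]; rfl

lemma alt_rename (π : Perm (Fin n)) (f : MvPolynomial (Fin n) ℚ) :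
    alt (rename π f) = sg π • alt f := by
  rw [alt_apply, alt_apply, Finset.smul_sum]
  refine Fintype.sum_equiv (Equiv.mulRight π) _ _ fun a => ?_
  simp only [Equiv.coe_mulRight, rename_mul_perm, sg_mul, smul_smul]
  rw [mul_comm (sg a), ← mul_assoc, sg_sq, one_mul]

lemma rename_alt (π : Perm (Fin n)) (f : MvPolynomial (Fin n) ℚ) :
    rename π (alt f) = sg π • alt f := by
  rw [alt_apply, map_sum, Finset.smul_sum]
  refine Fintype.sum_equiv (Equiv.mulLeft π) _ _ fun a => ?_
  simp only [Equiv.coe_mulLeft, rename_mul_perm, sg_mul, smul_smul, map_smul]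
  rw [← mul_assoc, sg_sq, one_mul]

lemma alt_sym_mul {s : MvPolynomial (Fin n) ℚ} (hs : s.IsSymmetric) (f : MvPolynomial (Fin n) ℚ) :
    alt (s * f) = s * alt f := by
  rw [alt_apply, alt_apply, Finset.mul_sum]
  refine Finset.sum_congr rfl fun π _ => ?_
  rw [map_mul, hs π, mul_smul_comm]

/-- staircase exponent -/
noncomputable def del (n : ℕ) : Fin n →₀ ℕ := Finsupp.equivFunOnFinite.symm (fun i => (i : ℕ))

@[simp] lemma del_apply (i : Fin n) : del n i = i := rfl

/-- Vandermonde -/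
noncomputable def van (n : ℕ) : MvPolynomial (Fin n) ℚ := alt (monomial (del n) 1)

noncomputable def beta : MvPolynomial (Fin n) ℚ →ₗ[ℚ] ℚ := (lcoeff ℚ (del n)).comp alt

lemma beta_apply (f : MvPolynomial (Fin n) ℚ) : beta f = coeff (del n) (alt f) := rfl

lemma beta_rename (π : Perm (Fin n)) (f : MvPolynomial (Fin n) ℚ) :
    beta (rename π f) = sg π * beta f := by
  rw [beta_apply, alt_rename, beta_apply, coeff_smul, smul_eq_mul]

lemma mapDomain_eq_del (π : Perm (Fin n)) (e : Fin n →₀ ℕ) :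
    Finsupp.mapDomain π e = del n ↔ ∀ j, e j = (π j : ℕ) := by
  rw [Finsupp.ext_iff]
  constructor
  · intro h j
    have := h (π j)
    rwa [Finsupp.mapDomain_apply π.injective, del_apply] at this
  · intro h j
    obtain ⟨k, rfl⟩ := π.surjective j
    rw [Finsupp.mapDomain_apply π.injective, del_apply, h]

lemma beta_monomial_of (u : Perm (Fin n)) (e : Fin n →₀ ℕ) (h : ∀ j, e j = (u j : ℕ)) :
    beta (monomial e (1 : ℚ)) = sg u := by
  rw [beta_apply, alt_apply, coeff_sum, Finset.sum_eq_single u]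
  · rw [rename_monomial, coeff_smul, coeff_monomial, if_pos ((mapDomain_eq_del u e).2 h)]; simp
  · intro π _ hπ
    rw [rename_monomial, coeff_smul, coeff_monomial, if_neg]
    · simp
    · rw [mapDomain_eq_del]
      intro h'
      apply hπ
      ext j
      rw [← h', h]
  · simp

lemma exists_of_beta_monomial (e : Fin n →₀ ℕ) (h : beta (monomial e (1 : ℚ)) ≠ 0) :
    ∃ u : Perm (Fin n), ∀ j, e j = (u j : ℕ) := by
  by_contra! hc
  apply h
  rw [beta_apply, alt_apply, coeff_sum]
  refine Finset.sum_eq_zero fun π _ => ?_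
  rw [rename_monomial, coeff_smul, coeff_monomial, if_neg]
  · simp
  · rw [mapDomain_eq_del]
    intro h'
    obtain ⟨j, hj⟩ := hc π
    exact hj (h' j)

lemma coeff_van : coeff (del n) (van n) = 1 := by
  have := beta_monomial_of (1 : Perm (Fin n)) (del n) (by simp)
  rwa [sg_one] at this

lemma van_ne_zero : van n ≠ 0 := by
  intro h
  have := coeff_van (n := n)
  rw [h] at this; simp at this

lemma le_totalDegree_van : ∑ i : Fin n, (i : ℕ) ≤ (van n).totalDegree := by
  have := le_totalDegree (p := van n) (s := del n) (by rw [mem_support_iff, coeff_van]; simp)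
  rwa [Finsupp.sum_fintype _ _ (by simp)] at this

lemma van_eq : van n = ∏ i : Fin n, ∏ j ∈ Finset.Ioi i, (X j - X i) := by
  rw [← Matrix.det_vandermonde, Matrix.det_apply, van, alt_apply]
  refine Finset.sum_congr rfl fun π _ => ?_
  rw [sg, Int.cast_smul_eq_zsmul]
  congr 1
  rw [rename_monomial, monomial_eq, Finsupp.prod_fintype _ _ (by simp)]
  simp only [map_one, one_mul, Matrix.vandermonde_apply]
  rw [← Equiv.prod_comp π]
  refine Finset.prod_congr rfl fun j _ => ?_
  rw [Finsupp.mapDomain_apply π.injective]; rfl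

/-- If two algebra homs agree modulo `X i - X j` on variables... -/
lemma dvd_sub_of {d : MvPolynomial (Fin n) ℚ} (ph : MvPolynomial (Fin n) ℚ →ₐ[ℚ] MvPolynomial (Fin n) ℚ)
    (h : ∀ k, d ∣ X k - ph (X k)) (f : MvPolynomial (Fin n) ℚ) : d ∣ f - ph f := by
  rw [← Ideal.mem_span_singleton, ← Ideal.Quotient.eq]
  have : (Ideal.Quotient.mkₐ ℚ (Ideal.span {d})) =
      (Ideal.Quotient.mkₐ ℚ (Ideal.span {d})).comp ph := by
    apply MvPolynomial.algHom_ext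
    intro k
    rw [AlgHom.comp_apply]
    simp only [Ideal.Quotient.mkₐ_eq_mk]
    rw [Ideal.Quotient.eq, Ideal.mem_span_singleton]
    exact h k
  exact DFunLike.congr_fun this f

noncomputable def coll (i j : Fin n) : MvPolynomial (Fin n) ℚ →ₐ[ℚ] MvPolynomial (Fin n) ℚ :=
  rename (fun k => if k = i then j else k)

lemma dvd_iff_coll {i j : Fin n} (h : i ≠ j) (f : MvPolynomial (Fin n) ℚ) :
    (X i - X j : MvPolynomial (Fin n) ℚ) ∣ f ↔ coll i j f = 0 := by
  constructor
  · rintro ⟨g, rfl⟩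
    simp [coll, h.symm]
  · intro h0
    have := dvd_sub_of (d := (X i - X j : MvPolynomial (Fin n) ℚ)) (coll i j) (fun k => by
      by_cases hk : k = i
      · subst hk; simp [coll]
      · simp [coll, hk]) f
    rwa [h0, sub_zero] at this

lemma X_sub_ne {i j : Fin n} (h : i ≠ j) : (X i - X j : MvPolynomial (Fin n) ℚ) ≠ 0 := by
  rw [sub_ne_zero]
  exact fun h' => h (X_injective h')

lemma prime_X_sub {i j : Fin n} (h : i ≠ j) : Prime (X i - X j : MvPolynomial (Fin n) ℚ) := by
  refine ⟨X_sub_ne h, ?_, ?_⟩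
  · intro hu
    have := (dvd_iff_coll h 1).1 (hu.dvd)
    simp at this
  · intro a b hab
    rw [dvd_iff_coll h] at *
    rw [dvd_iff_coll h, map_mul] at *
    exact mul_eq_zero.1 hab

lemma van_dvd (f : MvPolynomial (Fin n) ℚ) : van n ∣ alt f := by
  rw [van_eq, Finset.prod_sigma']
  apply Finset.prod_dvd_of_isRelPrime
  · rintro ⟨i, j⟩ h1 ⟨i', j'⟩ h2 hne
    simp only [true_and, Finset.mem_Ioi, Finset.coe_sigma, Set.mem_sigma_iff, Finset.mem_coe, Finset.coe_univ, Set.mem_univ] at h1 h2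
    show IsRelPrime (X j - X i : MvPolynomial (Fin n) ℚ) (X j' - X i')
    rw [(prime_X_sub h1.ne').irreducible.isRelPrime_iff_not_dvd, dvd_iff_coll h1.ne']
    simp only [coll, map_sub, rename_X]
    apply X_sub_ne
    intro h
    apply hne
    split_ifs at h with a b b
    · omega
    · subst a; subst h; rfl
    · omega
    · omega
  · rintro ⟨i, j⟩ h1
    simp only [Finset.mem_sigma, Finset.mem_univ, true_and, Finset.mem_Ioi] at h1
    have := dvd_sub_of (d := (X j - X i : MvPolynomial (Fin n) ℚ)) (rename (swap i j)) (fun k => by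
      rw [rename_X]
      by_cases hk : k = i
      · subst hk; simp only [swap_apply_left]; exact (dvd_sub_comm).1 dvd_rfl
      · by_cases hk' : k = j
        · subst hk'; simp
        · simp [swap_apply_of_ne_of_ne hk hk']) (alt f)
    rw [rename_alt, sg_swap h1.ne, neg_one_smul, sub_neg_eq_add, ← two_mul] at this
    rcases (prime_X_sub h1.ne').dvd_or_dvd this with h | h
    · exfalso
      rw [dvd_iff_coll h1.ne', map_ofNat] at h
      exact two_ne_zero h
    · exact h

lemma sym_of_van_mul {f q : MvPolynomial (Fin n) ℚ} (h : alt f = van n * q) : q.IsSymmetric := by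
  intro π
  have h1 := rename_alt π f
  rw [h, map_mul] at h1
  rw [van, rename_alt, ← van, smul_mul_assoc] at h1
  have h2 := congrArg (fun z => sg π • z) h1
  simp only [smul_smul, sg_sq, one_smul] at h2
  exact mul_left_cancel₀ van_ne_zero h2

lemma totalDegree_alt_le (f : MvPolynomial (Fin n) ℚ) : (alt f).totalDegree ≤ f.totalDegree := by
  rw [alt_apply]
  refine (totalDegree_finsetSum _ _).trans (Finset.sup_le fun π _ => ?_)
  exact (totalDegree_smul_le _ _).trans (totalDegree_rename_le _ _)

end HS

namespace HS

open Equiv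

variable {n : ℕ}

lemma exists_sym_relation {ι : Type*} [Fintype ι] (hι : n ! < Fintype.card ι)
    (f : ι → MvPolynomial (Fin n) ℚ) :
    ∃ c : ι → symmetricSubalgebra (Fin n) ℚ, c ≠ 0 ∧ ∑ i, (c i : MvPolynomial (Fin n) ℚ) * f i = 0 := by
  classical
  let L : (ι → MvPolynomial (Fin n) ℚ) →ₗ[MvPolynomial (Fin n) ℚ]
      (Perm (Fin n) → MvPolynomial (Fin n) ℚ) :=
    Matrix.mulVecLin (Matrix.of fun (π : Perm (Fin n)) i => rename π (f i))
  have hL : ¬ Function.Injective L := by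
    intro h
    have := card_le_of_injective _ L h
    rw [Fintype.card_perm, Fintype.card_fin] at this
    omega
  rw [← LinearMap.ker_eq_bot, Submodule.eq_bot_iff] at hL
  push Not at hL
  obtain ⟨a, ha, ha0⟩ := hL
  have ha' : ∀ π : Perm (Fin n), ∑ i, a i * rename π (f i) = 0 := by
    intro π
    have := congrFun (LinearMap.mem_ker.1 ha) π
    simp only [L, Matrix.mulVecLin_apply, Matrix.mulVec, dotProduct, Matrix.of_apply,
      Pi.zero_apply] at this
    rw [← this]
    exact Finset.sum_congr rfl fun i _ => mul_comm _ _
  obtain ⟨i0, hi0⟩ := Function.ne_iff.1 ha0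
  let N : MvPolynomial (Fin n) ℚ := ∏ ρ : Perm (Fin n), rename ρ (a i0)
  let t : MvPolynomial (Fin n) ℚ := ∏ ρ ∈ Finset.univ.erase (1 : Perm (Fin n)), rename ρ (a i0)
  have hN : t * a i0 = N := by
    have := Finset.prod_erase_mul (Finset.univ : Finset (Perm (Fin n)))
      (fun ρ => rename ρ (a i0)) (Finset.mem_univ 1)
    simpa [N, t] using this
  have hNs : ∀ π : Perm (Fin n), rename π N = N := by
    intro π
    simp only [N, map_prod]
    refine Fintype.prod_equiv (Equiv.mulLeft π) _ _ fun ρ => ?_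
    rw [Equiv.coe_mulLeft, rename_mul_perm]
  have hN0 : N ≠ 0 := by
    refine Finset.prod_ne_zero_iff.2 fun ρ _ => ?_
    rw [Ne, ← map_zero (rename (R := ℚ) ρ)]
    exact fun h => hi0 (rename_injective _ ρ.injective h)
  let c : ι → MvPolynomial (Fin n) ℚ := fun i => ∑ ρ : Perm (Fin n), rename ρ (t * a i)
  have hc : ∀ i, c i ∈ symmetricSubalgebra (Fin n) ℚ := by
    intro i π
    simp only [c, map_sum]
    refine Fintype.sum_equiv (Equiv.mulLeft π) _ _ fun ρ => ?_
    rw [Equiv.coe_mulLeft, rename_mul_perm]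
  refine ⟨fun i => ⟨c i, hc i⟩, ?_, ?_⟩
  · intro h
    have h1 : c i0 = 0 := congrArg Subtype.val (congrFun h i0)
    simp only [c, hN, hNs, Finset.sum_const, smul_eq_zero, hN0, or_false, Finset.card_univ] at h1
    exact Fintype.card_ne_zero h1
  · simp only [c, Finset.sum_mul]
    rw [Finset.sum_comm]
    refine Finset.sum_eq_zero fun ρ _ => ?_
    have h1 := congrArg (rename ρ) (ha' ρ⁻¹)
    rw [map_sum, map_zero] at h1
    simp only [map_mul, mul_assoc] at h1 ⊢
    rw [← Finset.mul_sum]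
    simp only [← rename_mul_perm, mul_inv_cancel] at h1
    rw [← mul_zero (rename ρ t), ← h1]
    congr 1
    refine Finset.sum_congr rfl fun i _ => ?_
    simp

theorem abstract_basis {ι : Type} [Fintype ι] (hι : Fintype.card ι = n !)
    (F G : ι → MvPolynomial (Fin n) ℚ) (d : ι → ℕ)
    (hF : ∀ i, (F i).totalDegree ≤ d i)
    (hG : ∀ i, (G i).totalDegree + d i ≤ ∑ i : Fin n, (i : ℕ))
    (hM : ∀ c : ι → ℚ, (∀ j, ∑ i, c i * beta (F i * G j) = 0) → c = 0) :
    ∃ b : Module.Basis ι (symmetricSubalgebra (Fin n) ℚ) (MvPolynomial (Fin n) ℚ),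
      ∀ x, b x = F x := by
  classical
  set A := symmetricSubalgebra (Fin n) ℚ with hA
  have hdiv : ∀ f : MvPolynomial (Fin n) ℚ, ∃ q : A, alt f = van n * (q : MvPolynomial (Fin n) ℚ) := by
    intro f
    obtain ⟨q, hq⟩ := van_dvd f
    exact ⟨⟨q, sym_of_van_mul hq⟩, hq⟩
  choose D hD using hdiv
  let q : Matrix ι ι A := Matrix.of fun i j => D (F i * G j)
  let M : Matrix ι ι ℚ := Matrix.of fun i j => beta (F i * G j)
  have hdeg : ∀ i j, (D (F i * G j) : MvPolynomial (Fin n) ℚ) ≠ 0 →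
      (D (F i * G j) : MvPolynomial (Fin n) ℚ).totalDegree + d j ≤ d i := by
    intro i j h
    have h1 := totalDegree_alt_le (F i * G j)
    rw [hD, totalDegree_mul_of_isDomain van_ne_zero h] at h1
    have h2 := totalDegree_mul (F i) (G j)
    have h3 := le_totalDegree_van (n := n)
    have h4 := hF i
    have h5 := hG j
    omega
  have hq0 : ∀ i j, d i < d j → q i j = 0 ∧ M i j = 0 := by
    intro i j hij
    have h0 : (D (F i * G j) : MvPolynomial (Fin n) ℚ) = 0 := by
      by_contra h
      have := hdeg i j h
      omega
    refine ⟨Subtype.ext h0, ?_⟩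
    simp only [M, Matrix.of_apply, beta_apply, hD, h0, mul_zero, coeff_zero]
  have hq1 : ∀ i j, d i = d j → q i j = algebraMap ℚ A (M i j) := by
    intro i j hij
    have h0 : (D (F i * G j) : MvPolynomial (Fin n) ℚ).totalDegree = 0 := by
      by_cases h : (D (F i * G j) : MvPolynomial (Fin n) ℚ) = 0
      · rw [h]; simp
      · have := hdeg i j h
        omega
    have h1 := totalDegree_eq_zero_iff_eq_C.1 h0
    apply Subtype.ext
    show (D (F i * G j) : MvPolynomial (Fin n) ℚ) = C (M i j)
    have h2 : M i j = coeff 0 (D (F i * G j) : MvPolynomial (Fin n) ℚ) := by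
      simp only [M, Matrix.of_apply, beta_apply, hD]
      rw [h1, mul_comm, coeff_C_mul, coeff_van]; simp
    rw [h2]; exact h1
  have hdet : q.det = algebraMap ℚ A M.det := by
    rw [Matrix.det_apply, Matrix.det_apply, map_sum]
    refine Finset.sum_congr rfl fun σ _ => ?_
    have : ∏ i, q (σ i) i = algebraMap ℚ A (∏ i, M (σ i) i) := by
      by_cases h : ∃ i, d (σ i) < d i
      · obtain ⟨i, hi⟩ := h
        have e1 : ∏ i, q (σ i) i = 0 := Finset.prod_eq_zero (Finset.mem_univ i) (hq0 _ _ hi).1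
        have e2 : ∏ i, M (σ i) i = 0 := Finset.prod_eq_zero (Finset.mem_univ i) (hq0 _ _ hi).2
        rw [e1, e2, map_zero]
      · push Not at h
        rw [map_prod]
        have hs : ∑ i, d (σ i) = ∑ i, d i := Equiv.sum_comp σ d
        have := (Finset.sum_eq_sum_iff_of_le (fun i _ => h i)).1 hs.symm
        exact Finset.prod_congr rfl fun i hi => hq1 _ _ (this i hi).symm
    rw [this]
    rcases Int.units_eq_one_or (Perm.sign σ) with h | h <;> rw [h] <;> simp
  have hM0 : M.det ≠ 0 := by
    intro h
    obtain ⟨v, hv, hv0⟩ := Matrix.exists_vecMul_eq_zero_iff.2 h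
    apply hv
    apply hM
    intro j
    have := congrFun hv0 j
    simpa [Matrix.vecMul, dotProduct, M] using this
  have hunit : IsUnit q.det := by
    rw [hdet]; exact (IsUnit.mk0 _ hM0).map _
  have hpair : ∀ (c : ι → A) (f : MvPolynomial (Fin n) ℚ) (a : A),
      ∑ i, (c i : MvPolynomial (Fin n) ℚ) * F i = (a : MvPolynomial (Fin n) ℚ) * f →
      ∀ j, ∑ i, c i * q i j = a * D (f * G j) := by
    intro c f a h j
    have h1 := congrArg (fun z => alt (z * G j)) h
    simp only [Finset.sum_mul, map_sum, mul_assoc] at h1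
    rw [alt_sym_mul a.2, hD] at h1
    have h2 : ∀ i, alt ((c i : MvPolynomial (Fin n) ℚ) * (F i * G j)) =
        van n * ((c i : MvPolynomial (Fin n) ℚ) * (q i j : MvPolynomial (Fin n) ℚ)) := by
      intro i
      rw [alt_sym_mul (c i).2, hD]
      simp only [q, Matrix.of_apply]; ring
    simp only [h2] at h1
    rw [← Finset.mul_sum, mul_left_comm] at h1
    have h3 := mul_left_cancel₀ van_ne_zero h1
    apply Subtype.ext
    push_cast
    exact h3
  have hvm : ∀ c : ι → A, (∀ j, ∑ i, c i * q i j = 0) → c = 0 := by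
    intro c h
    have h1 : Matrix.vecMul c q = 0 := by
      ext1 j
      simpa [Matrix.vecMul, dotProduct] using h j
    have h2 := congrArg (fun v => Matrix.vecMul v q⁻¹) h1
    simpa [Matrix.vecMul_vecMul, Matrix.mul_nonsing_inv _ hunit] using h2
  have hli : LinearIndependent A F := by
    rw [Fintype.linearIndependent_iff]
    intro c hc
    have hc' : ∑ i, (c i : MvPolynomial (Fin n) ℚ) * F i = ((0 : A) : MvPolynomial (Fin n) ℚ) * 0 := by
      rw [mul_zero, ← hc]; rfl
    have := hvm c (fun j => by rw [hpair c 0 0 hc' j, zero_mul])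
    intro i; rw [this]; rfl
  have hsp : ⊤ ≤ Submodule.span A (Set.range F) := by
    intro h _
    obtain ⟨c, hc0, hc⟩ := exists_sym_relation (n := n) (ι := Option ι)
      (by rw [Fintype.card_option, hι]; omega) (fun o => o.elim h F)
    rw [Fintype.sum_option] at hc
    simp only [Option.elim] at hc
    have hn0 : c none ≠ 0 := by
      intro h0
      apply hc0
      rw [h0] at hc
      have hc' : ∑ i, ((fun i => c (some i)) i : MvPolynomial (Fin n) ℚ) * F i
          = ((0 : A) : MvPolynomial (Fin n) ℚ) * 0 := by
        simpa using hc
      have := hvm (fun i => c (some i)) (fun j => by rw [hpair _ 0 0 hc' j, zero_mul])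
      ext1 o
      cases o with
      | none => exact h0
      | some i => exact congrFun this i
    let c' : ι → A := Matrix.vecMul (fun j => D (h * G j)) q⁻¹
    have hc' : ∀ j, ∑ i, c' i * q i j = D (h * G j) := by
      intro j
      have : Matrix.vecMul c' q = fun j => D (h * G j) := by
        simp only [c', Matrix.vecMul_vecMul, Matrix.nonsing_inv_mul _ hunit, Matrix.vecMul_one]
      have := congrFun this j
      simpa [Matrix.vecMul, dotProduct] using this
    have h1 := hpair (fun i => c (some i)) h (-c none) (by
      push_cast
      rw [neg_mul]
      exact eq_neg_of_add_eq_zero_right hc)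
    have h2 : (fun i => c (some i) + c none * c' i) = 0 := by
      apply hvm
      intro j
      simp only [add_mul, Finset.sum_add_distrib, mul_assoc]
      rw [h1, ← Finset.mul_sum, hc']; ring
    have h3 : h = ∑ i, c' i • F i := by
      have hn0' : (c none : MvPolynomial (Fin n) ℚ) ≠ 0 := fun h => hn0 (Subtype.ext h)
      apply mul_left_cancel₀ hn0'
      rw [Finset.mul_sum, eq_neg_of_add_eq_zero_left hc, ← Finset.sum_neg_distrib]
      refine Finset.sum_congr rfl fun i _ => ?_
      have h4 : c (some i) = - (c none * c' i) := eq_neg_of_add_eq_zero_left (congrFun h2 i)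
      rw [h4]
      push_cast
      rw [Algebra.smul_def]
      show _ = (c none : MvPolynomial (Fin n) ℚ) * ((c' i : MvPolynomial (Fin n) ℚ) * F i)
      ring
    rw [h3]
    exact Submodule.sum_mem _ fun i _ => Submodule.smul_mem _ _ (Submodule.subset_span ⟨i, rfl⟩)
  exact ⟨Module.Basis.mk hli hsp, fun x => by simp⟩

lemma adjoin_eq : Algebra.adjoin ℚ (Set.range fun k : Fin n => esymm (Fin n) ℚ ((k : ℕ) + 1)) =
    symmetricSubalgebra (Fin n) ℚ := by
  apply le_antisymm
  · rw [Algebra.adjoin_le_iff]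
    rintro _ ⟨k, rfl⟩
    exact esymm_isSymmetric _ _ _
  · intro p hp
    obtain ⟨g, hg⟩ := (esymmAlgHom_fin_surjective (R := ℚ) (n := n) (m := n) le_rfl) ⟨p, hp⟩
    have h1 := congrArg Subtype.val hg
    rw [esymmAlgHom_apply] at h1
    simp only at h1
    rw [← h1, Algebra.adjoin_range_eq_range_aeval]
    exact ⟨g, rfl⟩

end HS

namespace HS

open Equiv

variable {n : ℕ}

/-- the group algebra -/
abbrev GA (n : ℕ) := MonoidAlgebra ℚ (Perm (Fin n))

/-- group element in the group algebra -/
noncomputable def gg (π : Perm (Fin n)) : GA n := MonoidAlgebra.of ℚ _ π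

lemma gg_mul (a b : Perm (Fin n)) : gg (a * b) = gg a * gg b := by simp [gg]

/-- stabilizer of a labelling -/
def stab (p : Fin n → ℕ) : Finset (Perm (Fin n)) := Finset.univ.filter fun σ => ∀ j, p (σ j) = p j

lemma mem_stab {p : Fin n → ℕ} {σ : Perm (Fin n)} : σ ∈ stab p ↔ ∀ j, p (σ j) = p j := by
  simp [stab]

lemma one_mem_stab (p : Fin n → ℕ) : 1 ∈ stab p := by simp [mem_stab]

lemma mul_mem_stab {p : Fin n → ℕ} {σ τ : Perm (Fin n)} (h : σ ∈ stab p) (h' : τ ∈ stab p) :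
    σ * τ ∈ stab p := by
  rw [mem_stab] at *
  intro j; rw [Perm.mul_apply, h, h']

lemma inv_mem_stab {p : Fin n → ℕ} {σ : Perm (Fin n)} (h : σ ∈ stab p) : σ⁻¹ ∈ stab p := by
  rw [mem_stab] at *
  intro j; rw [← h]; simp

lemma swap_mem_stab {p : Fin n → ℕ} {i j : Fin n} (h : p i = p j) : swap i j ∈ stab p := by
  rw [mem_stab]
  intro k
  rw [swap_apply_def]
  split_ifs with h1 h2
  · rw [h1, h]
  · rw [h2, h]
  · rfl

/-- symmetrizer -/
noncomputable def Pp (p : Fin n → ℕ) : GA n := ∑ σ ∈ stab p, gg σ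
/-- antisymmetrizer -/
noncomputable def Pm (p : Fin n → ℕ) : GA n := ∑ σ ∈ stab p, sg σ • gg σ

lemma gg_mul_Pp {p : Fin n → ℕ} {τ : Perm (Fin n)} (h : τ ∈ stab p) : gg τ * Pp p = Pp p := by
  rw [Pp, Finset.mul_sum]
  refine Finset.sum_bij' (fun σ _ => τ * σ) (fun σ _ => τ⁻¹ * σ) ?_ ?_ ?_ ?_ ?_
  · intro σ hσ; exact mul_mem_stab h hσ
  · intro σ hσ; exact mul_mem_stab (inv_mem_stab h) hσ
  · intro σ hσ; simp
  · intro σ hσ; simp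
  · intro σ hσ; rw [gg_mul]

lemma Pp_mul_gg {p : Fin n → ℕ} {τ : Perm (Fin n)} (h : τ ∈ stab p) : Pp p * gg τ = Pp p := by
  rw [Pp, Finset.sum_mul]
  refine Finset.sum_bij' (fun σ _ => σ * τ) (fun σ _ => σ * τ⁻¹) ?_ ?_ ?_ ?_ ?_
  · intro σ hσ; exact mul_mem_stab hσ h
  · intro σ hσ; exact mul_mem_stab hσ (inv_mem_stab h)
  · intro σ hσ; simp
  · intro σ hσ; simp
  · intro σ hσ; rw [gg_mul]

lemma gg_mul_Pm {p : Fin n → ℕ} {τ : Perm (Fin n)} (h : τ ∈ stab p) :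
    gg τ * Pm p = sg τ • Pm p := by
  rw [Pm, Finset.mul_sum, Finset.smul_sum]
  refine Finset.sum_bij' (fun σ _ => τ * σ) (fun σ _ => τ⁻¹ * σ) ?_ ?_ ?_ ?_ ?_
  · intro σ hσ; exact mul_mem_stab h hσ
  · intro σ hσ; exact mul_mem_stab (inv_mem_stab h) hσ
  · intro σ hσ; simp
  · intro σ hσ; simp
  · intro σ hσ; rw [gg_mul, sg_mul, smul_smul, ← mul_assoc, sg_sq, one_mul, mul_smul_comm]

lemma Pm_mul_gg {p : Fin n → ℕ} {τ : Perm (Fin n)} (h : τ ∈ stab p) :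
    Pm p * gg τ = sg τ • Pm p := by
  rw [Pm, Finset.sum_mul, Finset.smul_sum]
  refine Finset.sum_bij' (fun σ _ => σ * τ) (fun σ _ => σ * τ⁻¹) ?_ ?_ ?_ ?_ ?_
  · intro σ hσ; exact mul_mem_stab hσ h
  · intro σ hσ; exact mul_mem_stab hσ (inv_mem_stab h)
  · intro σ hσ; simp
  · intro σ hσ; simp
  · intro σ hσ; rw [gg_mul, sg_mul, smul_smul, mul_comm (sg σ), ← mul_assoc, sg_sq, one_mul,
      smul_mul_assoc]

lemma half_zero {x : GA n} (h : x = -x) : x = 0 := by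
  have h2 : (2 : ℚ) • x = 0 := by
    rw [two_smul]; nth_rewrite 2 [h]; simp
  exact (smul_eq_zero.1 h2).resolve_left two_ne_zero

lemma Pp_mul_Pm_eq_zero {p q : Fin n → ℕ} {i j : Fin n} (hij : i ≠ j) (h : p i = p j)
    (h' : q i = q j) : Pp p * Pm q = 0 := by
  apply half_zero
  nth_rewrite 1 [← Pp_mul_gg (swap_mem_stab h)]
  rw [mul_assoc, gg_mul_Pm (swap_mem_stab h'), sg_swap hij]
  simp

/-- A finite set of cells with the margins of a lower set equals it. -/
lemma fill_unique {ι : Type*} [Fintype ι] (t : ι → ℕ × ℕ) (ht : Function.Injective t)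
    (hl : IsLowerSet (Set.range t)) (π : Perm ι)
    (hinj : Function.Injective fun j => ((t j).1, (t (π j)).2)) :
    ∀ r, ∀ j, (t j).1 = r → ((t j).1, (t (π j)).2) ∈ Set.range t := by
  classical
  intro r
  induction r using Nat.strong_induction_on with
  | _ r ih =>
  -- counting column by column
  intro j hj
  by_contra hnot
  set c := (t (π j)).2 with hc
  -- letters in column c of t
  let A : Finset ι := Finset.univ.filter fun k => (t k).2 = c
  let B : Finset ι := Finset.univ.filter fun k => (t (π k)).2 = c
  have hAB : A.card = B.card := by
    refine (Finset.card_bij (fun k _ => π k) ?_ ?_ ?_).symm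
    · intro k hk; simpa [A, B] using hk
    · intro k _ k' _ h; exact π.injective h
    · intro k hk; exact ⟨π.symm k, by simpa [A, B] using hk, by simp⟩
  -- every letter of A has row < r
  have hA : ∀ k ∈ A, (t k).1 < r := by
    intro k hk
    by_contra hge
    apply hnot
    refine hl (a := t k) ?_ ⟨k, rfl⟩
    simp only [A, Finset.mem_filter, Finset.mem_univ, true_and] at hk
    exact Prod.mk_le_mk.2 ⟨by omega, by omega⟩
  -- for rows < r, the new set has full rows, hence contains each cell
  have hfull : ∀ k, (t k).1 < r → ∃ l, ((t l).1, (t (π l)).2) = t k := by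
    intro k hk
    let R : Finset ι := Finset.univ.filter fun l => (t l).1 = (t k).1
    have hmap : ∀ l ∈ R, ((t l).1, (t (π l)).2) ∈ R.image t := by
      intro l hl'
      have hl'' : (t l).1 = (t k).1 := by simpa [R] using hl'
      obtain ⟨m, hm⟩ := ih _ hk l hl''
      rw [← hm]
      refine Finset.mem_image_of_mem _ ?_
      simp only [R, Finset.mem_filter, Finset.mem_univ, true_and]
      rw [hm]; exact hl''
    have hsub : R.image (fun l => ((t l).1, (t (π l)).2)) ⊆ R.image t := by
      intro x hx
      obtain ⟨l, hl', rfl⟩ := Finset.mem_image.1 hx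
      exact hmap l hl'
    have heq := Finset.eq_of_subset_of_card_le hsub (by
      rw [Finset.card_image_of_injective _ hinj, Finset.card_image_of_injective _ ht])
    have : t k ∈ R.image t := Finset.mem_image_of_mem _ (by simp [R])
    rw [← heq] at this
    obtain ⟨l, _, hl'⟩ := Finset.mem_image.1 this
    exact ⟨l, hl'⟩
  choose! g hg using hfull
  have hgB : ∀ k ∈ A, g k ∈ B.erase j := by
    intro k hk
    have h1 := hg k (hA k hk)
    have h2 := hA k hk
    simp only [A, Finset.mem_filter, Finset.mem_univ, true_and] at hk
    rw [Finset.mem_erase]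
    refine ⟨?_, ?_⟩
    · intro h
      rw [h] at h1
      have := congrArg Prod.fst h1
      simp only at this
      omega
    · simp only [B, Finset.mem_filter, Finset.mem_univ, true_and]
      rw [← hk, ← h1]
  have hcard := Finset.card_le_card_of_injOn g hgB (by
    intro k hk k' hk' h
    apply ht
    rw [← hg k (hA k hk), ← hg k' (hA k' hk'), h])
  have hjB : j ∈ B := by simp [B, hc]
  rw [Finset.card_erase_of_mem hjB, hAB] at hcard
  have := Finset.card_pos.2 ⟨j, hjB⟩
  omega

lemma vonNeumann_gg (t : Fin n → ℕ × ℕ) (ht : Function.Injective t)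
    (hl : IsLowerSet (Set.range t)) (π : Perm (Fin n)) :
    ∃ k : ℚ, Pm (fun j => (t j).1) * gg π * Pp (fun j => (t j).2) =
      k • (Pm (fun j => (t j).1) * Pp (fun j => (t j).2)) := by
  by_cases h : Function.Injective fun j => ((t j).1, (t (π⁻¹ j)).2)
  · have := fill_unique t ht hl π⁻¹ h
    choose ζ hζ using fun j => this _ j rfl
    have hζi : Function.Injective ζ := by
      intro a b hab
      apply h
      simp only
      rw [← hζ a, ← hζ b, hab]
    let z : Perm (Fin n) := Equiv.ofBijective ζ (Finite.injective_iff_bijective.1 hζi)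
    have hz : ∀ j, t (z j) = ((t j).1, (t (π⁻¹ j)).2) := hζ
    have hzR : z ∈ stab (fun j => (t j).1) := by
      rw [mem_stab]; intro j; rw [hz]
    have hzC : z * π ∈ stab (fun j => (t j).2) := by
      rw [mem_stab]; intro j; rw [Perm.mul_apply, hz]; simp
    refine ⟨sg z⁻¹, ?_⟩
    have : π = z⁻¹ * (z * π) := by group
    rw [this, gg_mul, ← mul_assoc, Pm_mul_gg (inv_mem_stab hzR), smul_mul_assoc, smul_mul_assoc,
      mul_assoc, gg_mul_Pp hzC]
  · refine ⟨0, ?_⟩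
    rw [zero_smul]
    simp only [Function.Injective, Prod.mk.injEq, not_forall, and_imp] at h
    obtain ⟨i, j, h1, h2, hij⟩ := h
    apply half_zero
    have hs : swap i j * π = π * swap (π⁻¹ i) (π⁻¹ j) := by
      rw [Equiv.mul_swap_eq_swap_mul]; simp
    have e1 : Pm (fun j => (t j).1) * gg (swap i j * π) * Pp (fun j => (t j).2) =
        Pm (fun j => (t j).1) * gg π * Pp (fun j => (t j).2) := by
      rw [hs, gg_mul, ← mul_assoc, mul_assoc _ (gg (swap _ _)),
        gg_mul_Pp (swap_mem_stab (by simpa using h2))]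
    rw [← e1, gg_mul, ← mul_assoc, Pm_mul_gg (swap_mem_stab h1), sg_swap hij]
    have e2 := e1
    rw [gg_mul, ← mul_assoc, Pm_mul_gg (swap_mem_stab h1), sg_swap hij] at e2
    rw [e2]
    simp only [neg_smul, one_smul, neg_mul] at e2
    exact e2.symm

lemma vonNeumann (t : Fin n → ℕ × ℕ) (ht : Function.Injective t)
    (hl : IsLowerSet (Set.range t)) (x : GA n) :
    ∃ k : ℚ, Pm (fun j => (t j).1) * x * Pp (fun j => (t j).2) =
      k • (Pm (fun j => (t j).1) * Pp (fun j => (t j).2)) := by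
  induction x using MonoidAlgebra.induction_on with
  | of π => exact vonNeumann_gg t ht hl π
  | add a b ha hb =>
    obtain ⟨k, hk⟩ := ha
    obtain ⟨k', hk'⟩ := hb
    exact ⟨k + k', by rw [mul_add, add_mul, hk, hk', add_smul]⟩
  | smul r a ha =>
    obtain ⟨k, hk⟩ := ha
    exact ⟨r * k, by rw [mul_smul_comm, smul_mul_assoc, hk, smul_smul]⟩

lemma trace_mulLeft (x : GA n) :
    LinearMap.trace ℚ (GA n) (LinearMap.mulLeft ℚ x) = n ! * x.coeff 1 := by
  classical
  rw [LinearMap.trace_eq_matrix_trace ℚ (MonoidAlgebra.basis (Perm (Fin n)) ℚ), Matrix.trace]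
  have : ∀ g, (LinearMap.toMatrix (MonoidAlgebra.basis (Perm (Fin n)) ℚ)
      (MonoidAlgebra.basis (Perm (Fin n)) ℚ) (LinearMap.mulLeft ℚ x)).diag g = x.coeff 1 := by
    intro g
    rw [Matrix.diag_apply, LinearMap.toMatrix_apply]
    simp [MonoidAlgebra.basis]
  simp only [this]
  simp [Fintype.card_perm]

lemma coeff_symm (t : Fin n → ℕ × ℕ) (ht : Function.Injective t) :
    (Pm (fun j => (t j).1) * Pp (fun j => (t j).2)).coeff 1 = 1 := by
  have : Pm (fun j => (t j).1) * Pp (fun j => (t j).2) =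
      ∑ σ ∈ stab (fun j => (t j).1), ∑ τ ∈ stab (fun j => (t j).2), sg σ • gg (σ * τ) := by
    rw [Pm, Pp, Finset.sum_mul_sum]
    simp only [smul_mul_assoc, gg_mul]
  rw [this]
  simp only [MonoidAlgebra.coeff_sum, Finsupp.finsetSum_apply]
  have h1 : ∀ σ ∈ stab (fun j => (t j).1), ∀ τ ∈ stab (fun j => (t j).2), (sg σ • gg (σ * τ)).coeff 1
      = if σ = 1 ∧ τ = 1 then 1 else 0 := by
    intro σ hσ τ hτ
    split_ifs with h
    · rw [h.1, h.2, sg_one]; simp [gg]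
    · have : σ * τ ≠ 1 := by
        intro h'
        apply h
        have h2 : τ = σ⁻¹ := (inv_eq_of_mul_eq_one_right h').symm
        have h3 : τ = 1 := by
          ext1 j
          apply ht
          apply Prod.ext
          · exact mem_stab.1 (h2 ▸ inv_mem_stab hσ) j
          · exact mem_stab.1 hτ j
        refine ⟨?_, h3⟩
        rw [h3, mul_one] at h'; exact h'
      simp [gg, Finsupp.single_apply, this]
  rw [Finset.sum_congr rfl fun σ hσ => Finset.sum_congr rfl fun τ hτ => h1 σ hσ τ hτ]
  rw [Finset.sum_eq_single 1, Finset.sum_eq_single 1]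
  · simp
  · intro b _ hb; simp [hb]
  · intro h; exact absurd (one_mem_stab _) h
  · intro b _ hb; simp [hb]
  · intro h; exact absurd (one_mem_stab _) h

lemma symm_sq (t : Fin n → ℕ × ℕ) (ht : Function.Injective t)
    (hl : IsLowerSet (Set.range t)) :
    ∃ k : ℚ, k ≠ 0 ∧ (Pm (fun j => (t j).1) * Pp (fun j => (t j).2)) *
      (Pm (fun j => (t j).1) * Pp (fun j => (t j).2)) =
      k • (Pm (fun j => (t j).1) * Pp (fun j => (t j).2)) := by
  obtain ⟨k, hk⟩ := vonNeumann t ht hl (Pp (fun j => (t j).2) * Pm (fun j => (t j).1))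
  refine ⟨k, ?_, by rw [← hk]; simp only [mul_assoc]⟩
  rintro rfl
  set e := Pm (fun j => (t j).1) * Pp (fun j => (t j).2) with he
  have h0 : e * e = 0 := by
    rw [zero_smul] at hk; rw [← hk, he]; simp only [mul_assoc]
  have hnil : IsNilpotent (LinearMap.mulLeft ℚ e) := by
    refine ⟨2, ?_⟩
    rw [pow_two]
    refine LinearMap.ext fun x => ?_
    change e * (e * x) = 0
    rw [← mul_assoc, h0, zero_mul]
  have h1 := (LinearMap.isNilpotent_trace_of_isNilpotent hnil).eq_zero
  rw [trace_mulLeft, coeff_symm t ht, mul_one] at h1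
  exact (Nat.cast_ne_zero.2 (Nat.factorial_ne_zero n)) h1

/-- action on polynomials -/
noncomputable def act : GA n →ₐ[ℚ] Module.End ℚ (MvPolynomial (Fin n) ℚ) :=
  MonoidAlgebra.lift ℚ _ _
    { toFun := fun π => (rename π : MvPolynomial (Fin n) ℚ →ₐ[ℚ] _).toLinearMap
      map_one' := LinearMap.ext fun f => by simp
      map_mul' := fun a b => LinearMap.ext fun f => rename_mul_perm a b f }

lemma act_gg (π : Perm (Fin n)) (f : MvPolynomial (Fin n) ℚ) : act (gg π) f = rename π f := by
  simp [act, gg]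

lemma beta_rename_mul (π : Perm (Fin n)) (f g : MvPolynomial (Fin n) ℚ) :
    beta (rename π f * g) = sg π * beta (f * rename (⇑π⁻¹) g) := by
  rw [← beta_rename, map_mul (rename π), ← rename_mul_perm]; simp

lemma act_Pp (p : Fin n → ℕ) (f : MvPolynomial (Fin n) ℚ) :
    act (Pp p) f = ∑ σ ∈ stab p, rename σ f := by
  simp [Pp, map_sum, act_gg]

lemma act_Pm (p : Fin n → ℕ) (f : MvPolynomial (Fin n) ℚ) :
    act (Pm p) f = ∑ σ ∈ stab p, sg σ • rename σ f := by
  simp [Pm, map_sum, act_gg]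

lemma sum_stab_inv {M : Type*} [AddCommMonoid M] (p : Fin n → ℕ) (f : Perm (Fin n) → M) :
    ∑ σ ∈ stab p, f σ⁻¹ = ∑ σ ∈ stab p, f σ := by
  refine Finset.sum_bij' (fun σ _ => σ⁻¹) (fun σ _ => σ⁻¹) ?_ ?_ ?_ ?_ ?_ <;>
    intro σ hσ
  · exact inv_mem_stab hσ
  · exact inv_mem_stab hσ
  · simp
  · simp
  · rfl

lemma beta_Pp (p : Fin n → ℕ) (f g : MvPolynomial (Fin n) ℚ) :
    beta (act (Pp p) f * g) = beta (f * act (Pm p) g) := by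
  rw [act_Pp, act_Pm, Finset.sum_mul, Finset.mul_sum, map_sum, map_sum]
  rw [← sum_stab_inv p]
  refine Finset.sum_congr rfl fun σ _ => ?_
  rw [beta_rename_mul, mul_smul_comm, map_smul, smul_eq_mul, inv_inv, sg_inv]

lemma beta_Pm (p : Fin n → ℕ) (f g : MvPolynomial (Fin n) ℚ) :
    beta (act (Pm p) f * g) = beta (f * act (Pp p) g) := by
  rw [act_Pp, act_Pm, Finset.sum_mul, Finset.mul_sum, map_sum, map_sum]
  rw [← sum_stab_inv p]
  refine Finset.sum_congr rfl fun σ _ => ?_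
  rw [smul_mul_assoc, map_smul, beta_rename_mul, smul_eq_mul, inv_inv, ← mul_assoc, sg_sq, one_mul]

end HS

namespace HS

open Equiv

variable {n : ℕ}

/-- position function of a standard tableau -/
structure IsPos (t : Fin n → ℕ × ℕ) : Prop where
  inj : Function.Injective t
  lower : IsLowerSet (Set.range t)
  std : ∀ i j, t i ≤ t j → i ≤ j

/-- properties of the index function of a tableau -/
structure IsIdx (s : Fin n → ℕ × ℕ) (ν : Fin n → ℕ) : Prop where
  mono : ∀ i j, i ≤ j → ν i ≤ ν j
  le : ∀ i, ν i ≤ (i : ℕ)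
  comono : ∀ i j : Fin n, i ≤ j → (i : ℕ) - ν i ≤ (j : ℕ) - ν j
  row : ∀ i j, i ≤ j → ν i = ν j → (s j).1 ≤ (s i).1
  col : ∀ i j : Fin n, i ≤ j → (i : ℕ) - ν i = (j : ℕ) - ν j → (s j).2 ≤ (s i).2

lemma next_eq {s s' : Fin n → ℕ × ℕ} (hs : Function.Injective s) (hs' : IsPos s') {m : Fin n}
    (h : ∀ i < m, s i = s' i) (hle : s m ≤ s' m) : s m = s' m := by
  obtain ⟨i, hi⟩ := hs'.lower hle ⟨m, rfl⟩
  have him : i ≤ m := hs'.std _ _ (hi ▸ hle)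
  rcases him.lt_or_eq with h1 | h1
  · rw [← h i h1] at hi
    exact absurd (hs hi) h1.ne
  · rw [← hi, h1]

lemma pigeon {A : Type*} (f : Fin n → A) (ψ : Perm (Fin n)) (m : Fin n)
    (h : ∀ i < m, f (ψ i) = f i) : ∃ j, m ≤ j ∧ f (ψ m) = f j := by
  classical
  by_contra hno
  push Not at hno
  let B : Finset (Fin n) := Finset.univ.filter fun k => f k = f (ψ m)
  let B' : Finset (Fin n) := Finset.univ.filter fun k => f (ψ k) = f (ψ m)
  have hc : B'.card = B.card := by
    refine Finset.card_bij (fun k _ => ψ k) ?_ ?_ ?_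
    · intro k hk; simpa [B, B'] using hk
    · intro k _ k' _ h; exact ψ.injective h
    · intro k hk; exact ⟨ψ.symm k, by simpa [B, B'] using hk, by simp⟩
  have hlt : ∀ k ∈ B, k < m := by
    intro k hk
    by_contra hk'
    exact hno k (not_lt.1 hk') (by simpa [B, eq_comm] using hk)
  have hss : B ⊂ B' := by
    refine Finset.ssubset_iff.2 ⟨m, fun hm => (hlt m hm).ne rfl, ?_⟩
    intro k hk
    rcases Finset.mem_insert.1 hk with rfl | hk
    · simp [B']
    · simp only [B', Finset.mem_filter, Finset.mem_univ, true_and]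
      rw [h k (hlt k hk)]; simpa [B] using hk
  have := Finset.card_lt_card hss
  omega

lemma S_step {s s' U : Fin n → ℕ × ℕ} (hs : IsPos s) (hs' : IsPos s')
    (hU : Function.Injective U) {ν ν' : Fin n → ℕ} (hν : IsIdx s ν) (hν' : IsIdx s' ν')
    (ψ ψ' : Perm (Fin n)) (h1 : ∀ k, (U k).1 = (s (ψ k)).1) (h2 : ∀ k, (U k).2 = (s' (ψ' k)).2)
    (h3 : ∀ k, ν (ψ k) + ((ψ' k : ℕ) - ν' (ψ' k)) = k) (m : Fin n)
    (ih : ∀ i < m, s i = s' i ∧ U i = s i ∧ ν (ψ i) = ν i ∧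
      (ψ' i : ℕ) - ν' (ψ' i) = (i : ℕ) - ν' i) :
    ν m ≤ ν' m ∧ (ν m = ν' m → (s' m).1 ≤ (s m).1 ∧ ((s' m).1 = (s m).1 →
      s m = s' m ∧ U m = s m ∧ ν (ψ m) = ν m ∧
      (ψ' m : ℕ) - ν' (ψ' m) = (m : ℕ) - ν' m)) := by
  obtain ⟨j, hj, ej⟩ := pigeon (fun k => (ν k, (s k).1)) ψ m (by
    intro i hi
    obtain ⟨_, b, c, _⟩ := ih i hi
    simp only [Prod.mk.injEq]
    exact ⟨c, by rw [← h1, b]⟩)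
  obtain ⟨j', hj', ej'⟩ := pigeon (fun k => ((k : ℕ) - ν' k, (s' k).2)) ψ' m (by
    intro i hi
    obtain ⟨a, b, _, c⟩ := ih i hi
    simp only [Prod.mk.injEq]
    exact ⟨c, by rw [← h2, b, a]⟩)
  simp only [Prod.mk.injEq] at ej ej'
  have k1 := hν.mono _ _ hj
  have k2 := hν'.comono _ _ hj'
  have k3 := h3 m
  have k4 := hν.le m
  have k5 := hν'.le m
  refine ⟨by omega, fun he => ?_⟩
  have r := hν.row m j hj (by omega)
  have c := hν'.col m j' hj' (by omega)
  rw [← ej.2, ← h1] at r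
  rw [← ej'.2, ← h2] at c
  have key : (s m).1 ≤ (s' m).1 → U m = s' m := by
    intro hle
    refine next_eq hU hs' (fun i hi => ?_) (Prod.le_def.2 ⟨r.trans hle, c⟩)
    rw [(ih i hi).2.1, (ih i hi).1]
  refine ⟨?_, fun heq => ?_⟩
  · by_contra hlt
    have := key (by omega)
    rw [this] at r
    omega
  · have hss : s m = s' m := by
      rcases le_total (s m).2 (s' m).2 with h | h
      · exact next_eq hs.inj hs' (fun i hi => (ih i hi).1) (Prod.le_def.2 ⟨heq.ge, h⟩)
      · exact (next_eq hs'.inj hs (fun i hi => (ih i hi).1.symm) (Prod.le_def.2 ⟨heq.le, h⟩)).symm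
    refine ⟨hss, by rw [hss]; exact key heq.ge, by omega, by omega⟩

lemma T_step {t t' : Fin n → ℕ × ℕ} (ht' : IsPos t')
    (H : ∀ i j, i ≠ j → (t i).2 = (t j).2 → (t' i).1 ≠ (t' j).1) (m : Fin n)
    (ih : ∀ i < m, (t i).2 = (t' i).2) : (t' m).2 ≤ (t m).2 := by
  by_contra hlt
  have hle : ((t' m).1, (t m).2) ≤ t' m := Prod.le_def.2 ⟨le_rfl, (not_le.1 hlt).le⟩
  obtain ⟨i, hi⟩ := ht'.lower hle ⟨m, rfl⟩
  have him : i ≤ m := ht'.std _ _ (hi ▸ hle)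
  have hne : i ≠ m := by
    rintro rfl
    have := congrArg Prod.snd hi
    simp only at this
    omega
  refine H i m hne ?_ ?_
  · rw [ih i (lt_of_le_of_ne him hne), hi]
  · rw [hi]

lemma T_eq {t t' : Fin n → ℕ × ℕ} (ht : IsPos t) (ht' : IsPos t')
    (h : ∀ i, (t i).2 = (t' i).2) : t = t' := by
  have : ∀ m, t m = t' m := by
    intro m
    induction m using WellFoundedLT.induction with
    | _ m ih =>
    rcases le_total (t m).1 (t' m).1 with h' | h'
    · exact next_eq ht.inj ht' ih (Prod.le_def.2 ⟨h', (h m).le⟩)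
    · exact (next_eq ht'.inj ht (fun i hi => (ih i hi).symm) (Prod.le_def.2 ⟨h', (h m).ge⟩)).symm
  exact funext this

lemma lex_lt_of {A : Type*} [LinearOrder A] {k k' : Fin n → A} (hne : k ≠ k')
    (h : ∀ m, (∀ i < m, k i = k' i) → k m ≤ k' m) : toLex k < toLex k' := by
  rcases lt_trichotomy (toLex k) (toLex k') with h1 | h1 | h1
  · exact h1
  · exact absurd (toLex.injective h1) hne
  · obtain ⟨m, hm, hm'⟩ := h1
    exact absurd (h m fun i hi => (hm i hi).symm) (not_le.2 hm')

/-- monomials -/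
noncomputable def mon (a : Fin n → ℕ) : MvPolynomial (Fin n) ℚ :=
  monomial (Finsupp.equivFunOnFinite.symm a) 1

lemma mon_mul (a b : Fin n → ℕ) : mon a * mon b = mon (fun j => a j + b j) := by
  rw [mon, mon, mon, monomial_mul, mul_one]
  have : (Finsupp.equivFunOnFinite.symm a + Finsupp.equivFunOnFinite.symm b : Fin n →₀ ℕ) =
      Finsupp.equivFunOnFinite.symm fun j => a j + b j := by
    ext j; simp
  rw [this]

lemma rename_mon (σ : Perm (Fin n)) (a : Fin n → ℕ) :
    rename σ (mon a) = mon (fun j => a (σ⁻¹ j)) := by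
  rw [mon, mon, rename_monomial]
  have : Finsupp.mapDomain σ (Finsupp.equivFunOnFinite.symm a) =
      Finsupp.equivFunOnFinite.symm fun j => a (σ⁻¹ j) := by
    ext j
    have := Finsupp.mapDomain_apply σ.injective (Finsupp.equivFunOnFinite.symm a) (σ⁻¹ j)
    simpa using this
  rw [this]

lemma beta_mon_of (u : Perm (Fin n)) : beta (mon fun j => (u j : ℕ)) = sg u :=
  beta_monomial_of u _ fun _ => rfl

lemma exists_of_beta_mon {a : Fin n → ℕ} (h : beta (mon a) ≠ 0) :
    ∃ u : Perm (Fin n), ∀ j, a j = u j := exists_of_beta_monomial _ h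

/-- combinatorial data attached to a pair of tableaux -/
structure Dat (n : ℕ) where
  s : Fin n → ℕ × ℕ
  t : Fin n → ℕ × ℕ
  ν : Fin n → ℕ
  ρ : Perm (Fin n)
  hs : IsPos s
  ht : IsPos t
  hν : IsIdx s ν
  hρ : ∀ j, s (ρ j) = t j

namespace Dat

/-- row of t -/
def r (D : Dat n) : Fin n → ℕ := fun j => (D.t j).1
/-- column of t -/
def c (D : Dat n) : Fin n → ℕ := fun j => (D.t j).2
/-- monomial -/
noncomputable def m (D : Dat n) : MvPolynomial (Fin n) ℚ := mon fun j => D.ν (D.ρ j)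
/-- dual monomial -/
noncomputable def m' (D : Dat n) : MvPolynomial (Fin n) ℚ :=
  mon fun j => (D.ρ j : ℕ) - D.ν (D.ρ j)
/-- higher Specht polynomial -/
noncomputable def F (D : Dat n) : MvPolynomial (Fin n) ℚ := act (Pm D.c * Pp D.r) D.m
/-- dual polynomial -/
noncomputable def G (D : Dat n) : MvPolynomial (Fin n) ℚ := act (Pm D.r * Pp D.c) D.m'

lemma beta_FG (D D' : Dat n) : beta (D.F * D'.G) =
    beta (D.m * act ((Pm D.r * Pp D.c) * (Pm D'.r * Pp D'.c)) D'.m') := by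
  rw [F, map_mul act, Module.End.mul_apply, beta_Pm, beta_Pp, G, map_mul act (Pm D.r * Pp D.c),
    map_mul act (Pm D.r)]
  rfl

lemma terms (D D' : Dat n) :
    beta (D.m * act (Pm D.r * Pp D.c) D'.m') =
    ∑ σ ∈ stab D.r, ∑ τ ∈ stab D.c,
      beta (mon fun j => D.ν (D.ρ (σ⁻¹ j)) + ((D'.ρ (τ⁻¹ j) : ℕ) - D'.ν (D'.ρ (τ⁻¹ j)))) := by
  rw [map_mul act, Module.End.mul_apply, ← beta_Pp, act_Pp, act_Pp, Finset.sum_mul_sum, map_sum]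
  refine Finset.sum_congr rfl fun σ _ => ?_
  rw [map_sum]
  refine Finset.sum_congr rfl fun τ _ => ?_
  rw [m, m', rename_mon, rename_mon, mon_mul]

/-- analysis of one nonzero term -/
lemma term_step (D D' : Dat n) (h : D.t = D'.t) {σ τ u : Perm (Fin n)} (hσ : σ ∈ stab D.r)
    (hτ : τ ∈ stab D.c)
    (hu : ∀ j, D.ν (D.ρ (σ⁻¹ j)) + ((D'.ρ (τ⁻¹ j) : ℕ) - D'.ν (D'.ρ (τ⁻¹ j))) = u j) (m : Fin n)
    (ih : ∀ i < m, D.ν i = D'.ν i ∧ (D.s i).1 = (D'.s i).1) :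
    (D.s m = D'.s m → D.ν m = D'.ν m → D.t (u⁻¹ m) = D.s m) ∧
    D.ν m ≤ D'.ν m ∧ (D.ν m = D'.ν m → (D'.s m).1 ≤ (D.s m).1 ∧ ((D'.s m).1 = (D.s m).1 →
      D.s m = D'.s m)) := by
  have key := S_step D.hs D'.hs (U := fun k => D.t (u⁻¹ k))
    (D.ht.inj.comp u⁻¹.injective) D.hν D'.hν (D.ρ * σ⁻¹ * u⁻¹) (D'.ρ * τ⁻¹ * u⁻¹)
    (by
      intro k
      have := mem_stab.1 (inv_mem_stab hσ) (u⁻¹ k)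
      simp only [Perm.mul_apply, D.hρ]
      exact this.symm)
    (by
      intro k
      have := mem_stab.1 (inv_mem_stab hτ) (u⁻¹ k)
      simp only [Perm.mul_apply, D'.hρ, ← h]
      exact this.symm)
    (by
      intro k
      simp only [Perm.mul_apply]
      rw [hu]; simp)
  have all : ∀ i < m, D.s i = D'.s i ∧ D.t (u⁻¹ i) = D.s i ∧
      D.ν ((D.ρ * σ⁻¹ * u⁻¹) i) = D.ν i ∧
      ((D'.ρ * τ⁻¹ * u⁻¹) i : ℕ) - D'.ν ((D'.ρ * τ⁻¹ * u⁻¹) i) = (i : ℕ) - D'.ν i := by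
    intro i
    induction i using WellFoundedLT.induction with
    | _ i ih2 =>
    intro him
    exact ((key i fun j hj => ih2 j hj (hj.trans him)).2 (ih i him).1).2 (ih i him).2.symm
  have k := key m all
  refine ⟨?_, k.1, fun h => ⟨(k.2 h).1, fun h' => ((k.2 h).2 h').1⟩⟩
  intro e1 e2
  exact ((k.2 e2).2 (by rw [e1])).2.1

/-- key of first tableau -/
def keyS (D : Dat n) : Fin n → Lex (ℕ × ℕᵒᵈ) :=
  fun k => toLex (D.ν k, OrderDual.toDual (D.s k).1)

/-- key of second tableau -/
def keyT (D : Dat n) : Fin n → ℕᵒᵈ := fun k => OrderDual.toDual (D.t k).2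

/-- total key -/
def key (D : Dat n) : Lex (Lex (Fin n → ℕᵒᵈ) × Lex (Fin n → Lex (ℕ × ℕᵒᵈ))) :=
  toLex (toLex D.keyT, toLex D.keyS)

lemma keyS_eq_iff (D D' : Dat n) (i : Fin n) :
    D.keyS i = D'.keyS i ↔ D.ν i = D'.ν i ∧ (D.s i).1 = (D'.s i).1 := by
  simp [keyS]

lemma tri (D D' : Dat n) (h : beta (D.F * D'.G) ≠ 0) :
    (D.s = D'.s ∧ D.t = D'.t) ∨ D.key < D'.key := by
  rw [beta_FG] at h
  by_cases ht : D.t = D'.t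
  · have hr : D'.r = D.r := by funext j; simp only [r, ht]
    have hc : D'.c = D.c := by funext j; simp only [c, ht]
    obtain ⟨k, hk0, hk⟩ := symm_sq D.t D.ht.inj D.ht.lower
    change (Pm D.r * Pp D.c) * (Pm D.r * Pp D.c) = k • (Pm D.r * Pp D.c) at hk
    rw [hr, hc, hk, map_smul act, LinearMap.smul_apply, mul_smul_comm, map_smul, smul_eq_mul] at h
    have h := right_ne_zero_of_mul h
    rw [terms D D'] at h
    obtain ⟨σ, hσ, h⟩ := Finset.exists_ne_zero_of_sum_ne_zero h
    obtain ⟨τ, hτ, h⟩ := Finset.exists_ne_zero_of_sum_ne_zero h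
    obtain ⟨u, hu⟩ := exists_of_beta_mon h
    have step := term_step D D' ht hσ hτ hu
    by_cases hS : D.keyS = D'.keyS
    · left
      refine ⟨?_, ht⟩
      have h' : ∀ i, D.ν i = D'.ν i ∧ (D.s i).1 = (D'.s i).1 :=
        fun i => (keyS_eq_iff D D' i).1 (congrFun hS i)
      funext m
      exact ((step m fun i _ => h' i).2.2 (h' m).1).2 (h' m).2.symm
    · right
      rw [key, key, Prod.Lex.toLex_lt_toLex]
      right
      refine ⟨congrArg toLex (by funext j; simp only [keyT, ht]), lex_lt_of hS fun m hm => ?_⟩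
      have := (step m fun i hi => (keyS_eq_iff D D' i).1 (hm i hi)).2
      rw [keyS, keyS, Prod.Lex.toLex_le_toLex]
      rcases this.1.lt_or_eq with h1 | h1
      · exact Or.inl h1
      · exact Or.inr ⟨h1, (this.2 h1).1⟩
  · right
    rw [key, key, Prod.Lex.toLex_lt_toLex]
    left
    refine lex_lt_of ?_ ?_
    · intro he
      exact ht (T_eq D.ht D'.ht fun i => congrFun he i)
    · intro m hm
      refine T_step (t := D.t) (t' := D'.t) D'.ht ?_ m fun i hi => hm i hi
      intro i j hij h1 h2
      apply h
      have : Pp D.c * Pm D'.r = 0 := Pp_mul_Pm_eq_zero hij h1 h2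
      have h0 : (Pm D.r * Pp D.c) * (Pm D'.r * Pp D'.c) = 0 := by
        rw [mul_assoc, ← mul_assoc (Pp D.c), this, zero_mul, mul_zero]
      rw [h0]; simp

lemma diag (D : Dat n) : beta (D.F * D.G) ≠ 0 := by
  rw [beta_FG]
  obtain ⟨k, hk0, hk⟩ := symm_sq D.t D.ht.inj D.ht.lower
  change (Pm D.r * Pp D.c) * (Pm D.r * Pp D.c) = k • (Pm D.r * Pp D.c) at hk
  rw [hk, map_smul act, LinearMap.smul_apply, mul_smul_comm, map_smul, smul_eq_mul]
  refine mul_ne_zero hk0 ?_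
  rw [terms D D]
  set f : Perm (Fin n) → Perm (Fin n) → ℚ := fun σ τ =>
    beta (mon fun j => D.ν (D.ρ (σ⁻¹ j)) + ((D.ρ (τ⁻¹ j) : ℕ) - D.ν (D.ρ (τ⁻¹ j)))) with hf
  have h1 : ∀ σ ∈ stab D.r, ∀ τ ∈ stab D.c, 0 ≤ sg D.ρ * f σ τ := by
    intro σ hσ τ hτ
    by_cases h : f σ τ = 0
    · rw [h, mul_zero]
    · obtain ⟨u, hu⟩ := exists_of_beta_mon h
      have huρ : u = D.ρ := by
        have : ∀ m, D.ρ (u⁻¹ m) = m := by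
          intro m
          apply D.hs.inj
          rw [D.hρ]
          exact (term_step D D rfl hσ hτ hu m fun i _ => ⟨rfl, rfl⟩).1 rfl rfl
        ext1 j
        have := this (u j)
        simpa using this.symm
      have : f σ τ = sg u := by
        rw [hf]; simp only [hu]; exact beta_mon_of u
      rw [this, huρ, sg_sq]; exact zero_le_one
  have h2 : sg D.ρ * f 1 1 = 1 := by
    have : f 1 1 = sg D.ρ := by
      rw [hf, ← beta_mon_of]
      simp only
      congr 2
      funext j
      have := D.hν.le (D.ρ j)
      simp only [inv_one, Perm.one_apply]
      omega
    rw [this, sg_sq]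
  intro h0
  have h3 : ∑ σ ∈ stab D.r, ∑ τ ∈ stab D.c, sg D.ρ * f σ τ = 0 := by
    simp only [← Finset.mul_sum]
    exact mul_eq_zero_of_right _ h0
  rw [Finset.sum_eq_zero_iff_of_nonneg fun σ hσ => Finset.sum_nonneg fun τ hτ => h1 σ hσ τ hτ] at h3
  have h4 := h3 1 (one_mem_stab _)
  rw [Finset.sum_eq_zero_iff_of_nonneg fun τ hτ => h1 1 (one_mem_stab _) τ hτ] at h4
  have h5 := h4 1 (one_mem_stab _)
  rw [h2] at h5
  exact one_ne_zero h5

lemma mon_degree (a : Fin n → ℕ) : (mon a).totalDegree = ∑ j, a j := by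
  rw [mon, totalDegree_monomial _ one_ne_zero]
  rw [Finsupp.sum_fintype _ _ (by simp)]
  simp

lemma act_degree (x : GA n) (f : MvPolynomial (Fin n) ℚ) :
    (act x f).totalDegree ≤ f.totalDegree := by
  induction x using MonoidAlgebra.induction_on with
  | of π =>
    change (act (gg π) f).totalDegree ≤ _
    rw [act_gg]; exact totalDegree_rename_le _ _
  | add a b ha hb =>
    rw [map_add, LinearMap.add_apply]
    exact (totalDegree_add _ _).trans (max_le ha hb)
  | smul r a ha =>
    rw [map_smul, LinearMap.smul_apply]
    exact (totalDegree_smul_le _ _).trans ha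

/-- degree -/
def d (D : Dat n) : ℕ := ∑ j, D.ν j

lemma F_degree (D : Dat n) : D.F.totalDegree ≤ D.d := by
  refine (act_degree _ _).trans ?_
  rw [m, mon_degree, d, Equiv.sum_comp D.ρ D.ν]

lemma G_degree (D : Dat n) : D.G.totalDegree + D.d ≤ ∑ i : Fin n, (i : ℕ) := by
  have h := act_degree (Pm D.r * Pp D.c) D.m'
  rw [m', mon_degree, Equiv.sum_comp D.ρ (fun k => (k : ℕ) - D.ν k)] at h
  refine (Nat.add_le_add_right h _).trans (le_of_eq ?_)
  rw [d, ← Finset.sum_add_distrib]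
  refine Finset.sum_congr rfl fun i _ => ?_
  have := D.hν.le i
  omega

end Dat

lemma gram_nonsing {ι K : Type} [Fintype ι] [LinearOrder K] (key : ι → K) (M : ι → ι → ℚ)
    (h : ∀ i j, M i j ≠ 0 → i = j ∨ key i < key j) (hd : ∀ i, M i i ≠ 0) (c : ι → ℚ)
    (hc : ∀ j, ∑ i, c i * M i j = 0) : c = 0 := by
  classical
  by_contra hne
  obtain ⟨i1, hi1⟩ := Function.ne_iff.1 hne
  obtain ⟨i0, hi0, hmin⟩ := Finset.exists_min_image (Finset.univ.filter fun i => c i ≠ 0) key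
    ⟨i1, by simpa using hi1⟩
  have h0 := hc i0
  rw [Finset.sum_eq_single i0] at h0
  · exact (mul_ne_zero (by simpa using hi0) (hd i0)) h0
  · intro i _ hne
    by_contra hz
    have h1 := left_ne_zero_of_mul hz
    rcases h i i0 (right_ne_zero_of_mul hz) with h2 | h2
    · exact hne h2
    · exact absurd (hmin i (by simpa using h1)) (not_le.2 h2)
  · simp

theorem basis_of_dat {ι : Type} [Fintype ι] (hι : Fintype.card ι = n !) (D : ι → Dat n)
    (hD : ∀ i j, (D i).s = (D j).s → (D i).t = (D j).t → i = j) :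
    ∃ b : Module.Basis ι (symmetricSubalgebra (Fin n) ℚ) (MvPolynomial (Fin n) ℚ),
      ∀ x, b x = (D x).F := by
  refine abstract_basis hι (fun i => (D i).F) (fun i => (D i).G) (fun i => (D i).d)
    (fun i => (D i).F_degree) (fun i => (D i).G_degree) ?_
  refine gram_nonsing (fun i => (D i).key) (fun i j => beta ((D i).F * (D j).G)) ?_
    fun i => (D i).diag
  intro i j h
  rcases Dat.tri _ _ h with h | h
  · exact Or.inl (hD i j h.1 h.2)
  · exact Or.inr h

end HS

namespace HS

open Equiv

variable {n : ℕ}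

lemma isIdx_of_steps (s : Fin n → ℕ × ℕ) (ν : ℕ → ℕ) (h0 : ν 0 = 0)
    (hstep : ∀ k, ν (k + 1) = ν k ∨ ν (k + 1) = ν k + 1)
    (hr : ∀ k (h : k + 1 < n), ν (k + 1) = ν k → (s ⟨k + 1, h⟩).1 ≤ (s ⟨k, by omega⟩).1)
    (hc : ∀ k (h : k + 1 < n), ν (k + 1) = ν k + 1 → (s ⟨k + 1, h⟩).2 ≤ (s ⟨k, by omega⟩).2) :
    IsIdx s (fun k => ν k) := by
  have hle : ∀ k, ν k ≤ k := by
    intro k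
    induction k with
    | zero => omega
    | succ k ih => have := hstep k; omega
  have hmono : ∀ i j, i ≤ j → ν i ≤ ν j := by
    intro i j hij
    induction j, hij using Nat.le_induction with
    | base => exact le_rfl
    | succ k _ ih => have := hstep k; omega
  have hcom : ∀ i j, i ≤ j → i - ν i ≤ j - ν j := by
    intro i j hij
    induction j, hij using Nat.le_induction with
    | base => exact le_rfl
    | succ k _ ih => have := hstep k; have := hle k; omega
  refine ⟨fun i j h => hmono _ _ h, fun i => hle _, fun i j h => hcom _ _ h, ?_, ?_⟩
  · rintro ⟨i, hi⟩ ⟨j, hj⟩ hij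
    have hij : i ≤ j := hij
    simp only
    induction j, hij using Nat.le_induction with
    | base => intro _; exact le_rfl
    | succ k hk ih =>
      intro he
      have h1 := hmono i k hk
      have h2 := hstep k
      exact (hr k hj (by omega)).trans (ih (by omega) hk (by omega))
  · rintro ⟨i, hi⟩ ⟨j, hj⟩ hij
    have hij : i ≤ j := hij
    simp only
    induction j, hij using Nat.le_induction with
    | base => intro _; exact le_rfl
    | succ k hk ih =>
      intro he
      have h1 := hcom i k hk
      have h2 := hstep k
      have h3 := hle k
      exact (hc k hj (by omega)).trans (ih (by omega) hk (by omega))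

/-- position function -/
def pos (μ : YoungDiagram) (S : ↥μ.cells ≃ Fin μ.card) : Fin μ.card → ℕ × ℕ :=
  fun j => (S.symm j : ℕ × ℕ)

lemma pos_apply (μ : YoungDiagram) (S : ↥μ.cells ≃ Fin μ.card) (c : μ.cells) :
    pos μ S (S c) = c := by simp [pos]

lemma range_pos (μ : YoungDiagram) (S : ↥μ.cells ≃ Fin μ.card) :
    Set.range (pos μ S) = (μ.cells : Set (ℕ × ℕ)) := by
  ext x
  constructor
  · rintro ⟨j, rfl⟩; exact (S.symm j).2
  · intro hx; exact ⟨S ⟨x, hx⟩, pos_apply μ S ⟨x, hx⟩⟩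

lemma isPos_pos (μ : YoungDiagram) (S : ↥μ.cells ≃ Fin μ.card) (hS : IsStandardYT μ S) :
    IsPos (pos μ S) := by
  refine ⟨Subtype.val_injective.comp S.symm.injective, ?_, ?_⟩
  · rw [range_pos]; exact μ.isLowerSet
  · have key : ∀ c d : μ.cells, (c : ℕ × ℕ) ≤ d → S c ≤ S d := by
      rintro ⟨⟨r, c⟩, hc⟩ ⟨⟨r', c'⟩, hd⟩ hle
      obtain ⟨h1, h2⟩ := Prod.mk_le_mk.1 hle
      have hm : (r, c') ∈ μ.cells := μ.isLowerSet (Prod.mk_le_mk.2 ⟨h1, le_rfl⟩) hd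
      have e1 : S ⟨(r, c), hc⟩ ≤ S ⟨(r, c'), hm⟩ := by
        rcases h2.lt_or_eq with h | h
        · exact (hS.1 ⟨(r, c), hc⟩ ⟨(r, c'), hm⟩ rfl h).le
        · subst h; exact le_rfl
      have e2 : S ⟨(r, c'), hm⟩ ≤ S ⟨(r', c'), hd⟩ := by
        rcases h1.lt_or_eq with h | h
        · exact (hS.2 ⟨(r, c'), hm⟩ ⟨(r', c'), hd⟩ rfl h).le
        · subst h; exact le_rfl
      exact e1.trans e2
    intro i j h
    have := key (S.symm i) (S.symm j) h
    simpa using this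

lemma mem_col (μ : YoungDiagram) (S : ↥μ.cells ≃ Fin μ.card) (c x : ℕ)
    (hx : x ∈ ((List.range (μ.colLen c)).reverse).filterMap fun r =>
      if h : (r, c) ∈ μ.cells then some ((S ⟨(r, c), h⟩ : Fin μ.card) : ℕ) else none) :
    ∀ i : Fin μ.card, (i : ℕ) = x → (pos μ S i).2 = c := by
  rw [List.mem_filterMap] at hx
  obtain ⟨r, _, hr⟩ := hx
  split_ifs at hr with h
  intro i hi
  have : i = S ⟨(r, c), h⟩ := Fin.ext (by rw [hi]; exact (Option.some.inj hr).symm)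
  rw [this, pos_apply]

lemma word_pairwise (μ : YoungDiagram) (S : ↥μ.cells ≃ Fin μ.card) :
    (wordOf μ S).Pairwise fun a b => ∀ i j : Fin μ.card, (i : ℕ) = a → (j : ℕ) = b →
      (pos μ S i).2 < (pos μ S j).2 ∨
      ((pos μ S i).2 = (pos μ S j).2 ∧ (pos μ S j).1 < (pos μ S i).1) := by
  rw [wordOf, List.pairwise_flatMap]
  constructor
  · intro c _
    rw [List.pairwise_filterMap, List.pairwise_reverse]
    refine (List.pairwise_lt_range (n := μ.colLen c)).imp ?_
    intro r r' hlt a ha b hb i j hi hj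
    right
    split_ifs at ha with h1
    split_ifs at hb with h2
    have e1 : i = S ⟨(r', c), h1⟩ := Fin.ext (by rw [hi]; exact (Option.some.inj ha).symm)
    have e2 : j = S ⟨(r, c), h2⟩ := Fin.ext (by rw [hj]; exact (Option.some.inj hb).symm)
    rw [e1, e2, pos_apply, pos_apply]
    exact ⟨rfl, hlt⟩
  · refine (List.pairwise_lt_range (n := μ.rowLen 0)).imp ?_
    intro c c' hlt x hx y hy i j hi hj
    left
    rw [mem_col μ S c x hx i hi, mem_col μ S c' y hy j hj]
    exact hlt

lemma mem_word (μ : YoungDiagram) (S : ↥μ.cells ≃ Fin μ.card) (k : Fin μ.card) :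
    (k : ℕ) ∈ wordOf μ S := by
  rw [wordOf, List.mem_flatMap]
  obtain ⟨⟨⟨r, c⟩, h⟩, rfl⟩ := S.surjective k
  refine ⟨c, ?_, ?_⟩
  · rw [List.mem_range, ← YoungDiagram.mem_iff_lt_rowLen]
    exact μ.isLowerSet (Prod.mk_le_mk.2 ⟨Nat.zero_le _, le_rfl⟩) h
  · rw [List.mem_filterMap]
    refine ⟨r, ?_, by rw [dif_pos h]⟩
    rw [List.mem_reverse, List.mem_range, ← YoungDiagram.mem_iff_lt_colLen]
    exact h

lemma word_order (μ : YoungDiagram) (S : ↥μ.cells ≃ Fin μ.card) (i j : Fin μ.card)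
    (h : (wordOf μ S).idxOf (i : ℕ) < (wordOf μ S).idxOf (j : ℕ)) :
    (pos μ S i).2 < (pos μ S j).2 ∨
      ((pos μ S i).2 = (pos μ S j).2 ∧ (pos μ S j).1 < (pos μ S i).1) := by
  have hi := List.idxOf_lt_length_iff.2 (mem_word μ S i)
  have hj := List.idxOf_lt_length_iff.2 (mem_word μ S j)
  refine List.pairwise_iff_getElem.1 (word_pairwise μ S) _ _ hi hj h i j ?_ ?_
  · simp
  · simp

lemma isIdx_word (μ : YoungDiagram) (S : ↥μ.cells ≃ Fin μ.card) (hS : IsStandardYT μ S) :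
    IsIdx (pos μ S) (fun k => letterIndex (wordOf μ S) k) := by
  refine isIdx_of_steps (pos μ S) (letterIndex (wordOf μ S)) rfl ?_ ?_ ?_
  · intro k
    rw [letterIndex]
    split_ifs <;> simp
  · intro k hk he
    rw [letterIndex] at he
    split_ifs at he with h
    · omega
    set a : Fin μ.card := ⟨k, by omega⟩
    set b : Fin μ.card := ⟨k + 1, hk⟩
    have hp := isPos_pos μ S hS
    have hne : (wordOf μ S).idxOf (a : ℕ) ≠ (wordOf μ S).idxOf (b : ℕ) := by
      intro h'
      have := (List.idxOf_inj (mem_word μ S a)).1 h'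
      simp [a, b] at this
    have hlt : (wordOf μ S).idxOf (a : ℕ) < (wordOf μ S).idxOf (b : ℕ) :=
      lt_of_le_of_ne (not_lt.1 h) hne
    rcases word_order μ S a b hlt with h1 | h1
    · by_contra hcon
      rw [not_le] at hcon
      have hle : ((pos μ S a).1, (pos μ S b).2) ≤ pos μ S b := Prod.le_def.2 ⟨hcon.le, le_rfl⟩
      obtain ⟨m, hm⟩ := hp.lower hle ⟨b, rfl⟩
      have m1 : m ≤ b := hp.std _ _ (hm ▸ hle)
      have m2 : a ≤ m := hp.std _ _ (by rw [hm]; exact Prod.le_def.2 ⟨le_rfl, h1.le⟩)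
      have m3 : m ≠ b := by
        rintro rfl
        have := congrArg Prod.fst hm
        simp only at this
        omega
      have m4 : m ≠ a := by
        rintro rfl
        have := congrArg Prod.snd hm
        simp only at this
        omega
      have : (m : ℕ) ≤ k + 1 := m1
      have : k ≤ (m : ℕ) := m2
      have : (m : ℕ) ≠ k + 1 := fun h => m3 (Fin.ext h)
      have : (m : ℕ) ≠ k := fun h => m4 (Fin.ext h)
      omega
    · exact h1.2.le
  · intro k hk he
    rw [letterIndex] at he
    split_ifs at he with h
    · rcases word_order μ S ⟨k + 1, hk⟩ ⟨k, by omega⟩ h with h1 | h1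
      · exact h1.le
      · exact h1.1.le
    · omega

/-- the data of a pair of standard tableaux -/
def datOf (μ : YoungDiagram) (S T : ↥μ.cells ≃ Fin μ.card) (hS : IsStandardYT μ S)
    (hT : IsStandardYT μ T) : Dat μ.card where
  s := pos μ S
  t := pos μ T
  ν := fun k => letterIndex (wordOf μ S) k
  ρ := T.symm.trans S
  hs := isPos_pos μ S hS
  ht := isPos_pos μ T hT
  hν := isIdx_word μ S hS
  hρ := fun j => by simp [pos]

lemma mon_eq_prod (a : Fin n → ℕ) : mon a = ∏ j, (X j : MvPolynomial (Fin n) ℚ) ^ a j := by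
  rw [mon, monomial_eq, Finsupp.prod_fintype _ _ (by simp)]
  simp

lemma datOf_F (μ : YoungDiagram) (S T : ↥μ.cells ≃ Fin μ.card) (hS : IsStandardYT μ S)
    (hT : IsStandardYT μ T) : (datOf μ S T hS hT).F = higherSpecht μ S T := by
  have hm : (datOf μ S T hS hT).m = higherSpechtMonomial μ S T := by
    rw [Dat.m, mon_eq_prod]; rfl
  rw [Dat.F, map_mul act, Module.End.mul_apply, act_Pp, map_sum, hm, higherSpecht]
  refine Finset.sum_congr rfl fun σ _ => ?_
  rw [act_Pm]
  refine Finset.sum_congr rfl fun τ _ => ?_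
  rw [rename_mul_perm, ← Int.cast_smul_eq_zsmul ℚ]
  rfl

/-- data for an element of the index set -/
def dat (x : HSPair n) : Dat n :=
  x.1.2 ▸ datOf x.1.1 x.2.1.1 x.2.1.2 x.2.2.1 x.2.2.2

lemma dat_F (x : HSPair n) : (dat x).F = higherSpechtFamily n x := by
  obtain ⟨⟨μ, rfl⟩, ⟨⟨S, T⟩, hS, hT⟩⟩ := x
  change (datOf μ S T hS hT).F = rename (Fin.cast rfl) (higherSpecht μ S T)
  rw [datOf_F]
  have : Fin.cast (rfl : μ.card = μ.card) = id := rfl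
  rw [this, rename_id_apply]

lemma dat_inj (x y : HSPair n) (h1 : (dat x).s = (dat y).s) (h2 : (dat x).t = (dat y).t) :
    x = y := by
  obtain ⟨⟨μ, rfl⟩, ⟨⟨S, T⟩, hS, hT⟩⟩ := x
  obtain ⟨⟨μ', h⟩, ⟨⟨S', T'⟩, hS', hT'⟩⟩ := y
  have hμ : μ = μ' := by
    have aux : ∀ (m : ℕ) (h : μ'.card = m) (z : HSPair m)
        (hz : z = ⟨⟨μ', h⟩, ⟨⟨S', T'⟩, hS', hT'⟩⟩),
        Set.range (dat z).s = (μ'.cells : Set (ℕ × ℕ)) := by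
      intro m h z hz
      subst h
      subst hz
      exact range_pos μ' S'
    have e := aux _ h _ rfl
    rw [← h1] at e
    have e' : Set.range (pos μ S) = (μ'.cells : Set (ℕ × ℕ)) := e
    rw [range_pos] at e'
    exact YoungDiagram.ext (Finset.coe_injective e')
  subst hμ
  have aux : ∀ A B : ↥μ.cells ≃ Fin μ.card, pos μ A = pos μ B → A = B := by
    intro A B hAB
    have : A.symm = B.symm := by
      ext1 j
      exact Subtype.ext (congrFun hAB j)
    exact Equiv.symm_bijective.injective this
  have e1 : S = S' := aux S S' h1
  have e2 : T = T' := aux T T' h2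
  subst e1
  subst e2
  rfl

end HS

namespace HS

open Equiv

variable {n : ℕ}

lemma cells_injective : Function.Injective YoungDiagram.cells := fun _ _ h => YoungDiagram.ext h

lemma finite_lev (n : ℕ) : {μ : YoungDiagram | μ.card = n}.Finite := by
  refine Set.Finite.subset (((Finset.range n ×ˢ Finset.range n).powerset.finite_toSet).preimage
    cells_injective.injOn) ?_
  intro μ hμ
  simp only [Set.mem_ofPred_eq] at hμ
  simp only [Set.mem_preimage, Finset.mem_coe, Finset.mem_powerset]
  rintro ⟨i, j⟩ hij
  rw [Finset.mem_product, Finset.mem_range, Finset.mem_range]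
  constructor
  · have : ((Finset.range (i + 1)).image fun k => (k, j)) ⊆ μ.cells := by
      intro x hx
      obtain ⟨k, hk, rfl⟩ := Finset.mem_image.1 hx
      rw [Finset.mem_range] at hk
      exact μ.isLowerSet (Prod.mk_le_mk.2 ⟨by omega, le_rfl⟩) hij
    have := Finset.card_le_card this
    rw [Finset.card_image_of_injective _ (fun a b h => congrArg Prod.fst h),
      Finset.card_range] at this
    change _ ≤ μ.card at this
    simp only; omega
  · have : ((Finset.range (j + 1)).image fun k => (i, k)) ⊆ μ.cells := by
      intro x hx
      obtain ⟨k, hk, rfl⟩ := Finset.mem_image.1 hx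
      rw [Finset.mem_range] at hk
      exact μ.isLowerSet (Prod.mk_le_mk.2 ⟨le_rfl, by omega⟩) hij
    have := Finset.card_le_card this
    rw [Finset.card_image_of_injective _ (fun a b h => congrArg Prod.snd h),
      Finset.card_range] at this
    change _ ≤ μ.card at this
    simp only; omega

/-- diagrams of size n -/
noncomputable def lev (n : ℕ) : Finset YoungDiagram := (finite_lev n).toFinset

lemma mem_lev {n : ℕ} {μ : YoungDiagram} : μ ∈ lev n ↔ μ.card = n := by simp [lev]

open Classical in
/-- diagrams covering -/
noncomputable def up (μ : YoungDiagram) : Finset YoungDiagram :=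
  (lev (μ.card + 1)).filter fun ν => μ ≤ ν

open Classical in
/-- diagrams covered -/
noncomputable def dn (ν : YoungDiagram) : Finset YoungDiagram :=
  (lev (ν.card - 1)).filter fun μ => μ ≤ ν ∧ μ.card + 1 = ν.card

lemma mem_up {μ ν : YoungDiagram} : ν ∈ up μ ↔ μ ≤ ν ∧ ν.card = μ.card + 1 := by
  simp [up, mem_lev, and_comm]

lemma mem_dn {μ ν : YoungDiagram} : μ ∈ dn ν ↔ μ ≤ ν ∧ ν.card = μ.card + 1 := by
  simp only [dn, Finset.mem_filter, mem_lev]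
  constructor
  · rintro ⟨_, h1, h2⟩; exact ⟨h1, h2.symm⟩
  · rintro ⟨h1, h2⟩; exact ⟨by omega, h1, h2.symm⟩

lemma card_mono {μ ν : YoungDiagram} (h : μ ≤ ν) : μ.card ≤ ν.card :=
  Finset.card_le_card (YoungDiagram.cells_subset_iff.2 h)

lemma eq_of_le_card {μ ν : YoungDiagram} (h : μ ≤ ν) (hc : ν.card ≤ μ.card) : μ = ν :=
  YoungDiagram.ext (Finset.eq_of_subset_of_card_le (YoungDiagram.cells_subset_iff.2 h) hc)

lemma card_sup_inf (μ κ : YoungDiagram) : (μ ⊔ κ).card + (μ ⊓ κ).card = μ.card + κ.card := by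
  change (μ ⊔ κ).cells.card + (μ ⊓ κ).cells.card = μ.cells.card + κ.cells.card
  rw [YoungDiagram.cells_sup, YoungDiagram.cells_inf, Finset.card_union_add_card_inter]

open Classical in
lemma common (μ κ : YoungDiagram) (hc : μ.card = κ.card) (hne : μ ≠ κ) :
    (up μ ∩ up κ).card = (dn μ ∩ dn κ).card := by
  have h1 : μ.card < (μ ⊔ κ).card := by
    by_contra h
    have e := eq_of_le_card (le_sup_left : μ ≤ μ ⊔ κ) (not_lt.1 h)
    have : κ ≤ μ := by rw [e]; exact le_sup_right
    exact hne (eq_of_le_card this hc.le).symm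
  have h2 := card_sup_inf μ κ
  by_cases h : (μ ⊔ κ).card = μ.card + 1
  · have e1 : up μ ∩ up κ = {μ ⊔ κ} := by
      ext ν
      rw [Finset.mem_inter, mem_up, mem_up, Finset.mem_singleton]
      constructor
      · rintro ⟨⟨a, b⟩, c, d⟩
        exact (eq_of_le_card (sup_le a c) (by omega)).symm
      · rintro rfl
        exact ⟨⟨le_sup_left, h⟩, le_sup_right, by omega⟩
    have e2 : dn μ ∩ dn κ = {μ ⊓ κ} := by
      ext ν
      rw [Finset.mem_inter, mem_dn, mem_dn, Finset.mem_singleton]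
      constructor
      · rintro ⟨⟨a, b⟩, c, d⟩
        exact eq_of_le_card (le_inf a c) (by omega)
      · rintro rfl
        exact ⟨⟨inf_le_left, by omega⟩, inf_le_right, by omega⟩
    rw [e1, e2, Finset.card_singleton, Finset.card_singleton]
  · have e1 : up μ ∩ up κ = ∅ := by
      ext ν
      rw [Finset.mem_inter, mem_up, mem_up]
      constructor
      · rintro ⟨⟨a, b⟩, c, d⟩
        have := card_mono (sup_le a c)
        omega
      · intro h; exact absurd h (Finset.notMem_empty _)
    have e2 : dn μ ∩ dn κ = ∅ := by
      ext ν
      rw [Finset.mem_inter, mem_dn, mem_dn]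
      constructor
      · rintro ⟨⟨a, b⟩, c, d⟩
        have := card_mono (le_inf a c)
        omega
      · intro h; exact absurd h (Finset.notMem_empty _)
    rw [e1, e2]

/-- rows where a cell may be added -/
noncomputable def addR (μ : YoungDiagram) : Finset ℕ :=
  (Finset.range (μ.colLen 0 + 1)).filter fun i => i = 0 ∨ μ.rowLen i < μ.rowLen (i - 1)

/-- rows where a cell may be removed -/
noncomputable def remR (μ : YoungDiagram) : Finset ℕ :=
  (Finset.range (μ.colLen 0)).filter fun i => μ.rowLen (i + 1) < μ.rowLen i

lemma card_addR (μ : YoungDiagram) : (addR μ).card = (remR μ).card + 1 := by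
  have : addR μ = insert 0 ((remR μ).image Nat.succ) := by
    ext i
    simp only [addR, remR, Finset.mem_filter, Finset.mem_range, Finset.mem_insert,
      Finset.mem_image]
    cases i with
    | zero => simp
    | succ i => simp
  rw [this, Finset.card_insert_of_notMem (by simp),
    Finset.card_image_of_injective _ Nat.succ_injective]

lemma mem_iff' (μ : YoungDiagram) (i j : ℕ) : (i, j) ∈ μ.cells ↔ j < μ.rowLen i := by
  rw [YoungDiagram.mem_cells, YoungDiagram.mem_iff_lt_rowLen]

lemma card_up (μ : YoungDiagram) : (up μ).card = (addR μ).card := by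
  classical
  have hlow : ∀ i, (i = 0 ∨ μ.rowLen i < μ.rowLen (i - 1)) →
      IsLowerSet ((insert (i, μ.rowLen i) μ.cells : Finset (ℕ × ℕ)) : Set (ℕ × ℕ)) := by
    rintro i hi ⟨a, b⟩ ⟨c, d⟩ hle hab
    obtain ⟨h1, h2⟩ := Prod.mk_le_mk.1 hle
    rw [Finset.mem_coe, Finset.mem_insert] at hab ⊢
    rcases hab with hab | hab
    · obtain ⟨rfl, rfl⟩ := Prod.mk.inj hab
      by_cases hc : c = a
      · subst hc
        by_cases hd : d = μ.rowLen c
        · left; rw [hd]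
        · right; rw [mem_iff']; omega
      · right
        rw [mem_iff']
        have := μ.rowLen_anti c (a - 1) (by omega)
        omega
    · right; exact μ.isLowerSet hle hab
  symm
  refine Finset.card_bij (fun i hi => ⟨insert (i, μ.rowLen i) μ.cells, hlow i (by
    simpa [addR] using (Finset.mem_filter.1 hi).2)⟩) ?_ ?_ ?_
  · intro i hi
    rw [mem_up]
    refine ⟨YoungDiagram.cells_subset_iff.1 (Finset.subset_insert _ _), ?_⟩
    change (insert (i, μ.rowLen i) μ.cells).card = _
    rw [Finset.card_insert_of_notMem]
    · rw [mem_iff']; omega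
  · intro i hi i' hi' h
    have h := congrArg YoungDiagram.cells h
    simp only at h
    have : (i, μ.rowLen i) ∈ insert (i', μ.rowLen i') μ.cells := by
      rw [← h]; exact Finset.mem_insert_self _ _
    rcases Finset.mem_insert.1 this with h | h
    · exact (Prod.mk.inj h).1
    · rw [mem_iff'] at h; omega
  · intro ν hν
    rw [mem_up] at hν
    have hsub := YoungDiagram.cells_subset_iff.2 hν.1
    have hc : (ν.cells \ μ.cells).card = 1 := by
      rw [Finset.card_sdiff_of_subset hsub]
      have := hν.2
      change ν.cells.card = μ.cells.card + 1 at this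
      omega
    obtain ⟨⟨i, j⟩, hij⟩ := Finset.card_eq_one.1 hc
    have hmem : ∀ x, x ∈ ν.cells ↔ x = (i, j) ∨ x ∈ μ.cells := by
      intro x
      have : x ∈ ν.cells \ μ.cells ↔ x = (i, j) := by rw [hij, Finset.mem_singleton]
      rw [Finset.mem_sdiff] at this
      have := @hsub x
      tauto
    have hnot : (i, j) ∉ μ.cells := by
      have : (i, j) ∈ ν.cells \ μ.cells := by rw [hij]; exact Finset.mem_singleton_self _
      exact (Finset.mem_sdiff.1 this).2
    have hin : (i, j) ∈ ν.cells := (hmem _).2 (Or.inl rfl)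
    have hj : j = μ.rowLen i := by
      rw [mem_iff'] at hnot
      by_contra hne
      have h1 : (i, μ.rowLen i) ∈ ν.cells :=
        ν.isLowerSet (Prod.mk_le_mk.2 ⟨le_rfl, by omega⟩) hin
      rcases (hmem _).1 h1 with h2 | h2
      · exact hne (Prod.mk.inj h2).2.symm
      · rw [mem_iff'] at h2; omega
    have hi0 : ∀ k < i, (k, j) ∈ μ.cells := by
      intro k hk
      have h1 : (k, j) ∈ ν.cells :=
        ν.isLowerSet (Prod.mk_le_mk.2 ⟨hk.le, le_rfl⟩) hin
      rcases (hmem _).1 h1 with h2 | h2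
      · have := (Prod.mk.inj h2).1; omega
      · exact h2
    have hiA : i ∈ addR μ := by
      rw [addR, Finset.mem_filter, Finset.mem_range]
      rcases Nat.eq_zero_or_pos i with h | h
      · exact ⟨by omega, Or.inl h⟩
      · have h1 := hi0 (i - 1) (by omega)
        have h2 : (i - 1, 0) ∈ μ.cells :=
          μ.isLowerSet (Prod.mk_le_mk.2 ⟨le_rfl, Nat.zero_le _⟩) h1
        rw [YoungDiagram.mem_cells, YoungDiagram.mem_iff_lt_colLen] at h2
        rw [mem_iff'] at h1
        exact ⟨by omega, Or.inr (by omega)⟩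
    refine ⟨i, hiA, YoungDiagram.ext ?_⟩
    ext x
    simp only [Finset.mem_insert, hmem, hj]

lemma card_dn (μ : YoungDiagram) : (dn μ).card = (remR μ).card := by
  classical
  have hlow : ∀ i, μ.rowLen (i + 1) < μ.rowLen i →
      IsLowerSet ((μ.cells.erase (i, μ.rowLen i - 1) : Finset (ℕ × ℕ)) : Set (ℕ × ℕ)) := by
    rintro i hi ⟨a, b⟩ ⟨c, d⟩ hle hab
    obtain ⟨h1, h2⟩ := Prod.mk_le_mk.1 hle
    rw [Finset.mem_coe, Finset.mem_erase] at hab ⊢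
    refine ⟨?_, μ.isLowerSet hle hab.2⟩
    intro he
    obtain ⟨rfl, rfl⟩ := Prod.mk.inj he
    have h3 := (mem_iff' _ _ _).1 hab.2
    by_cases hca : c = a
    · subst hca
      exact hab.1 (by rw [Prod.mk.injEq]; exact ⟨rfl, by omega⟩)
    · have := μ.rowLen_anti (c + 1) a (by omega)
      omega
  symm
  refine Finset.card_bij (fun i hi => ⟨μ.cells.erase (i, μ.rowLen i - 1), hlow i
    (Finset.mem_filter.1 hi).2⟩) ?_ ?_ ?_
  · intro i hi
    have hi := (Finset.mem_filter.1 hi).2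
    rw [mem_dn]
    refine ⟨YoungDiagram.cells_subset_iff.1 (Finset.erase_subset _ _), ?_⟩
    change _ = (μ.cells.erase (i, μ.rowLen i - 1)).card + 1
    rw [Finset.card_erase_add_one]
    rw [mem_iff']; omega
  · intro i hi i' hi' h
    have hi := (Finset.mem_filter.1 hi).2
    have h := congrArg YoungDiagram.cells h
    simp only at h
    have h1 : (i, μ.rowLen i - 1) ∉ μ.cells.erase (i', μ.rowLen i' - 1) := by
      rw [← h]; exact Finset.notMem_erase _ _
    by_contra hne
    apply h1
    rw [Finset.mem_erase, mem_iff']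
    refine ⟨fun h => hne (Prod.mk.inj h).1, by omega⟩
  · intro κ hκ
    rw [mem_dn] at hκ
    have hsub := YoungDiagram.cells_subset_iff.2 hκ.1
    have hc : (μ.cells \ κ.cells).card = 1 := by
      rw [Finset.card_sdiff_of_subset hsub]
      have := hκ.2
      change μ.cells.card = κ.cells.card + 1 at this
      omega
    obtain ⟨⟨i, j⟩, hij⟩ := Finset.card_eq_one.1 hc
    have hmem : ∀ x, x ∈ μ.cells ↔ x = (i, j) ∨ x ∈ κ.cells := by
      intro x
      have : x ∈ μ.cells \ κ.cells ↔ x = (i, j) := by rw [hij, Finset.mem_singleton]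
      rw [Finset.mem_sdiff] at this
      have := @hsub x
      tauto
    have hnot : (i, j) ∉ κ.cells := by
      have : (i, j) ∈ μ.cells \ κ.cells := by rw [hij]; exact Finset.mem_singleton_self _
      exact (Finset.mem_sdiff.1 this).2
    have hin : (i, j) ∈ μ.cells := (hmem _).2 (Or.inl rfl)
    have h1 : (i, j + 1) ∉ μ.cells := by
      intro h
      rcases (hmem _).1 h with h2 | h2
      · have := (Prod.mk.inj h2).2; omega
      · exact hnot (κ.isLowerSet (Prod.mk_le_mk.2 ⟨le_rfl, by omega⟩) h2)
    have h2 : (i + 1, j) ∉ μ.cells := by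
      intro h
      rcases (hmem _).1 h with h2 | h2
      · have := (Prod.mk.inj h2).1; omega
      · exact hnot (κ.isLowerSet (Prod.mk_le_mk.2 ⟨by omega, le_rfl⟩) h2)
    have h3 : (i, 0) ∈ μ.cells :=
          μ.isLowerSet (Prod.mk_le_mk.2 ⟨le_rfl, Nat.zero_le _⟩) hin
    rw [YoungDiagram.mem_cells, YoungDiagram.mem_iff_lt_colLen] at h3
    rw [mem_iff'] at h1 h2
    have h4 := (mem_iff' _ _ _).1 hin
    refine ⟨i, ?_, YoungDiagram.ext ?_⟩
    · rw [remR, Finset.mem_filter, Finset.mem_range]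
      exact ⟨h3, by omega⟩
    · have hj : μ.rowLen i - 1 = j := by omega
      ext x
      simp only [Finset.mem_erase, hmem, hj]
      constructor
      · rintro ⟨a, b⟩; tauto
      · intro h
        refine ⟨?_, Or.inr h⟩
        rintro rfl
        exact hnot h

lemma up_dn (μ : YoungDiagram) : (up μ).card = (dn μ).card + 1 := by
  rw [card_up, card_dn, card_addR]

/-- number of saturated chains -/
noncomputable def NN : ℕ → YoungDiagram → ℕ
  | 0, _ => 1
  | n + 1, ν => ∑ μ ∈ dn ν, NN n μ

lemma up_sum (n : ℕ) : ∀ μ : YoungDiagram, μ.card = n →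
    ∑ ν ∈ up μ, NN (n + 1) ν = (n + 1) * NN n μ := by
  classical
  induction n with
  | zero =>
    intro μ hμ
    have hd : dn μ = ∅ := by
      ext κ
      rw [mem_dn]
      constructor
      · rintro ⟨_, h⟩; omega
      · intro h; exact absurd h (Finset.notMem_empty _)
    have h1 : ∀ ν ∈ up μ, NN (0 + 1) ν = 1 := by
      intro ν hν
      have : dn ν = {μ} := by
        rw [mem_up] at hν
        ext κ
        rw [mem_dn, Finset.mem_singleton]
        constructor
        · rintro ⟨h1, h2⟩
          have a : κ.cells = ∅ := Finset.card_eq_zero.1 (show κ.card = 0 by omega)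
          have b : μ.cells = ∅ := Finset.card_eq_zero.1 hμ
          exact YoungDiagram.ext (a.trans b.symm)
        · rintro rfl; exact hν
      simp [NN, this]
    rw [Finset.sum_congr rfl h1, Finset.sum_const, up_dn, hd]
    simp [NN]
  | succ n ih =>
    intro μ hμ
    have e1 : ∑ ν ∈ up μ, NN (n + 1 + 1) ν =
        ∑ κ ∈ lev (n + 1), (up μ ∩ up κ).card * NN (n + 1) κ := by
      have : ∀ ν, NN (n + 1 + 1) ν = ∑ κ ∈ dn ν, NN (n + 1) κ := fun ν => rfl
      simp only [this]
      rw [Finset.sum_comm' (s' := fun κ => up μ ∩ up κ) (t' := lev (n + 1))]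
      · simp only [Finset.sum_const, smul_eq_mul]
      · intro ν κ
        rw [Finset.mem_inter, mem_up, mem_up, mem_dn, mem_lev]
        constructor
        · rintro ⟨⟨a, b⟩, c, d⟩; exact ⟨⟨⟨a, b⟩, c, d⟩, by omega⟩
        · rintro ⟨⟨⟨a, b⟩, c, d⟩, _⟩; exact ⟨⟨a, b⟩, c, d⟩
    have e2 : ∑ lam ∈ dn μ, ∑ κ ∈ up lam, NN (n + 1) κ =
        ∑ κ ∈ lev (n + 1), (dn μ ∩ dn κ).card * NN (n + 1) κ := by
      rw [Finset.sum_comm' (s' := fun κ => dn μ ∩ dn κ) (t' := lev (n + 1))]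
      · simp only [Finset.sum_const, smul_eq_mul]
      · intro ν κ
        rw [Finset.mem_inter, mem_up, mem_dn, mem_dn, mem_lev]
        constructor
        · rintro ⟨⟨a, b⟩, c, d⟩; exact ⟨⟨⟨a, b⟩, c, d⟩, by omega⟩
        · rintro ⟨⟨⟨a, b⟩, c, d⟩, _⟩; exact ⟨⟨a, b⟩, c, d⟩
    have e3 : ∑ lam ∈ dn μ, ∑ κ ∈ up lam, NN (n + 1) κ = (n + 1) * NN (n + 1) μ := by
      have : NN (n + 1) μ = ∑ κ ∈ dn μ, NN n κ := rfl
      rw [this, Finset.mul_sum]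
      refine Finset.sum_congr rfl fun lam hl => ih lam ?_
      rw [mem_dn] at hl; omega
    have hmem : μ ∈ lev (n + 1) := mem_lev.2 hμ
    rw [e1, ← Finset.add_sum_erase _ _ hmem]
    rw [e2, ← Finset.add_sum_erase _ _ hmem] at e3
    have e4 : ∑ κ ∈ (lev (n + 1)).erase μ, (up μ ∩ up κ).card * NN (n + 1) κ =
        ∑ κ ∈ (lev (n + 1)).erase μ, (dn μ ∩ dn κ).card * NN (n + 1) κ := by
      refine Finset.sum_congr rfl fun κ hκ => ?_
      rw [Finset.mem_erase, mem_lev] at hκ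
      rw [common μ κ (by omega) (Ne.symm hκ.1)]
    rw [e4, Finset.inter_self, up_dn]
    rw [Finset.inter_self] at e3
    linarith

lemma sum_sq (n : ℕ) : ∑ μ ∈ lev n, NN n μ * NN n μ = n ! := by
  induction n with
  | zero =>
    have : lev 0 = {⊥} := by
      ext μ
      rw [mem_lev, Finset.mem_singleton]
      constructor
      · intro h
        have : μ.cells = ∅ := Finset.card_eq_zero.1 h
        exact YoungDiagram.ext (by rw [this]; rfl)
      · rintro rfl; rfl
    rw [this]; simp [NN]
  | succ n ih =>
    have e : ∑ ν ∈ lev (n + 1), NN (n + 1) ν * NN (n + 1) ν =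
        ∑ ν ∈ lev (n + 1), ∑ μ ∈ dn ν, NN n μ * NN (n + 1) ν := by
      refine Finset.sum_congr rfl fun ν _ => ?_
      rw [← Finset.sum_mul]; rfl
    rw [e, Finset.sum_comm' (s' := up) (t' := lev n)]
    · have : ∀ μ ∈ lev n, ∑ ν ∈ up μ, NN n μ * NN (n + 1) ν = (n + 1) * (NN n μ * NN n μ) := by
        intro μ hμ
        rw [← Finset.mul_sum, up_sum n μ (mem_lev.1 hμ)]; ring
      rw [Finset.sum_congr rfl this, ← Finset.mul_sum, ih, Nat.factorial_succ]
    · intro ν μ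
      rw [mem_up, mem_dn, mem_lev, mem_lev]
      constructor
      · rintro ⟨a, b, c⟩; exact ⟨⟨b, c⟩, by omega⟩
      · rintro ⟨⟨b, c⟩, a⟩; exact ⟨by omega, b, c⟩

end HS

namespace HS

open Equiv

variable {n : ℕ}

lemma finite_P (n : ℕ) (ν : YoungDiagram) :
    {t : Fin n → ℕ × ℕ | IsPos t ∧ Set.range t = (ν.cells : Set (ℕ × ℕ))}.Finite := by
  refine Set.Finite.subset (Set.Finite.pi' (fun _ : Fin n => ν.cells.finite_toSet)) ?_
  rintro t ⟨_, h⟩ i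
  rw [← h]; exact ⟨i, rfl⟩

/-- standard fillings as a finset -/
noncomputable def PF (n : ℕ) (ν : YoungDiagram) : Finset (Fin n → ℕ × ℕ) :=
  (finite_P n ν).toFinset

lemma mem_PF {n : ℕ} {ν : YoungDiagram} {t : Fin n → ℕ × ℕ} :
    t ∈ PF n ν ↔ IsPos t ∧ Set.range t = (ν.cells : Set (ℕ × ℕ)) := by
  simp [PF]

lemma mem_of_range {ν : YoungDiagram} {t : Fin n → ℕ × ℕ}
    (h : Set.range t = (ν.cells : Set (ℕ × ℕ))) (x : ℕ × ℕ) : x ∈ ν.cells ↔ ∃ i, t i = x := by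
  rw [← Finset.mem_coe, ← h]; rfl

lemma card_of_range {ν : YoungDiagram} {t : Fin n → ℕ × ℕ} (hi : Function.Injective t)
    (h : Set.range t = (ν.cells : Set (ℕ × ℕ))) : ν.card = n := by
  have : ν.cells = Finset.univ.image t := by
    ext x; rw [mem_of_range h]; simp
  change ν.cells.card = n
  rw [this, Finset.card_image_of_injective _ hi]; simp

lemma card_PF_succ (n : ℕ) (ν : YoungDiagram) :
    (PF (n + 1) ν).card = ∑ μ ∈ dn ν, (PF n μ).card := by
  classical
  rw [← Finset.card_biUnion]
  · refine Finset.card_bij (fun t _ => fun i : Fin n => t i.castSucc) ?_ ?_ ?_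
    · intro t ht
      rw [mem_PF] at ht
      obtain ⟨hp, hr⟩ := ht
      have hinj : Function.Injective fun i : Fin n => t i.castSucc :=
        hp.inj.comp (Fin.castSucc_injective n)
      have hlow : IsLowerSet (Set.range fun i : Fin n => t i.castSucc) := by
        rintro _ y hle ⟨i, rfl⟩
        obtain ⟨j, rfl⟩ := hp.lower hle ⟨_, rfl⟩
        have hji := hp.std _ _ hle
        cases j using Fin.lastCases with
        | last => exact absurd hji (not_le.2 (Fin.castSucc_lt_last i))
        | cast j => exact ⟨j, rfl⟩
      let μ : YoungDiagram := ⟨Finset.univ.image fun i : Fin n => t i.castSucc, by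
        rw [Finset.coe_image, Finset.coe_univ, Set.image_univ]; exact hlow⟩
      have hμ : (Set.range fun i : Fin n => t i.castSucc) = (μ.cells : Set (ℕ × ℕ)) := by
        simp [μ]
      rw [Finset.mem_biUnion]
      refine ⟨μ, ?_, mem_PF.2 ⟨⟨hinj, hlow, fun i j h => ?_⟩, hμ⟩⟩
      · rw [mem_dn, card_of_range hp.inj hr, card_of_range hinj hμ]
        refine ⟨YoungDiagram.cells_subset_iff.1 fun x hx => ?_, rfl⟩
        obtain ⟨i, rfl⟩ := (mem_of_range hμ x).1 hx
        exact (mem_of_range hr _).2 ⟨_, rfl⟩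
      · exact Fin.castSucc_le_castSucc_iff.1 (hp.std _ _ h)
    · intro t ht t' ht' h
      rw [mem_PF] at ht ht'
      have h' : ∀ i : Fin n, t i.castSucc = t' i.castSucc := fun i => congrFun h i
      funext i
      cases i using Fin.lastCases with
      | cast i => exact h' i
      | last =>
        have : t (Fin.last n) ∈ Set.range t' := by rw [ht'.2, ← ht.2]; exact ⟨_, rfl⟩
        obtain ⟨j, hj⟩ := this
        cases j using Fin.lastCases with
        | last => exact hj.symm
        | cast j =>
          rw [← h'] at hj
          exact absurd (ht.1.inj hj) (Fin.castSucc_lt_last j).ne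
    · intro s hs
      rw [Finset.mem_biUnion] at hs
      obtain ⟨μ, hμ, hs⟩ := hs
      rw [mem_PF] at hs
      rw [mem_dn] at hμ
      obtain ⟨hp, hr⟩ := hs
      have hsub := YoungDiagram.cells_subset_iff.2 hμ.1
      have hc : (ν.cells \ μ.cells).card = 1 := by
        rw [Finset.card_sdiff_of_subset hsub]
        have := hμ.2
        change ν.cells.card = μ.cells.card + 1 at this
        omega
      obtain ⟨x, hx⟩ := Finset.card_eq_one.1 hc
      have hmem : ∀ y, y ∈ ν.cells ↔ y = x ∨ y ∈ μ.cells := by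
        intro y
        have : y ∈ ν.cells \ μ.cells ↔ y = x := by rw [hx, Finset.mem_singleton]
        rw [Finset.mem_sdiff] at this
        have := @hsub y
        tauto
      have hnot : x ∉ μ.cells := by
        have : x ∈ ν.cells \ μ.cells := by rw [hx]; exact Finset.mem_singleton_self _
        exact (Finset.mem_sdiff.1 this).2
      let t : Fin (n + 1) → ℕ × ℕ := Fin.snoc (α := fun _ => ℕ × ℕ) s x
      have t1 : ∀ i : Fin n, t i.castSucc = s i := fun i => by simp [t]
      have t2 : t (Fin.last n) = x := by simp [t]
      have smem : ∀ i, s i ∈ μ.cells := fun i => (mem_of_range hr _).2 ⟨i, rfl⟩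
      have hrt : Set.range t = (ν.cells : Set (ℕ × ℕ)) := by
        ext y
        rw [Finset.mem_coe, hmem, mem_of_range hr]
        constructor
        · rintro ⟨i, rfl⟩
          cases i using Fin.lastCases with
          | cast i => exact Or.inr ⟨i, (t1 i).symm⟩
          | last => exact Or.inl t2
        · rintro (rfl | ⟨i, rfl⟩)
          · exact ⟨_, t2⟩
          · exact ⟨_, t1 i⟩
      refine ⟨t, mem_PF.2 ⟨⟨?_, ?_, ?_⟩, hrt⟩, funext t1⟩
      · intro i j hij
        cases i using Fin.lastCases with
        | cast i =>
          cases j using Fin.lastCases with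
          | cast j => rw [t1, t1] at hij; rw [hp.inj hij]
          | last => rw [t1, t2] at hij; exact absurd (hij ▸ smem i) hnot
        | last =>
          cases j using Fin.lastCases with
          | cast j => rw [t1, t2] at hij; exact absurd (hij ▸ smem j) hnot
          | last => rfl
      · rw [hrt]; exact ν.isLowerSet
      · intro i j hij
        cases j using Fin.lastCases with
        | last => exact Fin.le_last _
        | cast j =>
          cases i using Fin.lastCases with
          | cast i =>
            rw [t1, t1] at hij
            exact Fin.castSucc_le_castSucc_iff.2 (hp.std _ _ hij)
          | last =>
            rw [t1, t2] at hij
            exact absurd (μ.isLowerSet hij (smem j)) hnot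
  · intro μ _ κ _ hne
    rw [Function.onFun, Finset.disjoint_left]
    intro t h1 h2
    rw [mem_PF] at h1 h2
    exact hne (YoungDiagram.ext (Finset.coe_injective (h1.2.symm.trans h2.2)))

lemma card_PF (n : ℕ) : ∀ ν : YoungDiagram, ν.card = n → (PF n ν).card = NN n ν := by
  induction n with
  | zero =>
    intro ν hν
    have hc : ν.cells = ∅ := Finset.card_eq_zero.1 hν
    rw [NN, Finset.card_eq_one]
    refine ⟨Fin.elim0, ?_⟩
    ext t
    rw [mem_PF, Finset.mem_singleton]
    constructor
    · intro _; exact Subsingleton.elim _ _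
    · intro _
      have hr : Set.range t = (ν.cells : Set (ℕ × ℕ)) := by
        rw [hc, Set.range_eq_empty]; simp
      refine ⟨⟨fun i => i.elim0, ?_, fun i => i.elim0⟩, hr⟩
      rw [hr]; exact ν.isLowerSet
  | succ n ih =>
    intro ν hν
    rw [card_PF_succ, NN]
    refine Finset.sum_congr rfl fun μ hμ => ih μ ?_
    rw [mem_dn] at hμ; omega

lemma pos_injective (μ : YoungDiagram) : Function.Injective (pos μ) := by
  intro A B hAB
  have : A.symm = B.symm := by
    ext1 j
    exact Subtype.ext (congrFun hAB j)
  exact Equiv.symm_bijective.injective this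

lemma card_SYT (μ : YoungDiagram) :
    Nat.card {T : ↥μ.cells ≃ Fin μ.card // IsStandardYT μ T} = NN μ.card μ := by
  have h1 : Nat.card ↥(PF μ.card μ) = (PF μ.card μ).card := by
    rw [Nat.card_eq_fintype_card, Fintype.card_coe]
  rw [← card_PF μ.card μ rfl, ← h1]
  refine Nat.card_eq_of_bijective
    (fun T => ⟨pos μ T.1, mem_PF.2 ⟨isPos_pos μ T.1 T.2, range_pos μ T.1⟩⟩) ⟨?_, ?_⟩
  · intro A B h
    exact Subtype.ext (pos_injective μ (congrArg Subtype.val h))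
  · rintro ⟨t, ht⟩
    obtain ⟨hp, hr⟩ := mem_PF.1 ht
    let e : Fin μ.card ≃ ↥μ.cells := Equiv.ofBijective
      (fun j => ⟨t j, (mem_of_range hr _).2 ⟨j, rfl⟩⟩) ⟨fun i j h =>
        hp.inj (congrArg Subtype.val h), fun x => by
        obtain ⟨i, hi⟩ := (mem_of_range hr _).1 x.2
        exact ⟨i, Subtype.ext hi⟩⟩
    have he : ∀ j, (e j : ℕ × ℕ) = t j := fun _ => rfl
    have key : ∀ c d : μ.cells, (c : ℕ × ℕ) ≤ d → c ≠ d → e.symm c < e.symm d := by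
      intro c d hle hne
      refine lt_of_le_of_ne (hp.std _ _ ?_) fun h => hne (e.symm.injective h)
      rw [← he, ← he]; simpa using hle
    refine ⟨⟨e.symm, ?_, ?_⟩, ?_⟩
    · intro c d h1 h2
      exact key c d (Prod.le_def.2 ⟨h1.le, h2.le⟩) (by rintro rfl; exact lt_irrefl _ h2)
    · intro c d h1 h2
      exact key c d (Prod.le_def.2 ⟨h2.le, h1.le⟩) (by rintro rfl; exact lt_irrefl _ h2)
    · exact Subtype.ext (funext fun j => by simp [pos, he])

lemma card_HSPair (n : ℕ) : Nat.card (HSPair n) = n ! := by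
  haveI : Finite {μ : YoungDiagram // μ.card = n} := (finite_lev n).to_subtype
  haveI : Fintype {μ : YoungDiagram // μ.card = n} := Fintype.ofFinite _
  unfold HSPair
  rw [Nat.card_sigma, ← sum_sq n, Finset.sum_subtype (lev n) (fun x => mem_lev)]
  refine Finset.sum_congr rfl fun μ _ => ?_
  rw [Nat.card_congr (Equiv.subtypeProdEquivProd (p := IsStandardYT μ.1) (q := IsStandardYT μ.1)),
    Nat.card_prod, card_SYT, μ.2]

theorem main (n : ℕ) :
    Nat.card (HSPair n) = n ! ∧
    ∃ b : Module.Basis (HSPair n)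
        ↥(Algebra.adjoin ℚ (Set.range fun k : Fin n => esymm (Fin n) ℚ ((k : ℕ) + 1)))
        (MvPolynomial (Fin n) ℚ),
      ∀ x, b x = higherSpechtFamily n x := by
  have hc := card_HSPair n
  refine ⟨hc, ?_⟩
  haveI : Finite (HSPair n) := Nat.finite_of_card_ne_zero (by
    rw [hc]; exact Nat.factorial_ne_zero n)
  haveI : Fintype (HSPair n) := Fintype.ofFinite _
  rw [adjoin_eq]
  obtain ⟨b, hb⟩ := basis_of_dat (n := n) (ι := HSPair n)
    (by rw [← Nat.card_eq_fintype_card, hc]) dat dat_inj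
  exact ⟨b, fun x => (hb x).trans (dat_F x)⟩

end HS

/-- **Higher Specht basis theorem** (Terasoma–Yamada). The `n!` higher Specht polynomials
`F^S_T`, as `(S, T)` runs over the pairs of standard Young tableaux of the same shape
`λ ⊢ n`, form a basis of `ℚ[x₁,…,xₙ]` as a module over the subalgebra
`Sym = ℚ[e₁,…,eₙ]` of symmetric polynomials; in particular `ℚ[x₁,…,xₙ]` is a free
`Sym`-module of rank `n!`. -/
theorem higherSpecht_basis (n : ℕ) (hn : 0 < n) :
    Nat.card (HSPair n) = n ! ∧
    ∃ b : Module.Basis (HSPair n)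
        ↥(Algebra.adjoin ℚ (Set.range fun k : Fin n => esymm (Fin n) ℚ ((k : ℕ) + 1)))
        (MvPolynomial (Fin n) ℚ),
      ∀ x, b x = higherSpechtFamily n x := by
  exact HS.main n
end

section
/- Let n be a positive integer and let G be a subgroup of the symmetric group S_n acting on ℚ[x_1,...,x_n] by permuting the variables. For each d ≥ 0 let h_d = dim_ℚ of the degree-d homogeneous component of the invariant ring ℚ[x_1,...,x_n]^G. Then the formal power series (Σ_{d≥0} h_d z^d) · Π_{i=1}^{n} (1 − z^i) in ℚ⟦z⟧ is a polynomial in z with nonnegative integer coefficients, and the sum of its coefficients equals n!/|G|. -/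
open MvPolynomial Nat

/-- The subalgebra of `ℚ[x₁,…,xₙ]` of polynomials invariant under a subgroup `G` of `Sₙ`
acting by permutation of the variables. -/
noncomputable def invariantSubalgebra (n : ℕ) (G : Subgroup (Equiv.Perm (Fin n))) :
    Subalgebra ℚ (MvPolynomial (Fin n) ℚ) :=
  ⨅ g ∈ G, AlgHom.equalizer (rename (⇑g) : MvPolynomial (Fin n) ℚ →ₐ[ℚ] MvPolynomial (Fin n) ℚ)
    (AlgHom.id ℚ (MvPolynomial (Fin n) ℚ))

namespace HilbSer

/-- the `(i+1)`-st elementary symmetric polynomial -/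
noncomputable def el (n i : ℕ) : MvPolynomial (Fin n) ℚ := esymm (Fin n) ℚ (i + 1)

/-- degree `d` part of a subspace -/
noncomputable def comp {n : ℕ} (M : Submodule ℚ (MvPolynomial (Fin n) ℚ)) (d : ℕ) :
    Submodule ℚ (MvPolynomial (Fin n) ℚ) := M ⊓ homogeneousSubmodule (Fin n) ℚ d

/-- the decomposable part in degree `d` -/
noncomputable def dec {n : ℕ} (M : Submodule ℚ (MvPolynomial (Fin n) ℚ)) (d : ℕ) :
    Submodule ℚ (MvPolynomial (Fin n) ℚ) :=
  Submodule.span ℚ {x | ∃ i < n, ∃ d', d' + (i + 1) = d ∧ ∃ f ∈ comp M d', x = el n i * f}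

/-- graded subspaces stable under elementary symmetric polynomials -/
structure Good {n : ℕ} (M : Submodule ℚ (MvPolynomial (Fin n) ℚ)) : Prop where
  mul : ∀ i < n, ∀ f ∈ M, el n i * f ∈ M
  hom : ∀ d, ∀ f ∈ M, homogeneousComponent d f ∈ M

/-- a complement of the decomposable part -/
noncomputable def cpl {n : ℕ} (M : Submodule ℚ (MvPolynomial (Fin n) ℚ)) (d : ℕ) :
    Submodule ℚ (MvPolynomial (Fin n) ℚ) :=
  Classical.choose (exists_isCompl (dec M d)) ⊓ comp M d

instance finHom (n d : ℕ) : FiniteDimensional ℚ (homogeneousSubmodule (Fin n) ℚ d) :=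
  Module.Finite.of_fg (homogeneousSubmodule_fg _ _ d)

instance finComp {n : ℕ} (M : Submodule ℚ (MvPolynomial (Fin n) ℚ)) (d : ℕ) :
    FiniteDimensional ℚ (comp M d) :=
  Submodule.finiteDimensional_of_le (inf_le_right : comp M d ≤ homogeneousSubmodule (Fin n) ℚ d)

instance finCpl {n : ℕ} (M : Submodule ℚ (MvPolynomial (Fin n) ℚ)) (d : ℕ) :
    FiniteDimensional ℚ (cpl M d) :=
  Submodule.finiteDimensional_of_le (inf_le_right : cpl M d ≤ comp M d)

lemma el_hom (n i : ℕ) : (el n i).IsHomogeneous (i + 1) := by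
  unfold el esymm
  apply IsHomogeneous.sum
  intro s hs
  have := IsHomogeneous.prod s (fun i => (X i : MvPolynomial (Fin n) ℚ)) (fun _ => 1)
    (fun i _ => isHomogeneous_X ℚ i)
  simpa [(Finset.mem_powersetCard.1 hs).2] using this

lemma dec_le {n : ℕ} {M : Submodule ℚ (MvPolynomial (Fin n) ℚ)} (hM : Good M) (d : ℕ) :
    dec M d ≤ comp M d := by
  unfold dec
  rw [Submodule.span_le]
  rintro x ⟨i, hi, d', rfl, f, hf, rfl⟩
  refine ⟨hM.mul i hi f hf.1, ?_⟩
  have h2 : f.IsHomogeneous d' := hf.2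
  have := (el_hom n i).mul h2
  rw [add_comm] at this
  exact this

lemma dec_le_hom {n : ℕ} (M : Submodule ℚ (MvPolynomial (Fin n) ℚ)) (d : ℕ) :
    dec M d ≤ homogeneousSubmodule (Fin n) ℚ d := by
  unfold dec
  rw [Submodule.span_le]
  rintro x ⟨i, hi, d', rfl, f, hf, rfl⟩
  have h2 : f.IsHomogeneous d' := hf.2
  have := (el_hom n i).mul h2
  rw [add_comm] at this
  exact this

instance finDec {n : ℕ} (M : Submodule ℚ (MvPolynomial (Fin n) ℚ)) (d : ℕ) :
    FiniteDimensional ℚ (dec M d) :=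
  Submodule.finiteDimensional_of_le (dec_le_hom M d)

lemma dec_sup_cpl {n : ℕ} {M : Submodule ℚ (MvPolynomial (Fin n) ℚ)} (hM : Good M) (d : ℕ) :
    dec M d ⊔ cpl M d = comp M d := by
  have h := Classical.choose_spec (exists_isCompl (dec M d))
  unfold cpl
  rw [← sup_inf_assoc_of_le _ (dec_le hM d), h.sup_eq_top, top_inf_eq]

lemma dec_inf_cpl {n : ℕ} (M : Submodule ℚ (MvPolynomial (Fin n) ℚ)) (d : ℕ) :
    dec M d ⊓ cpl M d = ⊥ := by
  have h := Classical.choose_spec (exists_isCompl (dec M d))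
  unfold cpl
  rw [← inf_assoc, h.inf_eq_bot, bot_inf_eq]

/-- dimension of the complement -/
noncomputable def cdim {n : ℕ} (M : Submodule ℚ (MvPolynomial (Fin n) ℚ)) (d : ℕ) : ℕ :=
  Module.finrank ℚ (cpl M d)

lemma cdim_add {n : ℕ} {M : Submodule ℚ (MvPolynomial (Fin n) ℚ)} (hM : Good M) (d : ℕ) :
    Module.finrank ℚ (dec M d) + cdim M d = Module.finrank ℚ (comp M d) := by
  have := Submodule.finrank_sup_add_finrank_inf_eq (dec M d) (cpl M d)
  rw [dec_sup_cpl hM, dec_inf_cpl, finrank_bot] at this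
  unfold cdim
  omega

/-- closing up under multiplication by one elementary symmetric polynomial -/
noncomputable def stepN {n : ℕ} (k : ℕ) (F : ℕ → Submodule ℚ (MvPolynomial (Fin n) ℚ)) (d : ℕ) :
    Submodule ℚ (MvPolynomial (Fin n) ℚ) :=
  F d ⊔ (if h : k + 1 ≤ d then
    (stepN k F (d - (k + 1))).map (LinearMap.mulLeft ℚ (el n k)) else ⊥)
termination_by d
decreasing_by omega

noncomputable def bigN {n : ℕ} (F : ℕ → Submodule ℚ (MvPolynomial (Fin n) ℚ)) :
    ℕ → ℕ → Submodule ℚ (MvPolynomial (Fin n) ℚ)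
  | 0 => F
  | k + 1 => stepN k (bigN F k)

lemma bigN_succ {n : ℕ} (F : ℕ → Submodule ℚ (MvPolynomial (Fin n) ℚ)) (k d : ℕ) :
    bigN F (k + 1) d = bigN F k d ⊔ (if k + 1 ≤ d then
    (bigN F (k + 1) (d - (k + 1))).map (LinearMap.mulLeft ℚ (el n k)) else ⊥) := by
  conv_lhs => rw [bigN, stepN]
  simp only [dite_eq_ite]
  rfl

lemma le_bigN {n : ℕ} (F : ℕ → Submodule ℚ (MvPolynomial (Fin n) ℚ)) (k d : ℕ) :
    F d ≤ bigN F k d := by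
  induction k with
  | zero => exact le_rfl
  | succ k ih => rw [bigN_succ]; exact ih.trans le_sup_left

lemma bigN_mul {n : ℕ} (F : ℕ → Submodule ℚ (MvPolynomial (Fin n) ℚ)) (k : ℕ) :
    ∀ i < k, ∀ d, ∀ f ∈ bigN F k d, el n i * f ∈ bigN F k (d + (i + 1)) := by
  induction k with
  | zero => intro i hi; omega
  | succ k ih =>
    intro i hi d
    by_cases hik : i = k
    · subst hik
      intro f hf
      rw [bigN_succ, if_pos (by omega), Nat.add_sub_cancel]
      exact Submodule.mem_sup_right ⟨f, hf, rfl⟩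
    · have hik : i < k := by omega
      induction d using Nat.strong_induction_on with
      | _ d ihd =>
        intro f hf
        rw [bigN_succ] at hf
        obtain ⟨a, ha, b, hb, rfl⟩ := Submodule.mem_sup.1 hf
        rw [mul_add]
        apply Submodule.add_mem
        · rw [bigN_succ]
          exact Submodule.mem_sup_left (ih i hik d a ha)
        · split_ifs at hb with hkd
          · obtain ⟨c, hc, rfl⟩ := hb
            have := ihd (d - (k + 1)) (by omega) c hc
            rw [bigN_succ, if_pos (by omega)]
            apply Submodule.mem_sup_right
            refine ⟨el n i * c, ?_, ?_⟩
            · have h9 : d + (i + 1) - (k + 1) = d - (k + 1) + (i + 1) := by omega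
              rw [h9]
              exact this
            · simp only [LinearMap.mulLeft_apply]; ring
          · rw [Submodule.mem_bot] at hb
            simp [hb]

lemma comp_le_bigN {n : ℕ} {M : Submodule ℚ (MvPolynomial (Fin n) ℚ)} (hM : Good M) (d : ℕ) :
    comp M d ≤ bigN (cpl M) n d := by
  induction d using Nat.strong_induction_on with
  | _ d ih =>
    rw [← dec_sup_cpl hM]
    refine sup_le ?_ (le_bigN _ _ _)
    unfold dec
    rw [Submodule.span_le]
    rintro x ⟨i, hi, d', rfl, f, hf, rfl⟩
    exact bigN_mul _ n i hi d' f (ih d' (by omega) hf)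

/-- `∏ 1/(1-z^i)` -/
noncomputable def parts (k : ℕ) : PowerSeries ℚ :=
  ∏ i ∈ Finset.range k, (1 - (PowerSeries.X : PowerSeries ℚ) ^ (i + 1))⁻¹

lemma one_sub_ne (i : ℕ) :
    PowerSeries.constantCoeff (1 - (PowerSeries.X : PowerSeries ℚ) ^ (i + 1)) ≠ 0 := by
  simp

lemma parts_mul (k : ℕ) :
    parts k * ∏ i ∈ Finset.range k, (1 - (PowerSeries.X : PowerSeries ℚ) ^ (i + 1)) = 1 := by
  unfold parts
  rw [← Finset.prod_mul_distrib]
  exact Finset.prod_eq_one fun i _ => PowerSeries.inv_mul_cancel _ (one_sub_ne i)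

lemma coeff_parts_succ (k : ℕ) (w : PowerSeries ℚ) (d : ℕ) :
    PowerSeries.coeff d (parts (k + 1) * w) = PowerSeries.coeff d (parts k * w) +
      if k + 1 ≤ d then PowerSeries.coeff (d - (k + 1)) (parts (k + 1) * w) else 0 := by
  have : parts (k + 1) * w = parts k * w + PowerSeries.X ^ (k + 1) * (parts (k + 1) * w) := by
    have h : parts (k + 1) * (1 - (PowerSeries.X : PowerSeries ℚ) ^ (k + 1)) = parts k := by
      unfold parts
      rw [Finset.prod_range_succ, mul_assoc, PowerSeries.inv_mul_cancel _ (one_sub_ne k), mul_one]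
    rw [← h]; ring
  conv_lhs => rw [this]
  rw [map_add, PowerSeries.coeff_X_pow_mul']

lemma parts_nonneg (w : PowerSeries ℚ) (hw : ∀ d, 0 ≤ PowerSeries.coeff d w) (k : ℕ) :
    ∀ d, 0 ≤ PowerSeries.coeff d (parts k * w) := by
  induction k with
  | zero => simpa [parts] using hw
  | succ k ih =>
    intro d
    induction d using Nat.strong_induction_on with
    | _ d ihd =>
      rw [coeff_parts_succ]
      refine add_nonneg (ih d) ?_
      split_ifs with h
      · exact ihd _ (by omega)
      · exact le_rfl

lemma finrank_bigN {n : ℕ} (F : ℕ → Submodule ℚ (MvPolynomial (Fin n) ℚ))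
    (hF : ∀ d, FiniteDimensional ℚ (F d)) (k : ℕ) :
    ∀ d, FiniteDimensional ℚ (bigN F k d) ∧ (Module.finrank ℚ (bigN F k d) : ℚ) ≤
      PowerSeries.coeff d (parts k * PowerSeries.mk fun d => (Module.finrank ℚ (F d) : ℚ)) := by
  induction k with
  | zero =>
    intro d
    refine ⟨hF d, ?_⟩
    simp only [parts, bigN, Finset.range_zero, Finset.prod_empty, one_mul, PowerSeries.coeff_mk]
    exact le_rfl
  | succ k ih =>
    intro d
    induction d using Nat.strong_induction_on with
    | _ d ihd =>
      have h1 := (ih d).1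
      have h2 := (ih d).2
      rw [bigN_succ, coeff_parts_succ]
      by_cases h : k + 1 ≤ d
      · rw [if_pos h, if_pos h]
        obtain ⟨h3, h4⟩ := ihd (d - (k + 1)) (by omega)
        refine ⟨inferInstance, ?_⟩
        have h5 := Submodule.finrank_add_le_finrank_add_finrank (bigN F k d)
          ((bigN F (k + 1) (d - (k + 1))).map (LinearMap.mulLeft ℚ (el n k)))
        have h6 := Submodule.finrank_map_le (LinearMap.mulLeft ℚ (el n k))
          (bigN F (k + 1) (d - (k + 1)))
        have h7 := h5.trans (Nat.add_le_add_left h6 _)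
        refine le_trans (Nat.cast_le.2 h7) ?_
        push_cast
        exact add_le_add h2 h4
      · rw [if_neg h, if_neg h, sup_bot_eq, add_zero]
        exact ⟨h1, h2⟩

lemma finrank_comp_le {n : ℕ} {M : Submodule ℚ (MvPolynomial (Fin n) ℚ)} (hM : Good M) (d : ℕ) :
    (Module.finrank ℚ (comp M d) : ℚ) ≤
      PowerSeries.coeff d (parts n * PowerSeries.mk fun d => (cdim M d : ℚ)) := by
  obtain ⟨h1, h2⟩ := finrank_bigN (cpl M) (fun d => inferInstance) n d
  exact le_trans (Nat.cast_le.2 (Submodule.finrank_mono (comp_le_bigN hM d))) h2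


section span
variable {A : Type*} [CommRing A] [Algebra ℚ A]

/-- subalgebra generated by the first `k` elements -/
noncomputable def subB (x : ℕ → A) (k : ℕ) : Subalgebra ℚ A := Algebra.adjoin ℚ (x '' Set.Iio k)

/-- span of the staircase monomials in the first `k` elements -/
noncomputable def stair (x : ℕ → A) (n k : ℕ) : Submodule ℚ A :=
  Submodule.span ℚ {y | ∃ a : ℕ → ℕ, (∀ i < k, a i < n - i) ∧ y = ∏ i ∈ Finset.range k, x i ^ a i}

lemma mem_subB (x : ℕ → A) {i k : ℕ} (h : i < k) : x i ∈ subB x k :=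
  Algebra.subset_adjoin ⟨i, h, rfl⟩

lemma exists_rel (x : ℕ → A) (n k : ℕ) (hk : k < n)
    (hx : ∏ i ∈ Finset.range n, (Polynomial.X - Polynomial.C (x i)) = Polynomial.X ^ n) :
    ∃ b : ℕ → A, (∀ t, b t ∈ subB x k) ∧
      x k ^ (n - k) = ∑ t ∈ Finset.range (n - k), b t * x k ^ t := by
  nontriviality A
  set B := subB x k with hB
  set g : Polynomial A := ∏ i ∈ Finset.range k, (Polynomial.X - Polynomial.C (x i)) with hg
  set p : Polynomial A := ∏ i ∈ Finset.Ico k n, (Polynomial.X - Polynomial.C (x i)) with hp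
  have hgp : g * p = Polynomial.X ^ n := by
    rw [← hx, hg, hp]
    exact Finset.prod_range_mul_prod_Ico _ hk.le
  have gmon : g.Monic := Polynomial.monic_prod_of_monic _ _ fun i _ => Polynomial.monic_X_sub_C _
  have pmon : p.Monic := Polynomial.monic_prod_of_monic _ _ fun i _ => Polynomial.monic_X_sub_C _
  have gl : g ∈ Polynomial.lifts (algebraMap B A) := by
    refine Subsemiring.prod_mem _ fun i hi => ?_
    rw [Polynomial.lifts_iff_coeff_lifts]
    intro m
    refine ⟨(Polynomial.X - Polynomial.C
      (⟨x i, mem_subB x (Finset.mem_range.1 hi)⟩ : B)).coeff m, ?_⟩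
    rw [← Polynomial.coeff_map]
    simp only [Polynomial.map_sub, Polynomial.map_X, Polynomial.map_C]
    rfl
  obtain ⟨g', hg', -, gmon'⟩ := Polynomial.lifts_and_natDegree_eq_and_monic gl gmon
  have hpm : (Polynomial.X ^ n /ₘ g').map (algebraMap B A) = p := by
    rw [Polynomial.map_divByMonic _ gmon', hg', Polynomial.map_pow, Polynomial.map_X, ← hgp,
      Polynomial.mul_divByMonic_cancel_left _ gmon]
  have hcoeff : ∀ t, p.coeff t ∈ B := by
    intro t
    rw [← hpm, Polynomial.coeff_map]
    exact ((Polynomial.X ^ n /ₘ g').coeff t).2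
  have hdeg : p.natDegree = n - k := by
    rw [hp, Polynomial.natDegree_prod_of_monic _ _ fun i _ => Polynomial.monic_X_sub_C _]
    simp
  have hev : p.eval (x k) = 0 := by
    rw [hp, Polynomial.eval_prod]
    apply Finset.prod_eq_zero (i := k) (by simp [hk])
    simp
  rw [Polynomial.eval_eq_sum_range, Finset.sum_range_succ, hdeg] at hev
  have htop : p.coeff (n - k) = 1 := by rw [← hdeg]; exact pmon
  rw [htop, one_mul] at hev
  refine ⟨fun t => -p.coeff t, fun t => B.neg_mem (hcoeff t), ?_⟩
  simp only [neg_mul, Finset.sum_neg_distrib]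
  exact eq_neg_of_add_eq_zero_right hev

lemma stair_mul_pow (x : ℕ → A) (n k t : ℕ) (ht : t < n - k) (c : A) (hc : c ∈ stair x n k) :
    c * x k ^ t ∈ stair x n (k + 1) := by
  unfold stair at hc
  induction hc using Submodule.span_induction with
  | mem y hy =>
    obtain ⟨a, ha, rfl⟩ := hy
    refine Submodule.subset_span ⟨Function.update a k t, ?_, ?_⟩
    · intro i hi
      by_cases h : i = k
      · subst h; simpa using ht
      · rw [Function.update_of_ne h]; exact ha i (by omega)
    · rw [Finset.prod_range_succ, Function.update_self]
      congr 1
      refine Finset.prod_congr rfl fun i hi => ?_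
      rw [Function.update_of_ne (Finset.mem_range.1 hi).ne]
  | zero => simp
  | add a b _ _ ha hb => rw [add_mul]; exact Submodule.add_mem _ ha hb
  | smul r a _ ha => rw [smul_mul_assoc]; exact Submodule.smul_mem _ r ha

lemma stair_le_subB (x : ℕ → A) (n k : ℕ) : ∀ c ∈ stair x n k, c ∈ subB x k := by
  intro c hc
  have : stair x n k ≤ Subalgebra.toSubmodule (subB x k) := by
    unfold stair
    rw [Submodule.span_le]
    rintro _ ⟨a, _, rfl⟩
    exact Subalgebra.prod_mem _ fun i hi => Subalgebra.pow_mem _ (mem_subB x (by simpa using hi)) _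
  exact this hc

lemma subB_le_stair (x : ℕ → A) (n k : ℕ) (hk : k ≤ n)
    (hx : ∏ i ∈ Finset.range n, (Polynomial.X - Polynomial.C (x i)) = Polynomial.X ^ n) :
    ∀ c ∈ subB x k, c ∈ stair x n k := by
  induction k with
  | zero =>
    intro c hc
    have h0 : Set.Iio (0 : ℕ) = ∅ := by ext; simp
    rw [subB, h0, Set.image_empty, Algebra.adjoin_empty] at hc
    obtain ⟨r, rfl⟩ := Algebra.mem_bot.1 hc
    rw [Algebra.algebraMap_eq_smul_one]
    exact Submodule.smul_mem _ _ (Submodule.subset_span ⟨0, by simp, by simp⟩)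
  | succ k ih =>
    have ih := ih (by omega)
    have key : ∀ i < k + 1, ∀ c ∈ stair x n (k + 1), x i * c ∈ stair x n (k + 1) := by
      intro i hi c hc
      unfold stair at hc
      induction hc using Submodule.span_induction with
      | zero => simp
      | add a b _ _ ha hb => rw [mul_add]; exact Submodule.add_mem _ ha hb
      | smul r a _ ha => rw [mul_smul_comm]; exact Submodule.smul_mem _ r ha
      | mem y hy =>
        obtain ⟨a, ha, rfl⟩ := hy
        rw [Finset.prod_range_succ]
        set m := ∏ i ∈ Finset.range k, x i ^ a i with hm
        have hmB : m ∈ subB x k :=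
          Subalgebra.prod_mem _ fun i hi =>
            Subalgebra.pow_mem _ (mem_subB x (by simpa using hi)) _
        have hak := ha k (by omega)
        by_cases hik : i = k
        · subst hik
          have e1 : x i * (m * x i ^ a i) = m * x i ^ (a i + 1) := by ring
          rw [e1]
          by_cases h2 : a i + 1 < n - i
          · exact stair_mul_pow x n i _ h2 _ (ih _ hmB)
          · have h3 : a i + 1 = n - i := by omega
            obtain ⟨b, hb, hb2⟩ := exists_rel x n i (by omega) hx
            rw [h3, hb2, Finset.mul_sum]
            refine Submodule.sum_mem _ fun t ht => ?_
            rw [← mul_assoc]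
            exact stair_mul_pow x n i t (by simpa using ht) _ (ih _ (Subalgebra.mul_mem _ hmB (hb t)))
        · rw [← mul_assoc]
          exact stair_mul_pow x n k _ hak _
            (ih _ (Subalgebra.mul_mem _ (mem_subB x (by omega)) hmB))
    have one_mem : (1 : A) ∈ stair x n (k + 1) :=
      Submodule.subset_span ⟨0, fun i hi => by simp; omega, by simp⟩
    have all : ∀ b ∈ subB x (k + 1), ∀ c ∈ stair x n (k + 1), b * c ∈ stair x n (k + 1) := by
      intro b hb
      unfold subB at hb
      induction hb using Algebra.adjoin_induction with
      | mem y hy =>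
        obtain ⟨i, hi, rfl⟩ := hy
        exact key i hi
      | algebraMap r =>
        intro c hc
        rw [← Algebra.smul_def]
        exact Submodule.smul_mem _ _ hc
      | add u v _ _ hu hv =>
        intro c hc
        rw [add_mul]
        exact Submodule.add_mem _ (hu c hc) (hv c hc)
      | mul u v _ _ hu hv =>
        intro c hc
        rw [mul_assoc]
        exact hu _ (hv c hc)
    intro c hc
    simpa using all c hc 1 one_mem

end span


/-- the ideal of elementary symmetric polynomials -/
noncomputable def eI (n : ℕ) : Ideal (MvPolynomial (Fin n) ℚ) :=
  Ideal.span (Set.range fun i : Fin n => el n i)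

/-- images of the variables -/
noncomputable def xq (n k : ℕ) : MvPolynomial (Fin n) ℚ ⧸ eI n :=
  if h : k < n then Ideal.Quotient.mk (eI n) (X ⟨k, h⟩) else 0

/-- staircase exponents -/
def box (n : ℕ) : Finset (Fin n → ℕ) := Fintype.piFinset fun i => Finset.range (n - i)

/-- staircase exponents of given degree -/
def boxd (n d : ℕ) : Finset (Fin n → ℕ) := (box n).filter fun a => ∑ i, a i = d

noncomputable def mono {n : ℕ} (a : Fin n → ℕ) : MvPolynomial (Fin n) ℚ := ∏ i, X i ^ a i

lemma xq_rel (n : ℕ) : ∏ i ∈ Finset.range n, (Polynomial.X - Polynomial.C (xq n i)) =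
    Polynomial.X ^ n := by
  have h1 : ∏ i ∈ Finset.range n, (Polynomial.X - Polynomial.C (xq n i)) =
      ∏ i : Fin n, (Polynomial.X - Polynomial.C (Ideal.Quotient.mk (eI n) (X i))) := by
    rw [Finset.prod_range]
    refine Finset.prod_congr rfl fun i _ => ?_
    simp [xq]
  have h2 := Multiset.prod_X_sub_X_eq_sum_esymm
    ((Finset.univ : Finset (Fin n)).val.map fun i => Ideal.Quotient.mk (eI n) (X i))
  rw [Multiset.map_map] at h2
  rw [h1]
  refine Eq.trans ?_ (h2.trans ?_)
  · rfl
  · rw [Finset.sum_range_succ']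
    have hes : ∀ j, Multiset.esymm ((Finset.univ : Finset (Fin n)).val.map
        fun i => Ideal.Quotient.mk (eI n) (X i)) j = Ideal.Quotient.mk (eI n) (esymm (Fin n) ℚ j) := by
      intro j
      rw [← aeval_esymm_eq_multiset_esymm (Fin n) ℚ]
      have : (Ideal.Quotient.mkₐ ℚ (eI n)) = aeval fun i => Ideal.Quotient.mk (eI n) (X i) := by
        ext i; simp
      rw [← this]; rfl
    simp only [hes]
    rw [Finset.sum_eq_zero]
    · simp
    · intro j hj
      have hj : j < n := by simpa using hj
      have : Ideal.Quotient.mk (eI n) (esymm (Fin n) ℚ (j + 1)) = 0 := by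
        rw [Ideal.Quotient.eq_zero_iff_mem]
        exact Ideal.subset_span ⟨⟨j, hj⟩, rfl⟩
      rw [this]; simp

lemma mk_mem (n : ℕ) (f : MvPolynomial (Fin n) ℚ) : Ideal.Quotient.mk (eI n) f ∈ subB (xq n) n := by
  induction f using MvPolynomial.induction_on with
  | C r => exact (subB (xq n) n).algebraMap_mem r
  | add p q hp hq => rw [map_add]; exact Subalgebra.add_mem _ hp hq
  | mul_X p i hp =>
    rw [map_mul]
    refine Subalgebra.mul_mem _ hp ?_
    have := mem_subB (xq n) i.2
    simpa [xq] using this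

lemma exists_span (n : ℕ) (f : MvPolynomial (Fin n) ℚ) :
    ∃ s ∈ Submodule.span ℚ (mono '' (box n : Set (Fin n → ℕ))), f - s ∈ eI n := by
  have h := subB_le_stair (xq n) n n le_rfl (xq_rel n) _ (mk_mem n f)
  have h2 : stair (xq n) n n ≤ (Submodule.span ℚ (mono '' (box n : Set (Fin n → ℕ)))).map
      (Ideal.Quotient.mkₐ ℚ (eI n)).toLinearMap := by
    unfold stair
    rw [Submodule.span_le]
    rintro _ ⟨a, ha, rfl⟩
    refine ⟨mono fun i => a i, Submodule.subset_span ⟨_, ?_, rfl⟩, ?_⟩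
    · simp only [box, Finset.mem_coe, Fintype.mem_piFinset, Finset.mem_range]
      exact fun i => ha i i.2
    · rw [Finset.prod_range]
      simp [mono, xq]
  obtain ⟨s, hs, hs2⟩ := h2 h
  refine ⟨s, hs, ?_⟩
  rw [← Ideal.Quotient.eq]
  exact hs2.symm

lemma mono_hom {n : ℕ} (a : Fin n → ℕ) : (mono a).IsHomogeneous (∑ i, a i) := by
  unfold mono
  exact IsHomogeneous.prod _ _ _ fun i _ => isHomogeneous_X_pow i _

lemma comp_eI {n : ℕ} (d : ℕ) (y : MvPolynomial (Fin n) ℚ) (hy : y ∈ eI n) :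
    homogeneousComponent d y ∈ dec (⊤ : Submodule ℚ (MvPolynomial (Fin n) ℚ)) d := by
  obtain ⟨c, rfl⟩ := Ideal.mem_span_range_iff_exists_fun.1 hy
  rw [map_sum]
  refine Submodule.sum_mem _ fun i _ => ?_
  rw [← sum_homogeneousComponent (c i), Finset.sum_mul, map_sum]
  refine Submodule.sum_mem _ fun j _ => ?_
  have h : (homogeneousComponent j (c i) * el n i) ∈
      homogeneousSubmodule (Fin n) ℚ (j + (i + 1)) :=
    (homogeneousComponent_isHomogeneous j (c i)).mul (el_hom n i)
  rw [homogeneousComponent_of_mem h]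
  split_ifs with hd
  · refine Submodule.subset_span ⟨i, i.2, j, hd.symm, homogeneousComponent j (c i), ?_, mul_comm _ _⟩
    exact ⟨trivial, homogeneousComponent_isHomogeneous j (c i)⟩
  · exact Submodule.zero_mem _

lemma comp_span {n : ℕ} (d : ℕ) (s : MvPolynomial (Fin n) ℚ)
    (hs : s ∈ Submodule.span ℚ (mono '' (box n : Set (Fin n → ℕ)))) :
    homogeneousComponent d s ∈ Submodule.span ℚ (mono '' (boxd n d : Set (Fin n → ℕ))) := by
  induction hs using Submodule.span_induction with
  | zero => simp
  | add a b _ _ ha hb => rw [map_add]; exact Submodule.add_mem _ ha hb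
  | smul r a _ ha => rw [map_smul]; exact Submodule.smul_mem _ r ha
  | mem y hy =>
    obtain ⟨a, ha, rfl⟩ := hy
    rw [homogeneousComponent_of_mem (mono_hom a)]
    split_ifs with hd
    · exact Submodule.subset_span ⟨a, by simpa [boxd, hd] using ha, rfl⟩
    · exact Submodule.zero_mem _

lemma hom_le (n d : ℕ) : homogeneousSubmodule (Fin n) ℚ d ≤
    dec (⊤ : Submodule ℚ (MvPolynomial (Fin n) ℚ)) d ⊔
      Submodule.span ℚ (mono '' (boxd n d : Set (Fin n → ℕ))) := by
  intro f hf
  obtain ⟨s, hs, hs2⟩ := exists_span n f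
  have h : f = homogeneousComponent d (f - s) + homogeneousComponent d s := by
    rw [← map_add, sub_add_cancel, homogeneousComponent_of_mem hf, if_pos rfl]
  rw [h]
  exact Submodule.add_mem_sup (comp_eI d _ hs2) (comp_span d s hs)

lemma finrank_hom_le (n d : ℕ) : Module.finrank ℚ (homogeneousSubmodule (Fin n) ℚ d) ≤
    Module.finrank ℚ (dec (⊤ : Submodule ℚ (MvPolynomial (Fin n) ℚ)) d) + (boxd n d).card := by
  classical
  have hfin : (mono '' (boxd n d : Set (Fin n → ℕ))) = ((boxd n d).image mono : Finset _) := by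
    simp
  have h := hom_le n d
  rw [hfin] at h
  have h1 := Submodule.finrank_mono h
  have h2 := Submodule.finrank_add_le_finrank_add_finrank
    (dec (⊤ : Submodule ℚ (MvPolynomial (Fin n) ℚ)) d)
    (Submodule.span ℚ (((boxd n d).image mono : Finset (MvPolynomial (Fin n) ℚ)) :
      Set (MvPolynomial (Fin n) ℚ)))
  have h3 := finrank_span_finset_le_card (R := ℚ)
    ((boxd n d).image mono : Finset (MvPolynomial (Fin n) ℚ))
  have h4 : ((boxd n d).image mono : Finset (MvPolynomial (Fin n) ℚ)).card ≤ _ :=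
    Finset.card_image_le
  unfold Set.finrank at h3
  omega

lemma finrank_hom (n d : ℕ) : (Module.finrank ℚ (homogeneousSubmodule (Fin n) ℚ d) : ℚ) =
    PowerSeries.coeff d ((PowerSeries.mk 1 : PowerSeries ℚ) ^ n) := by
  classical
  have h1 : PowerSeries.coeff d ((PowerSeries.mk 1 : PowerSeries ℚ) ^ n) =
      (Finset.finsuppAntidiag (Finset.univ : Finset (Fin n)) d).card := by
    have := PowerSeries.coeff_prod (fun _ : Fin n => (PowerSeries.mk 1 : PowerSeries ℚ)) d
      Finset.univ
    simpa using this
  rw [h1, homogeneousSubmodule_eq_finsupp_supported]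
  congr 1
  have h2 : {d' : Fin n →₀ ℕ | d'.degree = d} =
      (Finset.finsuppAntidiag (Finset.univ : Finset (Fin n)) d : Set (Fin n →₀ ℕ)) := by
    ext a
    simp [Finsupp.degree_eq_sum]
  rw [h2]
  have e := Module.finrank_eq_card_basis (basisRestrictSupport ℚ
    (Finset.finsuppAntidiag (Finset.univ : Finset (Fin n)) d : Set (Fin n →₀ ℕ)))
  refine Eq.trans e ?_
  simp

lemma coeff_boxd (n : ℕ) : (PowerSeries.mk fun d => ((boxd n d).card : ℚ)) =
    ∏ i ∈ Finset.range n, ∑ t ∈ Finset.range (i + 1), (PowerSeries.X : PowerSeries ℚ) ^ t := by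
  classical
  rw [← Finset.prod_range_reflect]
  have h0 : ∏ j ∈ Finset.range n, ∑ t ∈ Finset.range (n - 1 - j + 1),
      (PowerSeries.X : PowerSeries ℚ) ^ t =
      ∏ j : Fin n, ∑ t ∈ Finset.range (n - j), (PowerSeries.X : PowerSeries ℚ) ^ t := by
    rw [Finset.prod_range]
    refine Finset.prod_congr rfl fun j _ => ?_
    congr 2
    omega
  rw [h0, Finset.prod_univ_sum]
  ext d
  rw [PowerSeries.coeff_mk, map_sum, boxd, box, Finset.card_filter]
  push_cast
  refine Finset.sum_congr rfl fun a _ => ?_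
  rw [Finset.prod_pow_eq_pow_sum, PowerSeries.coeff_X_pow]
  simp only [eq_comm]

lemma parts_boxd (n : ℕ) : parts n * (PowerSeries.mk fun d => ((boxd n d).card : ℚ)) =
    (PowerSeries.mk 1 : PowerSeries ℚ) ^ n := by
  have h : ∀ i, ∑ t ∈ Finset.range (i + 1), (PowerSeries.X : PowerSeries ℚ) ^ t =
      PowerSeries.mk 1 * (1 - PowerSeries.X ^ (i + 1)) := by
    intro i
    have h1 := mul_neg_geom_sum (PowerSeries.X : PowerSeries ℚ) (i + 1)
    rw [← h1, ← mul_assoc, PowerSeries.mk_one_mul_one_sub_eq_one, one_mul]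
  rw [coeff_boxd, Finset.prod_congr rfl fun i _ => h i, Finset.prod_mul_distrib, mul_left_comm,
    parts_mul]
  simp

lemma box_card (n : ℕ) : (box n).card = n ! := by
  rw [box, Fintype.card_piFinset]
  simp only [Finset.card_range]
  rw [← Finset.prod_range (fun i => n - i), ← Finset.prod_range_reflect,
    ← Finset.prod_range_add_one_eq_factorial]
  refine Finset.prod_congr rfl fun j hj => ?_
  have := Finset.mem_range.1 hj
  omega

lemma box_sum_le {n : ℕ} {a : Fin n → ℕ} (ha : a ∈ box n) : ∑ i, a i < n * n + 1 := by
  have : ∑ i, a i ≤ ∑ _i : Fin n, n := by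
    refine Finset.sum_le_sum fun i _ => ?_
    have := Finset.mem_range.1 (Fintype.mem_piFinset.1 ha i)
    omega
  simp at this
  omega

lemma sum_boxd (n : ℕ) : ∑ d ∈ Finset.range (n * n + 1), (boxd n d).card = n ! := by
  rw [← box_card]
  exact (Finset.card_eq_sum_card_fiberwise (f := fun a : Fin n → ℕ => ∑ i, a i)
    fun a ha => by simpa using box_sum_le ha).symm

lemma boxd_zero (n d : ℕ) (h : n * n + 1 ≤ d) : (boxd n d).card = 0 := by
  rw [Finset.card_eq_zero, boxd, Finset.filter_eq_empty_iff]
  intro a ha hd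
  have := box_sum_le ha
  omega


section group
variable {n : ℕ} (G : Subgroup (Equiv.Perm (Fin n)))

/-- the invariant subspace -/
noncomputable abbrev inv : Submodule ℚ (MvPolynomial (Fin n) ℚ) :=
  Subalgebra.toSubmodule (invariantSubalgebra n G)

lemma mem_inv (f : MvPolynomial (Fin n) ℚ) : f ∈ inv G ↔ ∀ g ∈ G, rename (⇑g) f = f := by
  simp [inv, invariantSubalgebra, AlgHom.mem_equalizer]

/-- Reynolds operator -/
noncomputable def rho : MvPolynomial (Fin n) ℚ →ₗ[ℚ] MvPolynomial (Fin n) ℚ :=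
  (Nat.card G : ℚ)⁻¹ • ∑ᶠ g : G, (rename (⇑(g : Equiv.Perm (Fin n))) :
    MvPolynomial (Fin n) ℚ →ₐ[ℚ] MvPolynomial (Fin n) ℚ).toLinearMap

lemma rho_apply [Fintype G] (f : MvPolynomial (Fin n) ℚ) :
    rho G f = (Nat.card G : ℚ)⁻¹ • ∑ g : G, rename (⇑(g : Equiv.Perm (Fin n))) f := by
  unfold rho
  rw [finsum_eq_sum_of_fintype]
  simp

lemma rho_mem (f : MvPolynomial (Fin n) ℚ) : rho G f ∈ inv G := by
  classical
  rw [mem_inv]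
  intro g hg
  rw [rho_apply, map_smul, map_sum]
  congr 1
  refine Fintype.sum_equiv (Equiv.mulLeft (⟨g, hg⟩ : G)) _ _ fun h => ?_
  rw [rename_rename]
  rfl

lemma rho_of_mem (f : MvPolynomial (Fin n) ℚ) (hf : f ∈ inv G) : rho G f = f := by
  classical
  rw [mem_inv] at hf
  rw [rho_apply, Finset.sum_congr rfl fun g _ => hf g.1 g.2]
  have : (Nat.card G : ℚ) ≠ 0 := by exact_mod_cast Nat.card_pos.ne'
  rw [Finset.sum_const, Finset.card_univ, ← Nat.card_eq_fintype_card, ← Nat.cast_smul_eq_nsmul ℚ,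
    smul_smul, inv_mul_cancel₀ this, one_smul]

lemma rename_el (g : Equiv.Perm (Fin n)) (i : ℕ) : rename (⇑g) (el n i) = el n i :=
  rename_esymm (Fin n) ℚ (i + 1) g

lemma rho_el (i : ℕ) (f : MvPolynomial (Fin n) ℚ) : rho G (el n i * f) = el n i * rho G f := by
  classical
  simp only [rho_apply, map_mul, rename_el, mul_smul_comm, Finset.mul_sum]

lemma rho_hom (d : ℕ) (f : MvPolynomial (Fin n) ℚ) :
    rho G (homogeneousComponent d f) = homogeneousComponent d (rho G f) := by
  classical
  simp only [rho_apply, map_smul, map_sum, rename_homogeneousComponent]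

lemma good_inv : Good (inv G) where
  mul i _ f hf := by
    rw [← rho_of_mem G f hf, ← rho_el]
    exact rho_mem G _
  hom d f hf := by
    rw [← rho_of_mem G f hf, ← rho_hom]
    exact rho_mem G _

/-- kernel of the Reynolds operator -/
noncomputable abbrev ker : Submodule ℚ (MvPolynomial (Fin n) ℚ) := LinearMap.ker (rho G)

lemma good_ker : Good (ker G) where
  mul i _ f hf := by
    rw [LinearMap.mem_ker] at hf ⊢
    rw [rho_el, hf, mul_zero]
  hom d f hf := by
    rw [LinearMap.mem_ker] at hf ⊢
    rw [rho_hom, hf, map_zero]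

lemma sub_mem_ker (f : MvPolynomial (Fin n) ℚ) : f - rho G f ∈ ker G := by
  rw [LinearMap.mem_ker, map_sub, rho_of_mem G _ (rho_mem G f), sub_self]

lemma rho_mem_comp {d : ℕ} {f : MvPolynomial (Fin n) ℚ} (hf : f ∈ homogeneousSubmodule (Fin n) ℚ d) :
    rho G f ∈ comp (inv G) d ∧ f - rho G f ∈ comp (ker G) d := by
  have h : rho G f ∈ homogeneousSubmodule (Fin n) ℚ d := by
    have h1 : homogeneousComponent d f = f := by
      rw [homogeneousComponent_of_mem hf, if_pos rfl]
    rw [← h1, rho_hom]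
    exact homogeneousComponent_mem d _
  exact ⟨⟨rho_mem G f, h⟩, ⟨sub_mem_ker G f, Submodule.sub_mem _ hf h⟩⟩

lemma finrank_split (d : ℕ) : Module.finrank ℚ (homogeneousSubmodule (Fin n) ℚ d) =
    Module.finrank ℚ (comp (inv G) d) + Module.finrank ℚ (comp (ker G) d) := by
  have h := Submodule.finrank_sup_add_finrank_inf_eq (comp (inv G) d) (comp (ker G) d)
  have h1 : comp (inv G) d ⊔ comp (ker G) d = homogeneousSubmodule (Fin n) ℚ d := by
    refine le_antisymm (sup_le inf_le_right inf_le_right) fun f hf => ?_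
    obtain ⟨h1, h2⟩ := rho_mem_comp G hf
    have := Submodule.add_mem_sup h1 h2
    rwa [add_sub_cancel] at this
  have h2 : comp (inv G) d ⊓ comp (ker G) d = ⊥ := by
    rw [eq_bot_iff]
    rintro f ⟨hf, hf'⟩
    have h3 := rho_of_mem G f hf.1
    have h4 : rho G f = 0 := hf'.1
    rw [h4] at h3
    exact h3.symm
  rw [h1, h2, finrank_bot] at h
  omega

lemma dec_top_le (d : ℕ) : dec (⊤ : Submodule ℚ (MvPolynomial (Fin n) ℚ)) d ≤
    dec (inv G) d ⊔ dec (ker G) d := by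
  conv_lhs => unfold dec
  rw [Submodule.span_le]
  rintro _ ⟨i, hi, d', hd, f, hf, rfl⟩
  obtain ⟨h1, h2⟩ := rho_mem_comp G hf.2
  have : el n i * f = el n i * rho G f + el n i * (f - rho G f) := by ring
  rw [this]
  exact Submodule.add_mem_sup (Submodule.subset_span ⟨i, hi, d', hd, _, h1, rfl⟩)
    (Submodule.subset_span ⟨i, hi, d', hd, _, h2, rfl⟩)

lemma cdim_le (d : ℕ) : cdim (inv G) d + cdim (ker G) d ≤ (boxd n d).card := by
  have h1 := cdim_add (good_inv G) d
  have h2 := cdim_add (good_ker G) d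
  have h3 := finrank_split G d
  have h4 := finrank_hom_le n d
  have h5 := Submodule.finrank_mono (dec_top_le G d)
  have h6 := Submodule.finrank_add_le_finrank_add_finrank (dec (inv G) d) (dec (ker G) d)
  omega

lemma hilbert_eq : (PowerSeries.mk fun d => (Module.finrank ℚ (comp (inv G) d) : ℚ)) =
    parts n * PowerSeries.mk fun d => (cdim (inv G) d : ℚ) := by
  ext d
  rw [PowerSeries.coeff_mk]
  have h1 := finrank_comp_le (good_inv G) d
  have h2 := finrank_comp_le (good_ker G) d
  have h3 := parts_nonneg ((PowerSeries.mk fun d => ((boxd n d).card : ℚ)) -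
    (PowerSeries.mk fun d => (cdim (inv G) d : ℚ)) - (PowerSeries.mk fun d => (cdim (ker G) d : ℚ)))
    (by
      intro d
      simp only [map_sub, PowerSeries.coeff_mk]
      have : ((cdim (inv G) d + cdim (ker G) d : ℕ) : ℚ) ≤ (boxd n d).card :=
        Nat.cast_le.2 (cdim_le G d)
      push_cast at this
      linarith) n d
  rw [mul_sub, mul_sub, parts_boxd, map_sub, map_sub, ← finrank_hom, finrank_split G] at h3
  push_cast at h3
  linarith

/-- evaluation at the orbit of `(0,1,…,n-1)` -/
noncomputable def ev (n : ℕ) : MvPolynomial (Fin n) ℚ →ₗ[ℚ] (Equiv.Perm (Fin n) → ℚ) :=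
  LinearMap.pi fun σ => (aeval (fun i => ((σ i : ℕ) : ℚ)) : MvPolynomial (Fin n) ℚ →ₐ[ℚ] ℚ).toLinearMap

lemma ev_apply (f : MvPolynomial (Fin n) ℚ) (σ : Equiv.Perm (Fin n)) :
    ev n f σ = aeval (fun i => ((σ i : ℕ) : ℚ)) f := rfl

lemma ev_rename (g : Equiv.Perm (Fin n)) (f : MvPolynomial (Fin n) ℚ) (σ : Equiv.Perm (Fin n)) :
    ev n (rename (⇑g) f) σ = ev n f (σ * g) := by
  rw [ev_apply, ev_apply, aeval_rename]
  rfl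

lemma ev_el (i : ℕ) (f : MvPolynomial (Fin n) ℚ) : ev n (el n i * f) = ev n (el n i) 1 • ev n f := by
  funext σ
  have h := ev_rename σ (el n i) 1
  rw [rename_el, one_mul] at h
  rw [Pi.smul_apply, h, smul_eq_mul]
  simp [ev_apply]

lemma ev_surj (n : ℕ) : LinearMap.range (ev n) = ⊤ := by
  classical
  rw [eq_top_iff]
  intro u _
  have hs : ∀ σ : Equiv.Perm (Fin n), Pi.single σ (1 : ℚ) ∈ LinearMap.range (ev n) := by
    intro σ
    set p : MvPolynomial (Fin n) ℚ :=
      ∏ i : Fin n, ∏ j ∈ Finset.univ.erase (σ i), (X i - C ((j : ℕ) : ℚ)) with hp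
    have h1 : ∀ τ, ev n p τ = ∏ i : Fin n, ∏ j ∈ Finset.univ.erase (σ i),
        (((τ i : ℕ) : ℚ) - ((j : ℕ) : ℚ)) := by
      intro τ
      rw [ev_apply, hp]
      simp [map_prod]
    have h2 : ev n p σ ≠ 0 := by
      rw [h1]
      refine Finset.prod_ne_zero_iff.2 fun i _ => Finset.prod_ne_zero_iff.2 fun j hj => ?_
      rw [sub_ne_zero]
      intro h
      have h : σ i = j := Fin.ext (by exact_mod_cast h)
      simp [h] at hj
    have h3 : ∀ τ, τ ≠ σ → ev n p τ = 0 := by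
      intro τ hτ
      rw [h1]
      obtain ⟨i, hi⟩ : ∃ i, τ i ≠ σ i := by
        by_contra! h
        exact hτ (Equiv.ext h)
      exact Finset.prod_eq_zero (Finset.mem_univ i)
        (Finset.prod_eq_zero (i := τ i) (by simp [hi]) (sub_self _))
    refine ⟨(ev n p σ)⁻¹ • p, ?_⟩
    funext τ
    rw [map_smul, Pi.smul_apply]
    by_cases hτ : τ = σ
    · subst hτ
      simp [h2]
    · simp [h3 τ hτ, hτ]
  rw [← Finset.univ_sum_single u]
  refine Submodule.sum_mem _ fun σ _ => ?_
  have : Pi.single σ (u σ) = u σ • (Pi.single σ (1 : ℚ) : Equiv.Perm (Fin n) → ℚ) := by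
    rw [← Pi.single_smul, smul_eq_mul, mul_one]
  rw [this]
  exact Submodule.smul_mem _ _ (hs σ)

lemma ev_comp_le {M : Submodule ℚ (MvPolynomial (Fin n) ℚ)} (hM : Good M) (B : ℕ)
    (hB : ∀ d, B ≤ d → cdim M d = 0) (d : ℕ) :
    (comp M d).map (ev n) ≤ (Finset.range B).sup fun j => (cpl M j).map (ev n) := by
  induction d using Nat.strong_induction_on with
  | _ d ih =>
    rw [← dec_sup_cpl hM, Submodule.map_sup]
    refine sup_le ?_ ?_
    · rw [Submodule.map_le_iff_le_comap]
      conv_lhs => unfold dec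
      rw [Submodule.span_le]
      rintro _ ⟨i, hi, d', rfl, f, hf, rfl⟩
      simp only [Submodule.comap_coe, Set.mem_preimage, SetLike.mem_coe]
      rw [ev_el]
      exact Submodule.smul_mem _ _ (ih d' (by omega) ⟨f, hf, rfl⟩)
    · by_cases h : d < B
      · exact Finset.le_sup (f := fun j => (cpl M j).map (ev n)) (Finset.mem_range.2 h)
      · have := hB d (by omega)
        have h0 : cpl M d = ⊥ := Submodule.finrank_eq_zero.1 this
        rw [h0, Submodule.map_bot]
        exact bot_le

lemma ev_le {M : Submodule ℚ (MvPolynomial (Fin n) ℚ)} (hM : Good M) (B : ℕ)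
    (hB : ∀ d, B ≤ d → cdim M d = 0) :
    M.map (ev n) ≤ (Finset.range B).sup fun j => (cpl M j).map (ev n) := by
  rintro _ ⟨f, hf, rfl⟩
  rw [← sum_homogeneousComponent f, map_sum]
  exact Submodule.sum_mem _ fun j _ => ev_comp_le hM B hB j
    ⟨_, ⟨hM.hom j f hf, homogeneousComponent_mem j f⟩, rfl⟩

lemma finrank_sup_le (M : Submodule ℚ (MvPolynomial (Fin n) ℚ)) (B : ℕ) :
    Module.finrank ℚ ((Finset.range B).sup fun j => (cpl M j).map (ev n) :
      Submodule ℚ (Equiv.Perm (Fin n) → ℚ)) ≤ ∑ j ∈ Finset.range B, cdim M j := by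
  induction B with
  | zero =>
    rw [Finset.range_zero, Finset.sup_empty, finrank_bot]
    exact Nat.zero_le _
  | succ B ih =>
    rw [Finset.range_add_one, Finset.sup_insert, Finset.sum_insert (by simp)]
    refine (Submodule.finrank_add_le_finrank_add_finrank _ _).trans ?_
    exact Nat.add_le_add (Submodule.finrank_map_le _ _) ih

lemma finrank_ev_le {M : Submodule ℚ (MvPolynomial (Fin n) ℚ)} (hM : Good M) (B : ℕ)
    (hB : ∀ d, B ≤ d → cdim M d = 0) :
    Module.finrank ℚ (M.map (ev n)) ≤ ∑ j ∈ Finset.range B, cdim M j :=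
  (Submodule.finrank_mono (ev_le hM B hB)).trans (finrank_sup_le M B)

/-- functions constant on left cosets -/
noncomputable def pull : ((Equiv.Perm (Fin n) ⧸ G) → ℚ) →ₗ[ℚ] (Equiv.Perm (Fin n) → ℚ) :=
  LinearMap.funLeft ℚ ℚ (fun σ => (σ : Equiv.Perm (Fin n) ⧸ G))

lemma finrank_pull : Module.finrank ℚ (LinearMap.range (pull G)) = Nat.card (Equiv.Perm (Fin n) ⧸ G) := by
  classical
  have : Fintype (Equiv.Perm (Fin n) ⧸ G) := Fintype.ofFinite _
  unfold pull
  rw [LinearMap.finrank_range_of_inj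
    (LinearMap.funLeft_injective_of_surjective _ _ _ QuotientGroup.mk_surjective),
    Module.finrank_fintype_fun_eq_card, Nat.card_eq_fintype_card]

lemma ev_inv : (inv G).map (ev n) = LinearMap.range (pull G) := by
  classical
  apply le_antisymm
  · rintro _ ⟨f, hf, rfl⟩
    have hf := (mem_inv G f).1 hf
    refine ⟨fun q => ev n f q.out, ?_⟩
    funext σ
    obtain ⟨g, hg⟩ := QuotientGroup.mk_out_eq_mul G σ
    change ev n f (Quotient.out (σ : Equiv.Perm (Fin n) ⧸ G)) = _
    rw [hg, ← ev_rename, hf g.1 g.2]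
  · rintro _ ⟨ψ, rfl⟩
    obtain ⟨f, hf⟩ : pull G ψ ∈ LinearMap.range (ev n) := by rw [ev_surj]; trivial
    refine ⟨rho G f, rho_mem G f, ?_⟩
    funext σ
    rw [rho_apply, map_smul, map_sum, Pi.smul_apply, Finset.sum_apply]
    have h : ∀ g : G, ev n (rename (⇑(g : Equiv.Perm (Fin n))) f) σ = pull G ψ σ := by
      intro g
      rw [ev_rename, hf]
      change ψ _ = ψ _
      congr 1
      exact QuotientGroup.mk_mul_of_mem _ g.2
    have : (Nat.card G : ℚ) ≠ 0 := by exact_mod_cast Nat.card_pos.ne'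
    rw [Finset.sum_congr rfl fun g _ => h g, Finset.sum_const, Finset.card_univ,
      ← Nat.card_eq_fintype_card, nsmul_eq_mul, smul_eq_mul, inv_mul_cancel_left₀ this]

lemma cdim_zero (d : ℕ) (h : n * n + 1 ≤ d) : cdim (inv G) d = 0 ∧ cdim (ker G) d = 0 := by
  have h1 := cdim_le G d
  rw [boxd_zero n d h] at h1
  omega

lemma sum_cdim : ∑ j ∈ Finset.range (n * n + 1), cdim (inv G) j = n ! / Nat.card G := by
  have hq : Nat.card (Equiv.Perm (Fin n) ⧸ G) * Nat.card G = n ! := by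
    rw [← Subgroup.card_eq_card_quotient_mul_card_subgroup, Nat.card_perm]
    simp
  rw [← hq, Nat.mul_div_cancel _ Nat.card_pos]
  have h1 := finrank_ev_le (good_inv G) (n * n + 1) (fun d h => (cdim_zero G d h).1)
  have h2 := finrank_ev_le (good_ker G) (n * n + 1) (fun d h => (cdim_zero G d h).2)
  rw [ev_inv, finrank_pull] at h1
  have h3 : (inv G).map (ev n) ⊔ (ker G).map (ev n) = ⊤ := by
    rw [← Submodule.map_sup, ← ev_surj, LinearMap.range_eq_map]
    congr 1
    rw [eq_top_iff]
    intro f _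
    have := Submodule.add_mem_sup (rho_mem G f) (sub_mem_ker G f)
    rwa [add_sub_cancel] at this
  have h4 := Submodule.finrank_add_le_finrank_add_finrank ((inv G).map (ev n)) ((ker G).map (ev n))
  rw [h3, finrank_top, Module.finrank_fintype_fun_eq_card, Fintype.card_perm, Fintype.card_fin,
    ev_inv, finrank_pull] at h4
  have h5 : ∑ j ∈ Finset.range (n * n + 1), (cdim (inv G) j + cdim (ker G) j) ≤ n ! := by
    rw [← sum_boxd]
    exact Finset.sum_le_sum fun d _ => cdim_le G d
  rw [Finset.sum_add_distrib] at h5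
  omega

end group

end HilbSer

/-- The Hilbert series `∑_d h_d z^d` of the invariant ring `ℚ[x₁,…,xₙ]^G` of a permutation
group `G ≤ Sₙ`, multiplied by `∏_{i=1}^{n} (1 − z^i)`, is a polynomial with nonnegative integer
coefficients whose coefficients sum up to `n!/|G|`. -/
theorem hilbert_series_mul_eq_polynomial (n : ℕ) (hn : 0 < n)
    (G : Subgroup (Equiv.Perm (Fin n))) :
    ∃ q : Polynomial ℕ,
      (∀ d : ℕ, PowerSeries.coeff (R := ℚ) d
          ((PowerSeries.mk fun d => (Module.finrank ℚ
              ↥(Subalgebra.toSubmodule (invariantSubalgebra n G) ⊓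
                homogeneousSubmodule (Fin n) ℚ d) : ℚ)) *
            ∏ i ∈ Finset.range n, (1 - (PowerSeries.X : PowerSeries ℚ) ^ (i + 1))) =
          (q.coeff d : ℚ)) ∧
      q.eval 1 = n ! / Nat.card G := by
  refine ⟨∑ d ∈ Finset.range (n * n + 1), Polynomial.monomial d (HilbSer.cdim (HilbSer.inv G) d),
    ?_, ?_⟩
  · intro d
    have h := HilbSer.hilbert_eq G
    unfold HilbSer.comp at h
    rw [h, mul_right_comm, HilbSer.parts_mul, one_mul, PowerSeries.coeff_mk,
      Polynomial.finsetSum_coeff]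
    congr 1
    simp only [Polynomial.coeff_monomial]
    rw [Finset.sum_ite_eq']
    split_ifs with hd
    · rfl
    · exact (HilbSer.cdim_zero G d (by simpa using hd)).1
  · rw [← HilbSer.sum_cdim, Polynomial.eval_finsetSum]
    simp
end
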